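/- Let φ be an anisotropic quadratic form of type (r,s) over F, and let n be the unique integer with 2^n < dim φ ≤ 2^{n+1}. If φ is a Pfister neighbour with ambient general Pfister form π and complementary form φ^c, then: (1) r + s ≤ 2^n; (2) φ₁ ≅ (φ^c)_{F(φ)}, where φ₁ = (φ_{F(φ)})_an; (3) φ has maximal splitting, i.e., dim_Izh(φ) = 2^n. -/

import Mathlib

/-!  Common framework: quadratic forms over a field of characteristic 2, presented by
coefficient matrices, together with the standard invariants used in the paper
"Rationality of cycles modulo 2 on products of generically smooth quadrics in
characteristic 2" by S. Scully and G. Zhu. -/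

open scoped TensorProduct

/-- A quadratic form of dimension `n` over `F`, presented by an `n × n` coefficient
matrix `q`: the associated quadratic form is `x ↦ ∑ i j, q i j * x i * x j`. -/
abbrev QF (F : Type) (n : ℕ) := Matrix (Fin n) (Fin n) F

namespace QF

section Basic

variable {F : Type} [Field F]

/-- The value of a quadratic form at a vector. -/
def eval {n : ℕ} (q : QF F n) (x : Fin n → F) : F := ∑ i, ∑ j, q i j * x i * x j

/-- The polar bilinear form of `q`. -/
def polar {n : ℕ} (q : QF F n) (x y : Fin n → F) : F :=
  eval q (x + y) - eval q x - eval q y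

/-- `q` is isotropic: it vanishes at some nonzero vector. -/
def Isotropic {n : ℕ} (q : QF F n) : Prop := ∃ x, x ≠ 0 ∧ eval q x = 0

/-- `q` is anisotropic: it vanishes only at `0`. -/
def Anisotropic {n : ℕ} (q : QF F n) : Prop := ∀ x, eval q x = 0 → x = 0

/-- The zero form `d ⬝ ⟨0⟩` of dimension `d`. -/
def zeroForm (d : ℕ) : QF F d := 0

/-- Isometry of quadratic forms. -/
def Isom {n m : ℕ} (q : QF F n) (q' : QF F m) : Prop :=
  ∃ e : (Fin n → F) ≃ₗ[F] (Fin m → F), ∀ x, eval q' (e x) = eval q x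

/-- Orthogonal sum of quadratic forms. -/
def orthSum {n m : ℕ} (q : QF F n) (q' : QF F m) : QF F (n + m) :=
  Matrix.reindex finSumFinEquiv finSumFinEquiv (Matrix.fromBlocks q 0 0 q')

/-- The binary quadratic form `[a, b] : (x, y) ↦ a x² + x y + b y²`. -/
def binary (a b : F) : QF F 2 := !![a, 1; 0, b]

/-- The orthogonal sum of the binary forms `[a i, b i]`, `i = 0, …, r - 1`. -/
def binSum {r : ℕ} (a b : Fin r → F) : QF F (r + r) :=
  Matrix.reindex finSumFinEquiv finSumFinEquiv
    (Matrix.fromBlocks (Matrix.diagonal a) 1 0 (Matrix.diagonal b))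

/-- The split form `w ⬝ ℍ`, the orthogonal sum of `w` hyperbolic planes. -/
def hyper (w : ℕ) : QF F (w + w) := binSum 0 0

/-- The quasilinear (diagonal) quadratic form `⟨c 0, …, c (s - 1)⟩`. -/
def diag {s : ℕ} (c : Fin s → F) : QF F s := Matrix.diagonal c

/-- `q` has type `(r, s)` with quasilinear part `⟨c⟩`, i.e.
`q ≃ [a 0, b 0] ⊥ ⋯ ⊥ [a (r-1), b (r-1)] ⊥ ⟨c⟩` for some `a b`. -/
def HasTypeWith {n : ℕ} (q : QF F n) (r s : ℕ) (c : Fin s → F) : Prop :=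
  ∃ a b : Fin r → F, Isom q (orthSum (binSum a b) (diag c))

/-- `q` has type `(r, s)`. -/
def HasType {n : ℕ} (q : QF F n) (r s : ℕ) : Prop := ∃ c : Fin s → F, HasTypeWith q r s c

/-- `q` is quasilinear, i.e. isometric to a diagonal form. -/
def IsQuasilinear {n : ℕ} (q : QF F n) : Prop := ∃ c : Fin n → F, Isom q (diag c)

/-- The isotropy index `i₀(q)`: the maximal dimension of a totally isotropic subspace. -/
noncomputable def i0 {n : ℕ} (q : QF F n) : ℕ :=
  sSup {d | ∃ W : Submodule F (Fin n → F), Module.finrank F W = d ∧ ∀ x ∈ W, eval q x = 0}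

/-- The defect index `i_d(q)`: the maximal dimension of a totally isotropic subspace
contained in the radical of the polar form (equivalently, the isotropy index of the
quasilinear part of `q`, in characteristic 2). -/
noncomputable def defect {n : ℕ} (q : QF F n) : ℕ :=
  sSup {d | ∃ W : Submodule F (Fin n → F), Module.finrank F W = d ∧
    (∀ x ∈ W, eval q x = 0) ∧ ∀ x ∈ W, ∀ y, polar q x y = 0}

/-- `q` is nondefective. -/
def Nondefective {n : ℕ} (q : QF F n) : Prop := defect q = 0

/-- The Witt index `i_W(q)`: the maximal number of hyperbolic planes splitting off `q`. -/
noncomputable def wittIndex {n : ℕ} (q : QF F n) : ℕ :=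
  sSup {w | ∃ (m : ℕ) (q' : QF F m), Isom q (orthSum q' (hyper w))}

/-- `qa` is the anisotropic part of `q`: `qa` is anisotropic and
`q ≃ qa ⊥ w ⬝ ℍ ⊥ d ⬝ ⟨0⟩` (Witt decomposition). -/
def IsAnisotropicPart {n m : ℕ} (q : QF F n) (qa : QF F m) : Prop :=
  Anisotropic qa ∧ ∃ w d : ℕ, Isom q (orthSum (orthSum qa (hyper w)) (zeroForm d))

/-- Witt equivalence: `q` and `q'` have isometric anisotropic parts. -/
def WittEquiv {n m : ℕ} (q : QF F n) (q' : QF F m) : Prop :=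
  ∃ (k : ℕ) (qa : QF F k), IsAnisotropicPart q qa ∧ IsAnisotropicPart q' qa

/-- `p` is dominated by `q` (`p ≺ q`): `p` is isometric to the restriction of `q` to a
subspace of the underlying space of `q`. -/
def Dominated {m n : ℕ} (p : QF F m) (q : QF F n) : Prop :=
  ∃ f : (Fin m → F) →ₗ[F] (Fin n → F), Function.Injective f ∧ ∀ x, eval q (f x) = eval p x

/-- `p` is a subform (orthogonal direct summand) of `q`. -/
def Subform {m n : ℕ} (p : QF F m) (q : QF F n) : Prop :=
  ∃ (k : ℕ) (p' : QF F k), Isom q (orthSum p p')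

/-- Base change of a quadratic form along a field extension `K/F`. -/
def baseChange {n : ℕ} (q : QF F n) (K : Type) [Field K] [Algebra F K] : QF K n :=
  q.map (algebraMap F K)

/-- Transport a quadratic form along an equality of dimensions. -/
def castQF {n m : ℕ} (h : n = m) (q : QF F n) : QF F m :=
  Matrix.reindex (finCongr h) (finCongr h) q

/-- The orthogonal sum of the first `h` members of a family of quadratic forms. -/
noncomputable def sumFam {D : ℕ → ℕ} (f : ∀ i, QF F (D i)) :
    (h : ℕ) → QF F (∑ i ∈ Finset.range h, D i)
  | 0 => castQF (by simp) (zeroForm 0)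
  | h + 1 => castQF (Finset.sum_range_succ D h).symm (orthSum (sumFam f h) (f h))

/-- The Gram matrix of the `k`-fold bilinear Pfister form `⟪a 0, …, a (k-1)⟫_b`. -/
noncomputable def bPfister {k : ℕ} (a : Fin k → F) :
    Matrix (Fin (2 ^ k)) (Fin (2 ^ k)) F :=
  Matrix.reindex finFunctionFinEquiv finFunctionFinEquiv
    (Matrix.diagonal fun f : Fin k → Fin 2 => ∏ i, if f i = 1 then a i else 1)

/-- The `(k+1)`-fold quadratic Pfister form `⟪a 0, …, a (k-1)⟫_b ⊗ [1, c]`. -/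
noncomputable def qPfister {k : ℕ} (a : Fin k → F) (c : F) : QF F (2 ^ k * 2) :=
  Matrix.reindex finProdFinEquiv finProdFinEquiv
    (Matrix.kroneckerMap (· * ·) (bPfister a) (binary 1 c))

/-- `π` is a `(k+1)`-fold quadratic Pfister form. -/
def IsPfister {m : ℕ} (k : ℕ) (π : QF F m) : Prop :=
  ∃ (a : Fin k → F) (c : F), Isom π (qPfister a c)

/-- `π` is a general `(k+1)`-fold Pfister form: a nonzero scalar multiple of a
`(k+1)`-fold quadratic Pfister form. -/
def IsGenPfister {m : ℕ} (k : ℕ) (π : QF F m) : Prop :=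
  ∃ d : F, d ≠ 0 ∧ ∃ (a : Fin k → F) (c : F), Isom π (d • qPfister a c)

/-- `q` is a Pfister neighbour: `2 ^ k < dim q ≤ 2 ^ (k + 1)` and `q` is dominated by a
general `(k+1)`-fold Pfister form (domination forces `dim q ≤ 2 ^ (k + 1)`). -/
def IsPfisterNeighbour {n : ℕ} (q : QF F n) : Prop :=
  ∃ (k : ℕ) (π : QF F (2 ^ k * 2)), 2 ^ k < n ∧ IsGenPfister k π ∧ Dominated q π

/-- `qc` is the complementary form of the Pfister neighbour `q` in its ambient general
Pfister form `π`: it is the nondefective form of dimension `2 ^ (k + 1) - dim q` which is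
Witt equivalent to `q ⊥ π` (this pins down `qc` up to isometry). -/
def IsComplement {n k m : ℕ} (q : QF F n) (π : QF F (2 ^ k * 2)) (qc : QF F m) : Prop :=
  m = 2 ^ k * 2 - n ∧ Nondefective qc ∧ WittEquiv (orthSum q π) qc

/-- `qc` is the complementary form of the Pfister neighbour `q`. -/
def IsComplementOf {n m : ℕ} (q : QF F n) (qc : QF F m) : Prop :=
  ∃ (k : ℕ) (π : QF F (2 ^ k * 2)), 2 ^ k < n ∧ IsGenPfister k π ∧ Dominated q π ∧
    IsComplement q π qc

/-- The polynomial of the quadric `{q = 0}` in the affine chart where the last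
projective coordinate equals `1`. -/
noncomputable def affinePoly {n : ℕ} (q : QF F n) : MvPolynomial (Fin (n - 1)) F :=
  ∑ i : Fin n, ∑ j : Fin n,
    MvPolynomial.C (q i j) *
      (if h : (i : ℕ) < n - 1 then MvPolynomial.X (⟨(i : ℕ), h⟩ : Fin (n - 1)) else 1) *
      (if h : (j : ℕ) < n - 1 then MvPolynomial.X (⟨(j : ℕ), h⟩ : Fin (n - 1)) else 1)

/-- `K` is a model of the function field `F(q)` of the projective quadric `{q = 0}`:
`K` is the fraction field of the affine coordinate ring of the (dense) standard affine
chart of the quadric. -/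
def IsFunctionField {n : ℕ} (q : QF F n) (K : Type) [Field K] [Algebra F K] : Prop :=
  ∃ f : MvPolynomial (Fin (n - 1)) F →ₐ[F] K,
    RingHom.ker f = Ideal.span {affinePoly q} ∧
    IntermediateField.adjoin F (Set.range fun i => f (MvPolynomial.X i)) = ⊤

end Basic

/-- A bundled field extension of `F`. -/
structure FieldExt (F : Type) [Field F] : Type 1 where
  carrier : Type
  [fieldInst : Field carrier]
  [algInst : Algebra F carrier]

attribute [instance] FieldExt.fieldInst FieldExt.algInst

/-- `K/F` is a separable field extension (MacLane's criterion: `K ⊗_F L` is reduced for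
every purely inseparable extension `L/F`). -/
def IsSepExt (F : Type) [Field F] (K : Type) [Field K] [Algebra F K] : Prop :=
  ∀ (L : Type) [Field L] [Algebra F L], IsPurelyInseparable F L → IsReduced (K ⊗[F] L)

/-- `K/F` is purely transcendental: `K` is generated over `F` by an algebraically
independent subset. -/
def IsPurelyTranscendentalExt (F : Type) [Field F] (K : Type) [Field K] [Algebra F K] :
    Prop :=
  ∃ s : Set K, AlgebraicIndependent F (fun x : s => (x : K)) ∧
    IntermediateField.adjoin F s = ⊤

section Invariants

variable {F : Type} [Field F]

/-- `p` and `q` are stably birationally equivalent: over every field extension of `F`,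
`p` is isotropic if and only if `q` is (for anisotropic forms of dimension at least 2
this is equivalent to stable birationality of the associated projective quadrics). -/
def SBEquiv {m n : ℕ} (p : QF F m) (q : QF F n) : Prop :=
  ∀ (K : Type) [Field K] [Algebra F K],
    (Isotropic (baseChange p K) ↔ Isotropic (baseChange q K))

/-- The first higher isotropy index `i₁(q)` of an anisotropic form: the minimal positive
isotropy index attained over field extensions of `F`. -/
noncomputable def i1 {n : ℕ} (q : QF F n) : ℕ :=
  sInf {i | 0 < i ∧ ∃ K : FieldExt F, i0 (baseChange q K.carrier) = i}

/-- The Izhboldin dimension `dim q - i₁(q)`. -/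
noncomputable def izh {n : ℕ} (q : QF F n) : ℕ := n - i1 q

/-- The nondefective splitting pattern of a nondefective form `q`: the set of Witt
indices attained by `q` over separable field extensions of `F`. -/
def splittingPattern {n : ℕ} (q : QF F n) : Set ℕ :=
  {w | ∃ K : FieldExt F, IsSepExt F K.carrier ∧ wittIndex (baseChange q K.carrier) = w}

/-- The nondefective height `h_nd(q)`. -/
noncomputable def hnd {n : ℕ} (q : QF F n) : ℕ := (splittingPattern q).ncard - 1

/-- `jrel q t = j_t(q)`: the `t`-th value (in increasing order) of the nondefective
splitting pattern of `q`. -/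
noncomputable def jrel {n : ℕ} (q : QF F n) (t : ℕ) : ℕ :=
  sInf {w | w ∈ splittingPattern q ∧ {w' | w' ∈ splittingPattern q ∧ w' < w}.ncard = t}

/-- `irel q t = i_t(q) = j_t(q) - j_(t-1)(q)`: the `t`-th higher Witt index of `q`. -/
noncomputable def irel {n : ℕ} (q : QF F n) (t : ℕ) : ℕ := jrel q t - jrel q (t - 1)

/-- `q` is a virtual Pfister neighbour: it becomes an anisotropic Pfister neighbour
over some field extension of `F`. -/
def IsVirtualPfisterNeighbour {n : ℕ} (q : QF F n) : Prop :=
  ∃ K : FieldExt F, Anisotropic (baseChange q K.carrier) ∧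
    IsPfisterNeighbour (baseChange q K.carrier)

end Invariants

/-! ### The combinatorics of `Λ(X)` and the motivic decomposition type -/

/-- Formal symbols `i_lo` and `iᵘᵖ` indexing the Tate motives of a split quadric. -/
inductive Sym : Type
  | lo : ℤ → Sym
  | up : ℤ → Sym
  deriving DecidableEq

/-- Shift of a symbol by `j`. -/
def Sym.shift (j : ℤ) : Sym → Sym
  | .lo i => .lo (i + j)
  | .up i => .up (i + j)

/-- The shift `Λ[j]` of a set of symbols. -/
def shiftSet (Λ : Set Sym) (j : ℤ) : Set Sym := Sym.shift j '' Λ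

/-- The set `Λ(X)` for a quadric `X` of dimension `d` attached to a form of type
`(r, s)`: the symbols `i_lo` for `0 ≤ i < r` and `iᵘᵖ` for `d - r < i ≤ d`. -/
def LamSet (r d : ℤ) : Set Sym :=
  {x | (∃ i : ℤ, x = Sym.lo i ∧ 0 ≤ i ∧ i < r) ∨ ∃ i : ℤ, x = Sym.up i ∧ d - r < i ∧ i ≤ d}

/-- `a(Λ) = m`: `m` is the least index `i` with `i_lo ∈ Λ`. -/
def IsALower (Λ : Set Sym) (m : ℤ) : Prop :=
  Sym.lo m ∈ Λ ∧ ∀ i : ℤ, Sym.lo i ∈ Λ → m ≤ i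

/-- `b(Λ) = m`: `m` is the largest index `i` with `iᵘᵖ ∈ Λ`. -/
def IsBUpper (Λ : Set Sym) (m : ℤ) : Prop :=
  Sym.up m ∈ Λ ∧ ∀ i : ℤ, Sym.up i ∈ Λ → i ≤ m

/-- The member of a partition `M` of `Λ(X)` containing `0_lo`: the upper connected
component `Λᵁ(X)`. -/
def upperComp (M : Set (Set Sym)) : Set Sym := ⋃₀ {Λ | Λ ∈ M ∧ Sym.lo 0 ∈ Λ}

/-- An abstract theory of `F`-rational algebraic cycles modulo 2 of middle dimension on
the squares of generically smooth nondefective quadrics, as constructed in §§4–7 of the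
paper: `RatCyc K q` is the family of subsets `Λ ⊆ Λ(X_q)` whose associated cycle
`α_Λ = ∑_{λ ∈ Λ} α_λ` is an `F`-rational element of `Ch̄_{d_X}(X_q²)` (the image of
`CH_{d_X}(X_q²)/2 → CH_{d_X}((X_q²)_F̄)/2`).  The formal properties recorded here are
those established in the paper: the family is an `𝔽₂`-subspace (closed under symmetric
difference), is closed under intersections, consists of subsets of `Λ(X_q)`, and
contains `Λ(X_q)` itself. -/
structure MDTTheory : Type 1 where
  RatCyc : ∀ (K : Type) [Field K] {n : ℕ} (q : QF K n), Set (Set Sym)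
  inter_mem : ∀ (K : Type) [Field K] {n : ℕ} (q : QF K n),
    ∀ Λ₁ ∈ RatCyc K q, ∀ Λ₂ ∈ RatCyc K q, Λ₁ ∩ Λ₂ ∈ RatCyc K q
  symmDiff_mem : ∀ (K : Type) [Field K] {n : ℕ} (q : QF K n),
    ∀ Λ₁ ∈ RatCyc K q, ∀ Λ₂ ∈ RatCyc K q, symmDiff Λ₁ Λ₂ ∈ RatCyc K q
  subset_lam : ∀ (K : Type) [Field K] {n : ℕ} (q : QF K n) (r s : ℕ),
    HasType q r s → ∀ Λ ∈ RatCyc K q, Λ ⊆ LamSet (r : ℤ) ((n : ℤ) - 2)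
  lam_mem : ∀ (K : Type) [Field K] {n : ℕ} (q : QF K n) (r s : ℕ),
    HasType q r s → LamSet (r : ℤ) ((n : ℤ) - 2) ∈ RatCyc K q

/-- The motivic decomposition type `MDT(q)`: the partition of `Λ(X_q)` into the supports
of the indecomposable rational cycles, i.e. the minimal nonempty members of the family
of rational subsets. -/
def MDTTheory.MDT (T : MDTTheory) (K : Type) [Field K] {n : ℕ} (q : QF K n) :
    Set (Set Sym) :=
  {Λ | Λ ∈ T.RatCyc K q ∧ Λ.Nonempty ∧
    ∀ Λ' ∈ T.RatCyc K q, Λ' ⊆ Λ → Λ' = ∅ ∨ Λ' = Λ}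

end QF

namespace PN
open QuadraticMap
set_option linter.all false

theorem qadd {R V : Type} [CommRing R] [AddCommGroup V] [Module R V] (Q : QuadraticForm R V)
    (x y : V) : Q (x + y) = Q x + Q y + polar Q x y := QuadraticMap.map_add Q x y

section CR
variable {R : Type} [CommRing R] {ι κ : Type} [Fintype ι] [Fintype κ]

/-- The quadratic form attached to a coefficient matrix. -/
noncomputable def qf (A : Matrix ι ι R) : QuadraticForm R (ι → R) :=
  ∑ i, ∑ j, A i j • QuadraticMap.linMulLin (LinearMap.proj i) (LinearMap.proj j)

theorem qf_apply (A : Matrix ι ι R) (x : ι → R) :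
    qf A x = ∑ i, ∑ j, A i j * x i * x j := by
  simp [qf, mul_assoc]

theorem qf_map {S : Type} [CommRing S] (φ : R →+* S) (A : Matrix ι ι R) (x : ι → R) :
    qf (A.map φ) (φ ∘ x) = φ (qf A x) := by
  simp [qf_apply, map_sum]

theorem polar_map {S : Type} [CommRing S] (φ : R →+* S) (A : Matrix ι ι R) (x y : ι → R) :
    polar (qf (A.map φ)) (φ ∘ x) (φ ∘ y) = φ (polar (qf A) x y) := by
  have : φ ∘ x + φ ∘ y = φ ∘ (x + y) := by ext i; simp
  simp only [polar, this, qf_map, map_sub]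

/-- Linear combination of a family of vectors. -/
noncomputable def lc (a : κ → ι → R) : (κ → R) →ₗ[R] (ι → R) := Fintype.linearCombination R a

theorem lc_apply (a : κ → ι → R) (z : κ → R) : lc a z = ∑ l, z l • a l := rfl

theorem lc_single [DecidableEq κ] (a : κ → ι → R) (l : κ) : lc a (Pi.single l 1) = a l := by
  simp [lc, Fintype.linearCombination_apply_single]

theorem lc_map {S : Type} [CommRing S] (φ : R →+* S) (a : κ → ι → R) (z : κ → R) :
    lc (fun l => φ ∘ a l) (φ ∘ z) = φ ∘ lc a z := by
  ext i; simp [lc_apply]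

theorem eq_lc [DecidableEq κ] (f : (κ → R) →ₗ[R] (ι → R)) :
    lc (fun l => f (Pi.single l 1)) = f := by
  apply LinearMap.pi_ext'
  intro i
  ext
  simp [lc, Fintype.linearCombination_apply_single]

theorem qform_ext [DecidableEq κ] (Q Q' : QuadraticForm R (κ → R))
    (h : ∀ i, Q (Pi.single i 1) = Q' (Pi.single i 1))
    (h2 : ∀ i j, polar Q (Pi.single i 1) (Pi.single j 1) = polar Q' (Pi.single i 1) (Pi.single j 1)) :
    Q = Q' := by
  ext z
  have key : ∀ s : Finset κ, Q (∑ i ∈ s, z i • Pi.single i (1:R)) = Q' (∑ i ∈ s, z i • Pi.single i (1:R)) := by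
    intro s
    induction s using Finset.induction_on with
    | empty => simp
    | insert a s ha ih =>
      rw [Finset.sum_insert ha, qadd, qadd, ih, QuadraticMap.map_smul, QuadraticMap.map_smul, h]
      congr 1
      change QuadraticMap.polarBilin Q _ _ = QuadraticMap.polarBilin Q' _ _
      simp [map_sum, h2]
  have hz : z = ∑ i, z i • Pi.single i (1:R) := by
    conv_lhs => rw [pi_eq_sum_univ' z]
  rw [hz]; exact key _

theorem map_single {S : Type} [CommRing S] [DecidableEq κ] (φ : R →+* S) (i : κ) :
    (Pi.single i (1:S) : κ → S) = φ ∘ (Pi.single i (1:R)) := by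
  ext j; by_cases h : j = i
  · subst h; simp
  · simp [h]

theorem qf_lc_map {S : Type} [CommRing S] (φ : R →+* S) (A : Matrix ι ι R) (B : Matrix κ κ R)
    (a : κ → ι → R) (c : R) (h : ∀ z, qf A (lc a z) = c * qf B z) (z : κ → S) :
    qf (A.map φ) (lc (fun l => φ ∘ a l) z) = φ c * qf (B.map φ) z := by
  classical
  have hp : ∀ z w, polar (qf A) (lc a z) (lc a w) = c * polar (qf B) z w := by
    intro z w
    simp only [polar, ← map_add, h]; ring
  have : (qf (A.map φ)).comp (lc (fun l => φ ∘ a l)) = φ c • qf (B.map φ) := by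
    apply qform_ext
    · intro i
      simp only [comp_apply, smul_apply, smul_eq_mul]
      rw [map_single φ, lc_map, qf_map, qf_map, h, map_mul]
    · intro i j
      rw [map_single φ i, map_single φ j]
      have := hp (Pi.single i 1) (Pi.single j 1)
      have e1 : ∀ x y, polar ((qf (A.map φ)).comp (lc (fun l => φ ∘ a l))) x y
         = polar (qf (A.map φ)) (lc (fun l => φ ∘ a l) x) (lc (fun l => φ ∘ a l) y) := by
        intro x y; simp [polar]
      rw [e1, lc_map, lc_map, polar_map, this, map_mul, ← polar_map]
      simp only [polar, smul_apply, smul_eq_mul]; ring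
  have := congrArg (fun Q => Q z) this
  simpa using this

theorem polar_lc_map {S : Type} [CommRing S] (φ : R →+* S) (A : Matrix ι ι R)
    {κ' : Type} [Fintype κ'] (a : κ → ι → R) (b : κ' → ι → R)
    (B : κ → κ' → R)
    (h : ∀ i j, polar (qf A) (a i) (b j) = B i j) (z : κ → S) (w : κ' → S) :
    polar (qf (A.map φ)) (lc (fun l => φ ∘ a l) z) (lc (fun l => φ ∘ b l) w) =
      ∑ i, ∑ j, φ (B i j) * z i * w j := by
  change QuadraticMap.polarBilin _ _ _ = _
  simp only [lc_apply, map_sum, LinearMap.sum_apply, map_smul, LinearMap.smul_apply,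
    polarBilin_apply_apply, polar_map, h, smul_eq_mul]
  rw [Finset.sum_comm]
  refine Finset.sum_congr rfl fun i _ => ?_
  rw [Finset.mul_sum]
  refine Finset.sum_congr rfl fun j _ => ?_
  ring

theorem qf_reindex (e : ι ≃ κ) (A : Matrix ι ι R) (x : κ → R) :
    qf (Matrix.reindex e e A) x = qf A (x ∘ e) := by
  simp only [qf_apply, Matrix.reindex_apply, Matrix.submatrix_apply]
  rw [← e.sum_comp]
  refine Finset.sum_congr rfl fun i _ => ?_
  rw [← e.sum_comp]; simp

theorem qf_fromBlocks (A : Matrix ι ι R) (B : Matrix ι κ R) (C : Matrix κ ι R)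
    (D : Matrix κ κ R) (x : ι ⊕ κ → R) :
    qf (Matrix.fromBlocks A B C D) x = qf A (x ∘ Sum.inl) + qf D (x ∘ Sum.inr)
      + ((∑ i, ∑ j, B i j * x (.inl i) * x (.inr j)) + ∑ i, ∑ j, C i j * x (.inr i) * x (.inl j)) := by
  simp only [qf_apply, Fintype.sum_sum_type, Matrix.fromBlocks_apply₁₁, Matrix.fromBlocks_apply₁₂,
    Matrix.fromBlocks_apply₂₁, Matrix.fromBlocks_apply₂₂, Finset.sum_add_distrib, Function.comp]
  ring

theorem qf_smul (c : R) (A : Matrix ι ι R) (x : ι → R) : qf (c • A) x = c * qf A x := by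
  simp [qf_apply, Finset.mul_sum, mul_assoc]

theorem polar_smulm (c : R) (A : Matrix ι ι R) (x y : ι → R) :
    polar (qf (c • A)) x y = c * polar (qf A) x y := by
  simp only [polar, qf_smul]; ring

end CR

/-- Anisotropy. -/
def An {F V : Type} [Field F] [AddCommGroup V] [Module F V] (Q : QuadraticForm F V) : Prop :=
  ∀ x, Q x = 0 → x = 0

/-- Nondegeneracy of the polar form. -/
def ND {F V : Type} [Field F] [AddCommGroup V] [Module F V] (Q : QuadraticForm F V) : Prop :=
  ∀ x, (∀ y, polar Q x y = 0) → x = 0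

section Fld
variable {F V W : Type} [Field F] [AddCommGroup V] [Module F V] [AddCommGroup W] [Module F W]

theorem not_An {Q : QuadraticForm F V} : ¬ An Q ↔ ∃ x, x ≠ 0 ∧ Q x = 0 := by
  simp only [An, not_forall]
  exact ⟨fun ⟨x, h, h'⟩ => ⟨x, h', h⟩, fun ⟨x, h, h'⟩ => ⟨x, h', h⟩⟩

theorem polar_of_isom {Q : QuadraticForm F V} {Q' : QuadraticForm F W} {f : V →ₗ[F] W}
    {c : F} (h : ∀ x, Q' (f x) = c * Q x) (x y : V) :
    polar Q' (f x) (f y) = c * polar Q x y := by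
  simp only [polar, ← map_add, h]; ring

theorem polar_of_isom' {Q : QuadraticForm F V} {Q' : QuadraticForm F W} {f : V →ₗ[F] W}
    (h : ∀ x, Q' (f x) = Q x) (x y : V) :
    polar Q' (f x) (f y) = polar Q x y := by
  simp only [polar, ← map_add, h]

theorem inj_of_An {Q : QuadraticForm F V} (hQ : An Q) {Q' : QuadraticForm F W} {f : V →ₗ[F] W}
    {c : F} (hc : c ≠ 0) (h : ∀ x, Q' (f x) = c * Q x) : Function.Injective f := by
  rw [injective_iff_map_eq_zero]
  intro x hx
  apply hQ
  have := h x
  rw [hx, QuadraticMap.map_zero] at this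
  simpa [hc] using this.symm

/-- Reflection in an anisotropic vector. -/
noncomputable def rfl' (Q : QuadraticForm F V) (d : V) : V →ₗ[F] V :=
  LinearMap.id - ((Q d)⁻¹ • (Q.polarBilin d)).smulRight d

theorem rfl'_apply (Q : QuadraticForm F V) (d x : V) :
    rfl' Q d x = x - ((Q d)⁻¹ * polar Q d x) • d := by
  simp [rfl']

theorem rfl'_isom (Q : QuadraticForm F V) {d : V} (hd : Q d ≠ 0) (x : V) :
    Q (rfl' Q d x) = Q x := by
  rw [rfl'_apply, sub_eq_add_neg, qadd, ← neg_smul, QuadraticMap.map_smul,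
    polar_smul_right, polar_comm Q x d]
  simp only [smul_eq_mul]
  field_simp; ring

theorem rfl'_rfl' (Q : QuadraticForm F V) {d : V} (hd : Q d ≠ 0) (x : V) :
    rfl' Q d (rfl' Q d x) = x := by
  simp only [rfl'_apply, polar_sub_right, polar_smul_right, polar_self, smul_eq_mul,sub_sub, ← add_smul]
  rw [show (Q d)⁻¹ * polar Q d x + (Q d)⁻¹ * (polar Q d x - (Q d)⁻¹ * polar Q d x * (2 • Q d)) = 0 by
    field_simp; simp [two_mul]]
  simp

theorem rfl'_fix (Q : QuadraticForm F V) {d x : V} (h : polar Q d x = 0) : rfl' Q d x = x := by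
  simp [rfl'_apply, h]

/-- The reflection in `x - y` maps `x` to `y` when `Q x = Q y`. -/
theorem rfl'_move (Q : QuadraticForm F V) {x y : V} (h : Q x = Q y) (hd : Q (x - y) ≠ 0) :
    rfl' Q (x - y) x = y := by
  have e : Q (x - y) = polar Q (x - y) x := by
    have h1 : Q (x - y) = Q x + Q y - polar Q x y := by
      rw [sub_eq_add_neg, qadd, polar_neg_right, QuadraticMap.map_neg]; ring
    rw [h1, polar_sub_left, polar_self, polar_comm Q y x, ← h]; simp; ring
  rw [rfl'_apply, ← e, inv_mul_cancel₀ hd]; simp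

end Fld
end PN

namespace PN
open QuadraticMap
set_option linter.all false

section
variable {K : Type} [Field K] {ι : Type} [Fintype ι]

def Round (A : Matrix ι ι K) : Prop := ∀ v, qf A v ≠ 0 →
  ∃ S : (ι → K) →ₗ[K] (ι → K), ∀ x, qf A (S x) = qf A v * qf A x

def Half (A : Matrix ι ι K) : Prop := (∃ x, x ≠ 0 ∧ qf A x = 0) →
  ∃ (ζ : Type) (_ : Fintype ζ) (f : (ζ → K) →ₗ[K] (ι → K)), Function.Injective f ∧
    2 * Fintype.card ζ = Fintype.card ι ∧ ∀ x, qf A (f x) = 0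

def dbl (A : Matrix ι ι K) (a : K) : Matrix (ι ⊕ ι) (ι ⊕ ι) K := Matrix.fromBlocks A 0 0 (a • A)

theorem dbl_map {L : Type} [Field L] (φ : K →+* L) (A : Matrix ι ι K) (a : K) :
    (dbl A a).map φ = dbl (A.map φ) (φ a) := by
  ext i j; rcases i with i | i <;> rcases j with j | j <;> simp [dbl]

theorem qf_dbl (A : Matrix ι ι K) (a : K) (x : ι ⊕ ι → K) :
    qf (dbl A a) x = qf A (x ∘ Sum.inl) + a * qf A (x ∘ Sum.inr) := by
  rw [dbl, qf_fromBlocks, qf_smul]; simp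

theorem qf_dbl_elim (A : Matrix ι ι K) (a : K) (x y : ι → K) :
    qf (dbl A a) (Sum.elim x y) = qf A x + a * qf A y := by
  rw [qf_dbl]; simp

theorem polar_dbl (A : Matrix ι ι K) (a : K) (x y : ι ⊕ ι → K) :
    polar (qf (dbl A a)) x y = polar (qf A) (x ∘ Sum.inl) (y ∘ Sum.inl)
      + a * polar (qf A) (x ∘ Sum.inr) (y ∘ Sum.inr) := by
  have e1 : (x + y) ∘ Sum.inl = x ∘ Sum.inl + y ∘ Sum.inl := rfl
  have e2 : (x + y) ∘ Sum.inr = x ∘ Sum.inr + y ∘ Sum.inr := rfl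
  simp only [polar, qf_dbl, e1, e2]; ring

theorem polar_dbl_elim (A : Matrix ι ι K) (a : K) (x y x' y' : ι → K) :
    polar (qf (dbl A a)) (Sum.elim x y) (Sum.elim x' y') = polar (qf A) x x'
      + a * polar (qf A) y y' := by
  rw [polar_dbl]; simp

/-- Pairing of two linear maps into a space of functions on a sum type. -/
def pair {κ V : Type} [AddCommGroup V] [Module K V] (f : V →ₗ[K] (ι → K)) (g : V →ₗ[K] (κ → K)) :
    V →ₗ[K] (ι ⊕ κ → K) where
  toFun x := Sum.elim (f x) (g x)
  map_add' x y := by ext i; rcases i with i | i <;> simp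
  map_smul' c x := by ext i; rcases i with i | i <;> simp

theorem pair_apply {κ V : Type} [AddCommGroup V] [Module K V] (f : V →ₗ[K] (ι → K))
    (g : V →ₗ[K] (κ → K)) (x : V) : pair f g x = Sum.elim (f x) (g x) := rfl

def pl (K : Type) [Field K] (ι κ : Type) : (ι ⊕ κ → K) →ₗ[K] (ι → K) := LinearMap.funLeft K K Sum.inl
def pr (K : Type) [Field K] (ι κ : Type) : (ι ⊕ κ → K) →ₗ[K] (κ → K) := LinearMap.funLeft K K Sum.inr

theorem pl_elim {κ : Type} (x : ι → K) (y : κ → K) : pl K ι κ (Sum.elim x y) = x := rfl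
theorem pr_elim {κ : Type} (x : ι → K) (y : κ → K) : pr K ι κ (Sum.elim x y) = y := rfl
theorem elim_pl_pr {κ : Type} (x : ι ⊕ κ → K) : Sum.elim (pl K ι κ x) (pr K ι κ x) = x := by
  ext i; rcases i with i | i <;> rfl

theorem qf_dbl' (A : Matrix ι ι K) (a : K) (x : ι ⊕ ι → K) :
    qf (dbl A a) x = qf A (pl K ι ι x) + a * qf A (pr K ι ι x) := qf_dbl A a x

theorem round_dbl {A : Matrix ι ι K} (h : Round A) (a : K) : Round (dbl A a) := by
  intro v hv
  rw [qf_dbl'] at hv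
  rw [qf_dbl' A a v]
  set α := qf A (pl K ι ι v) with hα
  set β := qf A (pr K ι ι v) with hβ
  by_cases h1 : a * β = 0
  · rw [h1, add_zero] at hv ⊢
    obtain ⟨S, hS⟩ := h _ hv
    refine ⟨pair (S.comp (pl K ι ι)) (S.comp (pr K ι ι)), fun x => ?_⟩
    rw [pair_apply, qf_dbl_elim, qf_dbl']
    simp only [LinearMap.comp_apply, hS]; rw [← hα]; ring
  · have hb : β ≠ 0 := fun h' => h1 (by simp [h'])
    have ha : a ≠ 0 := fun h' => h1 (by simp [h'])
    obtain ⟨T, hT⟩ := h _ hb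
    by_cases h2 : α = 0
    · refine ⟨pair (a • (T.comp (pr K ι ι))) (T.comp (pl K ι ι)), fun x => ?_⟩
      rw [pair_apply, qf_dbl_elim, qf_dbl', h2]
      simp only [LinearMap.comp_apply, LinearMap.smul_apply, QuadraticMap.map_smul, hT, smul_eq_mul]
      rw [← hβ]; ring
    · obtain ⟨S, hS⟩ := h _ h2
      let Y : (ι ⊕ ι → K) →ₗ[K] (ι → K) := ((α * β)⁻¹) • (S.comp (T.comp (pr K ι ι)))
      have hY : ∀ x, α * β * qf A (Y x) = qf A (pr K ι ι x) := by
        intro x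
        simp only [Y, LinearMap.comp_apply, LinearMap.smul_apply, QuadraticMap.map_smul, hT, hS, smul_eq_mul]
        rw [← hβ, ← hα]; field_simp
      refine ⟨pair (S.comp (pl K ι ι + (a * β) • Y)) (T.comp (pl K ι ι - α • Y)), fun x => ?_⟩
      rw [pair_apply, qf_dbl_elim, qf_dbl', ← hY x]
      simp only [LinearMap.comp_apply, hS, hT, LinearMap.add_apply, LinearMap.smul_apply, LinearMap.sub_apply]
      rw [← hβ, ← hα, sub_eq_add_neg, ← neg_smul, qadd, qadd, QuadraticMap.map_smul, QuadraticMap.map_smul,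
        polar_smul_right, polar_smul_right]
      simp only [smul_eq_mul]; ring

theorem half_dbl {A : Matrix ι ι K} (h : Round A) (hh : Half A) (a : K) : Half (dbl A a) := by
  rintro ⟨v, hv, hv0⟩
  by_cases hA : ∃ x, x ≠ 0 ∧ qf A x = 0
  · obtain ⟨ζ, _, f, hf, hc, h0⟩ := hh hA
    refine ⟨ζ ⊕ ζ, inferInstance, pair (f.comp (pl K ζ ζ)) (f.comp (pr K ζ ζ)), ?_, ?_, ?_⟩
    · intro x y hxy
      have e1 : f (pl K ζ ζ x) = f (pl K ζ ζ y) := congrArg (pl K ι ι) hxy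
      have e2 : f (pr K ζ ζ x) = f (pr K ζ ζ y) := congrArg (pr K ι ι) hxy
      rw [← elim_pl_pr x, ← elim_pl_pr y, hf e1, hf e2]
    · simp; omega
    · intro x; rw [pair_apply, qf_dbl_elim]; simp [h0]
  · push Not at hA
    by_cases ha : a = 0
    · refine ⟨ι, inferInstance, pair 0 LinearMap.id, ?_, ?_, ?_⟩
      · intro x y hxy; exact congrArg (pr K ι ι) hxy
      · simp; omega
      · intro x; rw [pair_apply, qf_dbl_elim]; simp [ha]
    · rw [qf_dbl'] at hv0
      have hr : pr K ι ι v ≠ 0 := by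
        intro hr
        rw [hr, QuadraticMap.map_zero, mul_zero, add_zero] at hv0
        have hl : pl K ι ι v = 0 := by
          by_contra hl; exact hA _ hl hv0
        apply hv
        rw [← elim_pl_pr v, hl, hr]; ext i; rcases i with i | i <;> rfl
      have hb := hA _ hr
      obtain ⟨T, hT⟩ := h _ hb
      have hl : qf A (pl K ι ι v) = - a * qf A (pr K ι ι v) := by linear_combination hv0
      have hl' : qf A (pl K ι ι v) ≠ 0 := by rw [hl]; simp [ha, hb]
      obtain ⟨S, hS⟩ := h _ hl'
      refine ⟨ι, inferInstance, pair ((qf A (pr K ι ι v))⁻¹ • (S.comp T)) LinearMap.id, ?_, ?_, ?_⟩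
      · intro x y hxy; exact congrArg (pr K ι ι) hxy
      · simp; omega
      · intro x; rw [pair_apply, qf_dbl_elim]
        simp only [LinearMap.comp_apply, LinearMap.smul_apply, QuadraticMap.map_smul, hT, hS, smul_eq_mul, LinearMap.id_apply, hl]
        field_simp; ring

theorem An_dbl {A : Matrix ι ι K} {a : K} [Nonempty ι] (h : An (qf (dbl A a))) : An (qf A) ∧ a ≠ 0 := by
  constructor
  · intro x hx
    have := h (Sum.elim x 0) (by rw [qf_dbl_elim]; simp [hx])
    exact congrArg (pl K ι ι) this
  · rintro rfl
    have := h (Sum.elim 0 1) (by rw [qf_dbl_elim]; simp)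
    have e := congrFun (congrArg (pr K ι ι) this) (Classical.arbitrary ι)
    rw [pr_elim] at e
    exact one_ne_zero e

theorem nd_dbl {A : Matrix ι ι K} {a : K} (h : ND (qf A)) (ha : a ≠ 0) : ND (qf (dbl A a)) := by
  intro x hx
  rw [← elim_pl_pr x] at hx ⊢
  have h1 : pl K ι ι x = 0 := by
    apply h; intro y
    have := hx (Sum.elim y 0)
    rw [polar_dbl_elim] at this; simpa using this
  have h2 : pr K ι ι x = 0 := by
    apply h; intro y
    have := hx (Sum.elim 0 y)
    rw [polar_dbl_elim] at this; simpa [ha] using this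
  rw [h1, h2]; ext i; rcases i with i | i <;> rfl

end

/-- The properties of Pfister forms that we use. -/
structure PfLike {F : Type} [Field F] {ι : Type} [Fintype ι] (A : Matrix ι ι F) : Prop where
  round : ∀ (K : Type) [Field K] (φ : F →+* K), Round (A.map φ)
  half : ∀ (K : Type) [Field K] (φ : F →+* K), Half (A.map φ)
  one : ∃ v, qf A v = 1
  nd : An (qf A) → ∀ (K : Type) [Field K] (φ : F →+* K), ND (qf (A.map φ))

section
variable {F : Type} [Field F] {ι : Type} [Fintype ι] {A : Matrix ι ι F}

theorem PfLike.nonempty (h : PfLike A) : Nonempty ι := by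
  obtain ⟨v, hv⟩ := h.one
  by_contra hn
  rw [not_nonempty_iff] at hn
  rw [Subsingleton.elim v 0] at hv
  simp at hv

theorem map_map' {K L : Type} [Field K] [Field L] (φ : F →+* K) (ψ : K →+* L) (A : Matrix ι ι F) :
    (A.map φ).map ψ = A.map (ψ.comp φ) := by ext; simp

theorem map_id' (A : Matrix ι ι F) : A.map (RingHom.id F) = A := by ext; simp

theorem PfLike.round' (h : PfLike A) : Round A := by
  have := h.round F (RingHom.id F); rwa [map_id'] at this
theorem PfLike.half' (h : PfLike A) : Half A := by
  have := h.half F (RingHom.id F); rwa [map_id'] at this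
theorem PfLike.nd' (h : PfLike A) (ha : An (qf A)) : ND (qf A) := by
  have := h.nd ha F (RingHom.id F); rwa [map_id'] at this

theorem An_of_map {K : Type} [Field K] (φ : F →+* K) (h : An (qf (A.map φ))) : An (qf A) := by
  intro x hx
  have := h (φ ∘ x) (by rw [qf_map, hx, map_zero])
  ext i
  have := congrFun this i
  simpa using this

theorem PfLike.map (h : PfLike A) {K : Type} [Field K] (φ : F →+* K) : PfLike (A.map φ) where
  round L _ ψ := by rw [map_map']; exact h.round _ _
  half L _ ψ := by rw [map_map']; exact h.half _ _
  one := by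
    obtain ⟨v, hv⟩ := h.one
    exact ⟨φ ∘ v, by rw [qf_map, hv, map_one]⟩
  nd ha L _ ψ := by rw [map_map']; exact h.nd (An_of_map φ ha) _ _

theorem PfLike.dbl (h : PfLike A) (a : F) : PfLike (dbl A a) where
  round K _ φ := by rw [dbl_map]; exact round_dbl (h.round _ _) _
  half K _ φ := by rw [dbl_map]; exact half_dbl (h.round _ _) (h.half _ _) _
  one := by
    obtain ⟨v, hv⟩ := h.one
    exact ⟨Sum.elim v 0, by rw [qf_dbl_elim]; simp [hv]⟩
  nd ha K _ φ := by
    have := h.nonempty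
    obtain ⟨h1, h2⟩ := An_dbl ha
    rw [dbl_map]; exact nd_dbl (h.nd h1 _ _) (by simpa using h2)

theorem qf_binary {K : Type} [Field K] (c : K) (x : Fin 2 → K) :
    qf (QF.binary 1 c) x = x 0 * x 0 + x 0 * x 1 + c * x 1 * x 1 := by
  simp [qf_apply, QF.binary, Fin.sum_univ_two]

theorem binary_map {K : Type} [Field K] (φ : F →+* K) (c : F) :
    (QF.binary 1 c).map φ = QF.binary 1 (φ c) := by
  ext i j; fin_cases i <;> fin_cases j <;> simp [QF.binary]

theorem pf_binary (h2 : (2 : F) = 0) (c : F) : PfLike (QF.binary 1 c) where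
  round K _ φ := by
    rw [binary_map]; set c := φ c
    intro v _
    refine ⟨⟨⟨fun x => ![v 0 * x 0 - c * v 1 * x 1, v 0 * x 1 + v 1 * x 0 + v 1 * x 1], ?_⟩, ?_⟩, ?_⟩
    · intro x y; ext i; fin_cases i <;> simp <;> ring
    · intro a y; ext i; fin_cases i <;> simp <;> ring
    · intro x; simp [qf_binary]; ring
  half K _ φ := by
    rintro ⟨x, hx, h⟩
    refine ⟨Fin 1, inferInstance, (LinearMap.proj 0).smulRight x, ?_, by simp, ?_⟩
    · rw [injective_iff_map_eq_zero]
      intro a ha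
      ext i; fin_cases i; simpa [hx] using ha
    · intro a; simp [QuadraticMap.map_smul, h]
  one := ⟨![1, 0], by simp [qf_binary]⟩
  nd _ K _ φ := by
    rw [binary_map]; set c := φ c
    have h2 : (2 : K) = 0 := by rw [← map_ofNat φ 2, h2, map_zero]
    intro x hx
    have h0 := hx ![1, 0]
    have h1 := hx ![0, 1]
    simp only [polar, qf_binary, Pi.add_apply, Matrix.cons_val_zero, Matrix.cons_val_one] at h0 h1
    ext i; fin_cases i
    · change x 0 = 0; linear_combination h1 - c * x 1 * h2
    · change x 1 = 0; linear_combination h0 - x 0 * h2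

end
section
variable {F : Type} [Field F]

/-- The coefficient matrix of a Pfister form, with its natural index set. -/
def pfm {k : ℕ} (a : Fin k → F) (c : F) : Matrix ((Fin k → Fin 2) × Fin 2) ((Fin k → Fin 2) × Fin 2) F :=
  Matrix.kroneckerMap (· * ·)
    (Matrix.diagonal fun f : Fin k → Fin 2 => ∏ i, if f i = 1 then a i else 1) (QF.binary 1 c)

theorem pfm_apply {k : ℕ} (a : Fin k → F) (c : F) (f g : Fin k → Fin 2) (i j : Fin 2) :
    pfm a c (f, i) (g, j) = (if f = g then ∏ i, (if f i = 1 then a i else 1) else 0) * QF.binary 1 c i j := by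
  simp [pfm, Matrix.kroneckerMap_apply, Matrix.diagonal_apply]

def splitEquiv {ι : Type} {k : ℕ} (e : ι ≃ (Fin k → Fin 2) × Fin 2) :
    ι ⊕ ι ≃ (Fin (k+1) → Fin 2) × Fin 2 :=
  (Equiv.sumCongr e e).trans (
  { toFun := fun x => match x with
      | .inl p => (Fin.cons 0 p.1, p.2)
      | .inr p => (Fin.cons 1 p.1, p.2)
    invFun := fun p => if p.1 0 = 0 then .inl (Fin.tail p.1, p.2) else .inr (Fin.tail p.1, p.2)
    left_inv := by rintro (p | p) <;> simp
    right_inv := by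
      rintro ⟨f, i⟩
      by_cases h : f 0 = 0
      · simp [h]; rw [← h]; simp
      · have h1 : f 0 = 1 := by omega
        simp [h1]; rw [← h1]; simp } : ((Fin k → Fin 2) × Fin 2) ⊕ ((Fin k → Fin 2) × Fin 2) ≃ _)

theorem pfm_split {ι : Type} {k : ℕ} (e : ι ≃ (Fin k → Fin 2) × Fin 2) (a : Fin (k+1) → F) (c : F)
    (A : Matrix ι ι F) (hA : ∀ x y, A x y = pfm (Fin.tail a) c (e x) (e y)) (x y : ι ⊕ ι) :
    dbl A (a 0) x y = pfm a c (splitEquiv e x) (splitEquiv e y) := by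
  have hA' : ∀ x y, A x y = _ := fun x y => (hA x y).trans (pfm_apply (Fin.tail a) c (e x).1 (e y).1 (e x).2 (e y).2)
  rcases x with x | x <;> rcases y with y | y <;>
    simp [dbl, splitEquiv, pfm_apply, hA', Fin.prod_univ_succ, Fin.tail] 
  · by_cases h : (e x).1 = (e y).1 <;> simp [h, mul_assoc]

theorem pf_exists (h2 : (2 : F) = 0) : ∀ (k : ℕ) (a : Fin k → F) (c : F),
    ∃ (ι : Type) (_ : Fintype ι) (A : Matrix ι ι F) (e : ι ≃ (Fin k → Fin 2) × Fin 2),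
      PfLike A ∧ ∀ x y, A x y = pfm a c (e x) (e y)
  | 0, a, c => ⟨Fin 2, inferInstance, QF.binary 1 c, (Equiv.uniqueProd (Fin 2) (Fin 0 → Fin 2)).symm,
      pf_binary h2 c, fun x y => by simp [pfm_apply, Equiv.uniqueProd]⟩
  | k+1, a, c => by
    obtain ⟨ι, _, A, e, hA, h⟩ := pf_exists h2 k (Fin.tail a) c
    exact ⟨ι ⊕ ι, inferInstance, dbl A (a 0), splitEquiv e, hA.dbl _, pfm_split e a c A h⟩

theorem qPfister_eval {k : ℕ} (a : Fin k → F) (c : F) {ι : Type} [Fintype ι] (A : Matrix ι ι F)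
    (e : ι ≃ (Fin k → Fin 2) × Fin 2) (h : ∀ x y, A x y = pfm a c (e x) (e y)) :
    ∃ e' : ι ≃ Fin (2 ^ k * 2), ∀ x, qf (QF.qPfister a c) x = qf A (x ∘ e') := by
  refine ⟨e.trans ((Equiv.prodCongr finFunctionFinEquiv (Equiv.refl _)).trans finProdFinEquiv), fun x => ?_⟩
  rw [← qf_reindex]
  congr 1
  congr 1
  ext i j
  simp [QF.qPfister, h, pfm, QF.bPfister, Matrix.kroneckerMap_apply, Matrix.diagonal_apply]

end
end PN

namespace PN
open QuadraticMap Polynomial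
set_option linter.all false

theorem polar_apply {R : Type} [CommRing R] {ι : Type} [Fintype ι] (A : Matrix ι ι R) (x y : ι → R) :
    polar (qf A) x y = ∑ i, ∑ j, A i j * (x i * y j + y i * x j) := by
  simp only [polar, qf_apply, ← Finset.sum_sub_distrib, Pi.add_apply]
  refine Finset.sum_congr rfl fun i _ => Finset.sum_congr rfl fun j _ => ?_
  ring

section
variable {F : Type} [Field F] {ι κ : Type} [Fintype ι] (A : Matrix ι ι F)

theorem polar_coeff (r : ι → F[X]) (j : ι → F) (m : ℕ) :
    (polar (qf (A.map C)) r (C ∘ j)).coeff m = polar (qf A) (fun i => (r i).coeff m) j := by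
  simp only [polar_apply, Matrix.map_apply, finset_sum_coeff, coeff_C_mul, coeff_add, coeff_mul_C,
    Function.comp]

theorem qf_natDegree_le (v : ι → F[X]) (m : ℕ) (h : ∀ i, (v i).natDegree ≤ m) :
    (qf (A.map C) v).natDegree ≤ 2 * m := by
  rw [qf_apply]
  apply natDegree_sum_le_of_forall_le
  intro i _
  apply natDegree_sum_le_of_forall_le
  intro j _
  rw [Matrix.map_apply, mul_assoc]
  refine (natDegree_C_mul_le _ _).trans (natDegree_mul_le.trans ?_)
  have := h i; have := h j; omega

theorem qf_coeff (v : ι → F[X]) (m : ℕ) (h : ∀ i, (v i).natDegree ≤ m) :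
    (qf (A.map C) v).coeff (2 * m) = qf A (fun i => (v i).coeff m) := by
  simp only [qf_apply, Matrix.map_apply, finset_sum_coeff, mul_assoc, coeff_C_mul]
  refine Finset.sum_congr rfl fun i _ => Finset.sum_congr rfl fun j _ => ?_
  rw [two_mul, coeff_mul_add_eq_of_natDegree_le (h i) (h j)]

theorem deg_lemma {A : Matrix ι ι F} (hA : An (qf A)) (v : ι → F[X]) (hv : v ≠ 0) :
    ∃ m, (qf (A.map C) v).natDegree = 2 * m ∧ (∀ i, (v i).natDegree ≤ m) ∧ qf (A.map C) v ≠ 0 := by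
  classical
  obtain ⟨i0, h0⟩ := Function.ne_iff.1 hv
  have : Nonempty ι := ⟨i0⟩
  have hne : (Finset.univ.filter fun i => v i ≠ 0).Nonempty := ⟨i0, by simpa using h0⟩
  obtain ⟨i1, hi1, hmax⟩ := Finset.exists_max_image _ (fun i => (v i).natDegree) hne
  set m := (v i1).natDegree
  have hle : ∀ i, (v i).natDegree ≤ m := by
    intro i
    by_cases h : v i = 0
    · simp [h]
    · exact hmax i (by simpa using h)
  have hc : (qf (A.map C) v).coeff (2 * m) ≠ 0 := by
    rw [qf_coeff A v m hle]
    intro h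
    have := congrFun (hA _ h) i1
    simp at hi1
    simp [m, hi1] at this
  refine ⟨m, le_antisymm (qf_natDegree_le A v m hle) (le_natDegree_of_ne_zero hc), hle, ?_⟩
  intro h; simp [h] at hc

theorem An_poly {A : Matrix ι ι F} (hA : An (qf A)) (v : ι → F[X]) (h : qf (A.map C) v = 0) : v = 0 := by
  by_contra hv
  obtain ⟨m, _, _, h'⟩ := deg_lemma hA v hv
  exact h' h

theorem rcp {A : Matrix ι ι F} (hA : An (qf A)) (j : κ → ι → F) (β : κ → F[X]) (f : F[X]) (n : ℕ) :
    ∀ (g : F[X]) (p : ι → F[X]), g.natDegree = n → g ≠ 0 → qf (A.map C) p = g ^ 2 * f →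
    (∀ l, polar (qf (A.map C)) p (C ∘ j l) = g * β l) →
    ∃ v, qf (A.map C) v = f ∧ ∀ l, polar (qf (A.map C)) v (C ∘ j l) = β l := by
  induction n using Nat.strong_induction_on with
  | _ n ih =>
  intro g p hn hg hp hb
  set Q := qf (A.map C) with hQ
  set v : ι → F[X] := fun i => p i / g with hv
  set r : ι → F[X] := fun i => p i % g with hr
  have hpv : p = g • v + r := by
    ext1 i; simp [hv, hr, EuclideanDomain.div_add_mod]
  have hrdeg : ∀ i, (r i).degree < g.degree := fun i => EuclideanDomain.mod_lt _ hg
  have hbr : ∀ l, polar Q r (C ∘ j l) = g * (β l - polar Q v (C ∘ j l)) := by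
    intro l
    have := hb l
    rw [hpv, polar_add_left, polar_smul_left, smul_eq_mul] at this
    linear_combination this
  have hbz : ∀ l, β l - polar Q v (C ∘ j l) = 0 := by
    intro l
    by_contra hne
    have h1 : (polar Q r (C ∘ j l)).degree < g.degree := by
      rw [degree_eq_natDegree hg, degree_lt_iff_coeff_zero]
      intro m hm
      rw [hQ, polar_coeff]
      have : (fun i => (r i).coeff m) = 0 := by
        ext i
        apply coeff_eq_zero_of_degree_lt
        refine (hrdeg i).trans_le ?_
        rw [degree_eq_natDegree hg]; exact_mod_cast hm
      rw [this, polar_zero_left]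
    rw [hbr l, degree_mul] at h1
    have : (0 : WithBot ℕ) ≤ (β l - polar Q v (C ∘ j l)).degree := zero_le_degree_iff.2 hne
    have h3 : g.degree + 0 ≤ g.degree + (β l - polar Q v (C ∘ j l)).degree := by gcongr
    rw [add_zero] at h3
    exact absurd h1 (not_lt.2 h3)
  have hbv : ∀ l, polar Q v (C ∘ j l) = β l := fun l => by linear_combination -hbz l
  have hbr0 : ∀ l, polar Q r (C ∘ j l) = 0 := fun l => by rw [hbr, hbz, mul_zero]
  by_cases hr0 : r = 0
  · refine ⟨v, ?_, hbv⟩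
    rw [hpv, hr0, add_zero, QuadraticMap.map_smul, smul_eq_mul] at hp
    have : g ^ 2 ≠ 0 := pow_ne_zero _ hg
    apply mul_left_cancel₀ this
    linear_combination hp
  · set g' := g * f - g * Q v - polar Q v r with hg'
    have hQr : Q r = g * g' := by
      rw [hpv, qadd, QuadraticMap.map_smul, polar_smul_left] at hp
      simp only [smul_eq_mul] at hp
      rw [hg']; linear_combination hp
    have hQr0 : Q r ≠ 0 := fun h => hr0 (An_poly hA r h)
    have hg'0 : g' ≠ 0 := by rintro h; rw [h, mul_zero] at hQr; exact hQr0 hQr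
    have hnd : ∀ i, (r i).natDegree ≤ n - 1 := by
      intro i
      by_cases h : r i = 0
      · simp [h]
      · have := natDegree_lt_natDegree h (hrdeg i); omega
    have hn0 : 0 < n := by
      obtain ⟨i0, h0⟩ := Function.ne_iff.1 hr0
      have := natDegree_lt_natDegree h0 (hrdeg i0); omega
    have hd : g'.natDegree < n := by
      have h1 := qf_natDegree_le A r (n-1) hnd
      rw [← hQ, hQr, natDegree_mul hg hg'0] at h1
      omega
    refine ih _ hd g' (g' • v + (Q v - f) • r) rfl hg'0 ?_ ?_
    · rw [qadd, QuadraticMap.map_smul, QuadraticMap.map_smul, polar_smul_left, polar_smul_right, hQr]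
      simp only [smul_eq_mul]
      rw [hg']; ring
    · intro l
      rw [polar_add_left, polar_smul_left, polar_smul_left, hbr0, hbv]; simp

/-- The embedding of a field in its rational function field. -/
noncomputable def rc (F : Type) [Field F] : F →+* RatFunc F := (algebraMap F[X] (RatFunc F)).comp C

theorem map_rc : A.map (rc F) = (A.map C).map (algebraMap F[X] (RatFunc F)) := by ext; simp [rc]

theorem clear_den (w : ι → RatFunc F) : ∃ (g : F[X]) (p : ι → F[X]), g ≠ 0 ∧
    (algebraMap F[X] (RatFunc F)) ∘ p = algebraMap F[X] (RatFunc F) g • w := by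
  classical
  obtain ⟨b, hb⟩ := IsLocalization.exist_integer_multiples_of_finite (nonZeroDivisors F[X]) w
  choose p hp using hb
  refine ⟨b, p, nonZeroDivisors.ne_zero b.2, ?_⟩
  ext i
  simp [hp, Algebra.smul_def]

theorem An_rc {A : Matrix ι ι F} (hA : An (qf A)) : An (qf (A.map (rc F))) := by
  intro w hw
  obtain ⟨g, p, hg, h⟩ := clear_den w
  have hg' : algebraMap F[X] (RatFunc F) g ≠ 0 := by simpa using hg
  have e := congrArg (qf (A.map (rc F))) h
  rw [QuadraticMap.map_smul, hw, smul_zero, map_rc, qf_map] at e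
  have hp := An_poly hA p (by simpa using e)
  have : algebraMap F[X] (RatFunc F) g • w = 0 := by rw [← h, hp]; ext i; simp
  exact (smul_eq_zero.1 this).resolve_left hg'

theorem An_dbl_X {A : Matrix ι ι F} (hA : An (qf A)) {c : F} (hc : c ≠ 0) :
    An (qf (dbl (A.map (rc F)) (rc F c * RatFunc.X))) := by
  intro w hw
  obtain ⟨g, p, hg, h⟩ := clear_den w
  have hg' : algebraMap F[X] (RatFunc F) g ≠ 0 := by simpa using hg
  have e := congrArg (qf (dbl (A.map (rc F)) (rc F c * RatFunc.X))) h
  rw [QuadraticMap.map_smul, hw, smul_zero, qf_dbl, map_rc] at e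
  have e1 : (algebraMap F[X] (RatFunc F) ∘ p) ∘ Sum.inl = algebraMap F[X] (RatFunc F) ∘ (p ∘ Sum.inl) := rfl
  have e2 : (algebraMap F[X] (RatFunc F) ∘ p) ∘ Sum.inr = algebraMap F[X] (RatFunc F) ∘ (p ∘ Sum.inr) := rfl
  rw [e1, e2, qf_map, qf_map, ← RatFunc.algebraMap_X, rc, RingHom.comp_apply, ← map_mul, ← map_mul, ← map_add,
    map_eq_zero_iff _ (IsFractionRing.injective F[X] (RatFunc F))] at e
  have hp2 : p ∘ Sum.inr = 0 := by
    by_contra h2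
    obtain ⟨m, h3, _, h4⟩ := deg_lemma hA _ h2
    have h5 : qf (A.map C) (p ∘ Sum.inl) = - (C c * X * qf (A.map C) (p ∘ Sum.inr)) := by
      linear_combination e
    have hcx : C c * X ≠ (0 : F[X]) := by simpa using hc
    have h6 : p ∘ Sum.inl ≠ 0 := by
      intro h6
      rw [h6, QuadraticMap.map_zero, eq_comm, neg_eq_zero] at h5
      exact (mul_ne_zero hcx h4) h5
    obtain ⟨m', h3', _, h4'⟩ := deg_lemma hA _ h6
    have := congrArg natDegree h5
    rw [natDegree_neg, natDegree_mul hcx h4, natDegree_C_mul_X _ hc, h3, h3'] at this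
    omega
  have hp1 : p ∘ Sum.inl = 0 := by
    rw [hp2, QuadraticMap.map_zero, mul_zero, add_zero] at e
    exact An_poly hA _ e
  have : algebraMap F[X] (RatFunc F) g • w = 0 := by
    rw [← h]; ext i
    rcases i with i | i
    · have := congrFun hp1 i; simp at this; simp [this]
    · have := congrFun hp2 i; simp at this; simp [this]
  exact (smul_eq_zero.1 this).resolve_left hg'

theorem rcp_rat {A : Matrix ι ι F} (hA : An (qf A)) (j : κ → ι → F) (β : κ → F[X]) (f : F[X])
    (w : ι → RatFunc F) (h1 : qf (A.map (rc F)) w = algebraMap _ _ f)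
    (h2 : ∀ l, polar (qf (A.map (rc F))) w (rc F ∘ j l) = algebraMap _ _ (β l)) :
    ∃ v, qf (A.map C) v = f ∧ ∀ l, polar (qf (A.map C)) v (C ∘ j l) = β l := by
  obtain ⟨g, p, hg, h⟩ := clear_den w
  have inj := IsFractionRing.injective F[X] (RatFunc F)
  refine rcp hA j β f _ g p rfl hg (inj ?_) (fun l => inj ?_)
  · rw [← qf_map, ← map_rc, h, QuadraticMap.map_smul, h1]; simp [pow_two]
  · rw [← polar_map, ← map_rc, h, polar_smul_left]
    have := h2 l
    have e : algebraMap F[X] (RatFunc F) ∘ (C ∘ j l) = rc F ∘ j l := rfl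
    rw [e, this]; simp

theorem rcp_const {A : Matrix ι ι F} (hA : An (qf A)) (j : κ → ι → F) (β : κ → F) (f : F)
    (w : ι → RatFunc F) (h1 : qf (A.map (rc F)) w = rc F f)
    (h2 : ∀ l, polar (qf (A.map (rc F))) w (rc F ∘ j l) = rc F (β l)) :
    ∃ v, qf A v = f ∧ ∀ l, polar (qf A) v (j l) = β l := by
  obtain ⟨v, hv, hb⟩ := rcp_rat hA j (fun l => C (β l)) (C f) w h1 h2
  have hc : v = C ∘ (fun i => (v i).coeff 0) := by
    by_cases h : v = 0
    · subst h; ext1 i; simp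
    · obtain ⟨m, h3, h4, _⟩ := deg_lemma hA v h
      rw [hv, natDegree_C] at h3
      ext1 i
      have := h4 i
      exact eq_C_of_natDegree_le_zero (by omega)
  refine ⟨fun i => (v i).coeff 0, C_injective ?_, fun l => C_injective ?_⟩
  · rw [← qf_map, ← hc, hv]
  · rw [← polar_map, ← hc, hb]

theorem rcp_lin {A : Matrix ι ι F} (hA : An (qf A)) (j : κ → ι → F) (β : κ → F[X]) (f : F[X])
    (hf : f.natDegree ≤ 2)
    (w : ι → RatFunc F) (h1 : qf (A.map (rc F)) w = algebraMap _ _ f)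
    (h2 : ∀ l, polar (qf (A.map (rc F))) w (rc F ∘ j l) = algebraMap _ _ (β l)) :
    ∃ w0 w1 : ι → F, qf (A.map C) (C ∘ w0 + (X : F[X]) • (C ∘ w1)) = f ∧
      ∀ l, polar (qf (A.map C)) (C ∘ w0 + (X : F[X]) • (C ∘ w1)) (C ∘ j l) = β l := by
  obtain ⟨v, hv, hb⟩ := rcp_rat hA j β f w h1 h2
  have hc : v = C ∘ (fun i => (v i).coeff 0) + (X : F[X]) • (C ∘ (fun i => (v i).coeff 1)) := by
    by_cases h : v = 0
    · subst h; ext1 i; simp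
    · obtain ⟨m, h3, h4, _⟩ := deg_lemma hA v h
      rw [hv] at h3
      ext1 i
      have := h4 i
      have := eq_X_add_C_of_natDegree_le_one (p := v i) (by omega)
      simp
      rw [add_comm]; exact this
  exact ⟨_, _, by rw [← hc]; exact hv, fun l => by rw [← hc]; exact hb l⟩

end
end PN

namespace PN
open QuadraticMap Polynomial
set_option linter.all false

/-- The tower of rational function fields with its generic point. -/
inductive IsGen (L : Type) [Field L] :
    ∀ (n : ℕ) (E : Type) (_ : Field E), (L →+* E) → (Fin (n + 1) → E) → Prop
  | zero : IsGen L 0 L inferInstance (RingHom.id L) (fun _ => 1)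
  | succ (n : ℕ) (E : Type) (i : Field E) (φ : L →+* E) (g : Fin (n + 1) → E) :
      IsGen L n E i φ g →
      IsGen L (n + 1) (RatFunc E) inferInstance ((rc E).comp φ) (Fin.cons RatFunc.X (rc E ∘ g))

theorem exists_gen (L : Type) [Field L] : ∀ n, ∃ (E : Type) (i : Field E) (φ : L →+* E) (g : Fin (n + 1) → E),
    IsGen L n E i φ g
  | 0 => ⟨_, _, _, _, IsGen.zero⟩
  | n+1 => by
    obtain ⟨E, i, φ, g, h⟩ := exists_gen L n
    exact ⟨_, _, _, _, IsGen.succ n E i φ g h⟩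

theorem qf_succ {R : Type} [CommRing R] {n : ℕ} (χ : Matrix (Fin (n+1)) (Fin (n+1)) R) (z : Fin (n+1) → R) :
    qf χ z = χ 0 0 * z 0 ^ 2 + z 0 * (∑ i : Fin n, (χ 0 i.succ + χ i.succ 0) * z i.succ)
      + qf (χ.submatrix Fin.succ Fin.succ) (z ∘ Fin.succ) := by
  simp only [qf_apply, Fin.sum_univ_succ, Finset.sum_add_distrib, Matrix.submatrix_apply, Function.comp,
    add_mul, Finset.mul_sum, mul_add]
  have e1 : ∀ i : Fin n, χ 0 i.succ * z 0 * z i.succ = z 0 * (χ 0 i.succ * z i.succ) := fun i => by ring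
  have e2 : ∀ i : Fin n, χ i.succ 0 * z i.succ * z 0 = z 0 * (χ i.succ 0 * z i.succ) := fun i => by ring
  simp only [e1, e2]
  ring

section
variable {L : Type} [Field L] {ι : Type} [Fintype ι]

theorem An_gen {A : Matrix ι ι L} (hA : An (qf A)) {n : ℕ} {E : Type} {i : Field E} {φ : L →+* E}
    {g : Fin (n+1) → E} (h : IsGen L n E i φ g) : An (qf (A.map φ)) := by
  induction h with
  | zero => rwa [map_id']
  | succ n E i φ g h ih => rw [← map_map']; exact An_rc ih

theorem descent {A : Matrix ι ι L} (hA : An (qf A)) {κ : Type} (j : κ → ι → L) (β : κ → L) (d : L)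
    {n : ℕ} {E : Type} {i : Field E} {φ : L →+* E}
    {g : Fin (n+1) → E} (h : IsGen L n E i φ g) : ∀ (w : ι → E), qf (A.map φ) w = φ d →
    (∀ l, polar (qf (A.map φ)) w (φ ∘ j l) = φ (β l)) →
    ∃ v, qf A v = d ∧ ∀ l, polar (qf A) v (j l) = β l := by
  induction h with
  | zero => 
    intro w h1 h2
    rw [map_id'] at h1 h2
    exact ⟨w, h1, h2⟩
  | succ n E i φ g h ih =>
    intro w h1 h2
    rw [← map_map'] at h1 h2
    obtain ⟨v, hv, hv2⟩ := rcp_const (An_gen hA h) (fun l => φ ∘ j l) (fun l => φ (β l)) (φ d) w h1 h2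
    exact ih v hv hv2

theorem subform {A : Matrix ι ι L} (hA : An (qf A)) 
    {n : ℕ} {E : Type} {i : Field E} {φ : L →+* E}
    {g : Fin (n+1) → E} (h : IsGen L n E i φ g) :
    ∀ (χ : Matrix (Fin (n+1)) (Fin (n+1)) L) (κ : Type) (j : κ → ι → L) (β : κ → Fin (n+1) → L) (w : ι → E),
    qf (A.map φ) w = qf (χ.map φ) g →
    (∀ l, polar (qf (A.map φ)) w (φ ∘ j l) = ∑ i, φ (β l i) * g i) →
    ∃ e : Fin (n+1) → ι → L, (∀ z, qf A (lc e z) = qf χ z) ∧ ∀ l i, polar (qf A) (e i) (j l) = β l i := by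
  induction h with
  | zero =>
    intro χ κ j β w h1 h2
    rw [map_id'] at h1 h2
    refine ⟨fun _ => w, fun z => ?_, fun l i => ?_⟩
    · simp [qf_apply] at h1
      have : lc (fun _ : Fin (0+1) => w) z = z 0 • w := by simp [lc_apply]
      rw [this, QuadraticMap.map_smul, qf_apply A w, h1]
      simp [qf_apply]; ring
    · have := h2 l
      simp at this
      rw [Fin.fin_one_eq_zero i, ← this]
  | succ n E i φ g h ih =>
    intro χ κ j β w h1 h2
    set m : Fin n.succ → L := fun i => χ 0 i.succ + χ i.succ 0 with hm
    set χ' := χ.submatrix Fin.succ Fin.succ with hχ'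
    set M : E := ∑ i, φ (m i) * g i with hM
    set f : E[X] := C (φ (χ 0 0)) * X ^ 2 + C M * X + C (qf (χ'.map φ) g) with hf
    have hAE := An_gen hA h
    rw [← map_map'] at h1 h2
    have h1' : qf ((A.map φ).map (rc E)) w = algebraMap _ _ f := by
      rw [h1, qf_succ, hf]
      have e3 : (Fin.cons RatFunc.X (rc E ∘ g) : Fin (n+1+1) → RatFunc E) ∘ Fin.succ = rc E ∘ g := by
        ext i; simp
      have e4 : ((χ.map ((rc E).comp φ)).submatrix Fin.succ Fin.succ) = (χ'.map φ).map (rc E) := by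
        ext; simp [hχ']
      rw [e3, e4, qf_map]
      simp [rc, hM, hm, map_sum, RatFunc.algebraMap_X]
      ring
    have h2' : ∀ l, polar (qf ((A.map φ).map (rc E))) w (rc E ∘ (φ ∘ j l)) = 
        algebraMap _ _ (C (φ (β l 0)) * X + C (∑ i : Fin (n+1), φ (β l i.succ) * g i)) := by
      intro l
      have := h2 l
      rw [RingHom.coe_comp, Function.comp_assoc] at this
      rw [this, Fin.sum_univ_succ]
      simp [rc, map_sum, RatFunc.algebraMap_X]
    obtain ⟨w0, w1, hw, hwb⟩ := rcp_lin hAE (fun l => φ ∘ j l) _ f (by rw [hf]; exact natDegree_quadratic_le) w h1' h2'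
    set Q := qf (A.map φ) with hQ
    have hw' : C (Q w1) * X ^ 2 + C (polar Q w0 w1) * X + C (Q w0) = f := by
      rw [← hw, qadd, QuadraticMap.map_smul, polar_smul_right, qf_map, qf_map, polar_map]
      simp only [smul_eq_mul]; ring
    have hwb' : ∀ l, C (polar Q w1 (φ ∘ j l)) * X + C (polar Q w0 (φ ∘ j l)) = 
        C (φ (β l 0)) * X + C (∑ i : Fin (n+1), φ (β l i.succ) * g i) := by
      intro l
      rw [← hwb l, polar_add_left, polar_smul_left, polar_map, polar_map]
      simp only [smul_eq_mul]; ring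
    have q0 : Q w0 = qf (χ'.map φ) g := by
      have := congrArg (fun p => p.coeff 0) hw'; simpa [hf, coeff_X] using this
    have q1 : polar Q w0 w1 = M := by
      have := congrArg (fun p => p.coeff 1) hw'; simpa [hf, coeff_X, coeff_C] using this
    have q2 : Q w1 = φ (χ 0 0) := by
      have := congrArg (fun p => p.coeff 2) hw'; simpa [hf, coeff_X, coeff_C] using this
    have b0 : ∀ l, polar Q w0 (φ ∘ j l) = ∑ i : Fin (n+1), φ (β l i.succ) * g i := by
      intro l
      have := congrArg (fun p => p.coeff 0) (hwb' l); simpa [coeff_X] using this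
    have b1 : ∀ l, polar Q w1 (φ ∘ j l) = φ (β l 0) := by
      intro l
      have := congrArg (fun p => p.coeff 1) (hwb' l); simpa [coeff_X, coeff_C] using this
    obtain ⟨v, hv, hvb⟩ := descent hA j (fun l => β l 0) (χ 0 0) h w1 q2 b1
    have : ∃ w0', Q w0' = Q w0 ∧ polar Q w0' (φ ∘ v) = M ∧ ∀ l, polar Q w0' (φ ∘ j l) = polar Q w0 (φ ∘ j l) := by
      by_cases hd : w1 - φ ∘ v = 0
      · refine ⟨w0, rfl, ?_, fun l => rfl⟩
        rw [← sub_eq_zero.1 hd, q1]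
      · have hd' : Q (w1 - φ ∘ v) ≠ 0 := fun h' => hd (hAE _ h')
        refine ⟨rfl' Q (w1 - φ ∘ v) w0, rfl'_isom Q hd' _, ?_, fun l => ?_⟩
        · have e := rfl'_move Q (x := w1) (y := φ ∘ v) (by rw [q2, hQ, qf_map, hv]) hd'
          conv_lhs => rw [show polar Q (rfl' Q (w1 - φ ∘ v) w0) (φ ∘ v) = polar Q (rfl' Q (w1 - φ ∘ v) w0) (rfl' Q (w1 - φ ∘ v) w1) by rw [e]]
          rw [polar_of_isom' (rfl'_isom Q hd'), q1]
        · have e := rfl'_fix Q (d := w1 - φ ∘ v) (x := φ ∘ j l) (by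
            rw [polar_sub_left, b1, hQ, polar_map, hvb, sub_self])
          conv_lhs => rw [← e]
          rw [polar_of_isom' (rfl'_isom Q hd')]
    obtain ⟨w0', hw0, hwv, hwj⟩ := this
    obtain ⟨e, he, heb⟩ := ih χ' (Option κ) (fun o => o.elim v j) (fun o => o.elim m (fun l i => β l i.succ)) w0'
      (by rw [hw0, q0]) (by
        rintro (_ | l)
        · exact hwv
        · simp only [Option.elim]; rw [hwj, b0])
    refine ⟨Fin.cons v e, fun z => ?_, fun l i => ?_⟩
    · have e1 : lc (Fin.cons v e : Fin (n+1+1) → ι → L) z = z 0 • v + lc e (z ∘ Fin.succ) := by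
        simp [lc_apply, Fin.sum_univ_succ]
      rw [e1, qadd, QuadraticMap.map_smul, polar_smul_left, hv, he, qf_succ χ z]
      have e2 : polar (qf A) v (lc e (z ∘ Fin.succ)) = ∑ i, m i * z i.succ := by
        change polarBilin _ _ _ = _
        rw [lc_apply, map_sum]
        refine Finset.sum_congr rfl fun i _ => ?_
        rw [map_smul, polarBilin_apply_apply, polar_comm]
        have := heb none i
        simp only [Option.elim] at this
        rw [this]; simp [mul_comm]
      rw [e2]; simp only [smul_eq_mul]; ring
    · refine Fin.cases ?_ (fun i => ?_) i
      · exact hvb l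
      · exact heb (some l) i

end
end PN

namespace PN
open QuadraticMap Polynomial
set_option linter.all false

section
variable {L : Type} [Field L]

theorem gen_last {n : ℕ} {E : Type} {i : Field E} {φ : L →+* E}
    {g : Fin (n+1) → E} (h : IsGen L n E i φ g) : g (Fin.last n) = 1 := by
  induction h with
  | zero => rfl
  | succ n E i φ g h ih => rw [← Fin.succ_last, Fin.cons_succ]; simp [ih]

theorem gen_indep {n : ℕ} {E : Type} {i : Field E} {φ : L →+* E}
    {g : Fin (n+1) → E} (h : IsGen L n E i φ g) :
    Function.Injective (MvPolynomial.eval₂Hom φ (fun i : Fin n => g i.castSucc)) := by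
  induction h with
  | zero =>
    rw [injective_iff_map_eq_zero]
    intro p hp
    rw [MvPolynomial.eq_C_of_isEmpty p] at hp ⊢
    simpa using hp
  | succ n E i φ g h ih =>
    have : MvPolynomial.eval₂Hom ((rc E).comp φ) (fun i : Fin (n+1) => (Fin.cons RatFunc.X (rc E ∘ g) : Fin (n+1+1) → RatFunc E) i.castSucc)
      = ((algebraMap E[X] (RatFunc E)).comp (Polynomial.mapRingHom (MvPolynomial.eval₂Hom φ (fun i : Fin n => g i.castSucc)))).comp
        ((MvPolynomial.finSuccEquiv L n).toRingEquiv : MvPolynomial (Fin (n+1)) L →+* Polynomial (MvPolynomial (Fin n) L)) := by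
      apply MvPolynomial.ringHom_ext
      · intro r; simp [MvPolynomial.finSuccEquiv_apply, rc]
      · intro j
        refine Fin.cases ?_ (fun j => ?_) j
        · simp [MvPolynomial.finSuccEquiv_X_zero, RatFunc.algebraMap_X]
        · simp [MvPolynomial.finSuccEquiv_X_succ, rc]
    rw [this, RingHom.coe_comp, RingHom.coe_comp]
    have i1 : Function.Injective (algebraMap E[X] (RatFunc E)) := IsFractionRing.injective _ _
    have i2 := Polynomial.map_injective _ ih
    have i3 := (MvPolynomial.finSuccEquiv L n).injective
    exact (i1.comp i2).comp i3

theorem ff {n : ℕ} (χ : Matrix (Fin (n+2)) (Fin (n+2)) L) (hχ : An (qf χ)) :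
    ∃ (K : Type) (_ : Field K) (φ : L →+* K) (x : Fin (n+2) → K),
      qf (χ.map φ) x = 0 ∧ x (Fin.last _) = 1 ∧
      (∀ r0 r1 : MvPolynomial (Fin n) L,
        MvPolynomial.eval₂ φ (fun i => x i.castSucc.succ) r0
          + x 0 * MvPolynomial.eval₂ φ (fun i => x i.castSucc.succ) r1 = 0 → r0 = 0 ∧ r1 = 0) ∧
      (∀ (ι : Type) [Fintype ι] (A : Matrix ι ι L), (∀ (K : Type) [Field K] (φ : L →+* K), Round (A.map φ)) →
        An (qf A) → ¬ An (qf (A.map φ)) →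
        ∃ (c : L) (a : Fin (n+2) → ι → L), c ≠ 0 ∧ ∀ z, qf A (lc a z) = c * qf χ z) := by
  obtain ⟨E, iE, φ, g, hg⟩ := exists_gen L n
  set m : Fin (n+1) → L := fun i => χ 0 i.succ + χ i.succ 0 with hm
  set χ' := χ.submatrix Fin.succ Fin.succ with hχ'
  set M : E := ∑ i, φ (m i) * g i with hM
  set P : E[X] := C (φ (χ 0 0)) * X ^ 2 + C M * X + C (qf (χ'.map φ) g) with hP
  have key : ∀ (R : Type) [CommRing R] (ψ : E →+* R) (t : R),
      qf (χ.map (ψ.comp φ)) (Fin.cons t (ψ ∘ g)) = P.eval₂ ψ t := by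
    intro R _ ψ t
    rw [qf_succ, hP]
    have e3 : (Fin.cons t (ψ ∘ g) : Fin (n+1+1) → R) ∘ Fin.succ = ψ ∘ g := by
      ext i; simp
    have e4 : ((χ.map (ψ.comp φ)).submatrix Fin.succ Fin.succ) = (χ'.map φ).map ψ := by
      ext; simp [hχ']
    rw [e3, e4, qf_map]
    simp only [eval₂_add, eval₂_mul, eval₂_C, eval₂_pow, eval₂_X]
    rw [hM]
    simp [hm, map_sum]
    ring
  have h00 : χ 0 0 ≠ 0 := by
    intro h
    have := hχ (Pi.single 0 1) (by simp [qf_apply, Pi.single_apply, h])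
    have := congrFun this 0
    simp at this
  have h00' : φ (χ 0 0) ≠ 0 := by simpa using h00
  have hdeg : P.natDegree = 2 := natDegree_quadratic h00'
  have hP0 : P ≠ 0 := by intro h; rw [h] at hdeg; simp at hdeg
  have hirr : Irreducible P := by
    rw [irreducible_iff_roots_eq_zero_of_degree_le_three (by omega) (by omega)]
    rw [Multiset.eq_zero_iff_forall_notMem]
    intro t ht
    rw [mem_roots hP0, IsRoot.def] at ht
    have e := key E (RingHom.id E) t
    rw [eval₂_id, ht] at e
    have := An_gen hχ hg _ e
    have := congrFun this (Fin.last _)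
    rw [← Fin.succ_last, Fin.cons_succ] at this
    simp [gen_last hg] at this
  haveI : Fact (Irreducible P) := ⟨hirr⟩
  set o := AdjoinRoot.of P with ho
  set t := AdjoinRoot.root P with ht
  refine ⟨AdjoinRoot P, inferInstance, o.comp φ, Fin.cons t (o ∘ g), ?_, ?_, ?_, ?_⟩
  · rw [key, AdjoinRoot.eval₂_root]
  · rw [← Fin.succ_last, Fin.cons_succ]; simp [gen_last hg]
  · intro r0 r1 h
    simp only [Fin.cons_succ, Fin.cons_zero, Function.comp] at h
    have e : ∀ r, MvPolynomial.eval₂ (o.comp φ) (fun i => o (g i.castSucc)) r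
       = o (MvPolynomial.eval₂Hom φ (fun i : Fin n => g i.castSucc) r) := by
      intro r
      rw [MvPolynomial.coe_eval₂Hom, MvPolynomial.eval₂_comp_left]; rfl
    rw [e, e] at h
    set e0 := MvPolynomial.eval₂Hom φ (fun i : Fin n => g i.castSucc) r0 with he0
    set e1 := MvPolynomial.eval₂Hom φ (fun i : Fin n => g i.castSucc) r1 with he1
    have h' : AdjoinRoot.mk P (C e1 * X + C e0) = 0 := by
      rw [map_add, map_mul, AdjoinRoot.mk_X, AdjoinRoot.mk_C, AdjoinRoot.mk_C, ← h]; 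
      change o e1 * t + o e0 = _
      ring
    rw [AdjoinRoot.mk_eq_zero] at h'
    have hz : C e1 * X + C e0 = 0 := by
      apply eq_zero_of_dvd_of_natDegree_lt h'
      rw [hdeg]
      exact lt_of_le_of_lt natDegree_linear_le (by norm_num)
    have z0 : e0 = 0 := by simpa [coeff_X] using congrArg (fun p => p.coeff 0) hz
    have z1 : e1 = 0 := by simpa [coeff_X, coeff_C] using congrArg (fun p => p.coeff 1) hz
    exact ⟨(map_eq_zero_iff _ (gen_indep hg)).1 z0, (map_eq_zero_iff _ (gen_indep hg)).1 z1⟩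
  · intro ι _ A hR hA hiso
    rw [not_An] at hiso
    obtain ⟨w, hw0, hw⟩ := hiso
    have hAE := An_gen hA hg
    have hrep : ∀ y : AdjoinRoot P, ∃ e0 e1 : E, y = o e0 + t * o e1 := by
      intro y
      obtain ⟨p, rfl⟩ := AdjoinRoot.mk_surjective y
      have h1 : AdjoinRoot.mk P p = AdjoinRoot.mk P (p % P) := by
        conv_lhs => rw [← EuclideanDomain.div_add_mod p P]
        simp
      have h2 : (p % P).natDegree ≤ 1 := by
        have := natDegree_mod_lt p (q := P) (by omega)
        omega
      refine ⟨(p % P).coeff 0, (p % P).coeff 1, ?_⟩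
      rw [h1]
      conv_lhs => rw [eq_X_add_C_of_natDegree_le_one h2]
      rw [map_add, map_mul, AdjoinRoot.mk_X, AdjoinRoot.mk_C, AdjoinRoot.mk_C]
      change o _ * t + o _ = _
      ring
    choose w0 w1 hww using fun i => hrep (w i)
    have hw' : w = o ∘ w0 + t • (o ∘ w1) := by
      ext i; simp [hww]
    set Q := qf (A.map φ) with hQ
    set G : E[X] := C (Q w1) * X ^ 2 + C (polar Q w0 w1) * X + C (Q w0) with hG
    have hmk : AdjoinRoot.mk P G = 0 := by
      rw [← map_map', hw', qadd, QuadraticMap.map_smul, polar_smul_right, qf_map, qf_map, polar_map] at hw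
      rw [← hw, hG]
      simp only [map_add, map_mul, map_pow, AdjoinRoot.mk_X, AdjoinRoot.mk_C]
      change o _ * t ^ 2 + o _ * t + o _ = _
      simp only [smul_eq_mul]
      ring
    rw [AdjoinRoot.mk_eq_zero] at hmk
    obtain ⟨H, hH⟩ := hmk
    have hH0 : H ≠ 0 := by
      rintro rfl
      rw [mul_zero] at hH
      have z0 : w0 = 0 := by
        apply hAE
        simpa [hG, coeff_X] using congrArg (fun p => p.coeff 0) hH
      have z1 : w1 = 0 := by
        apply hAE
        simpa [hG, coeff_X, coeff_C] using congrArg (fun p => p.coeff 2) hH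
      apply hw0
      rw [hw', z0, z1]; ext i; simp
    have hHd : H.natDegree = 0 := by
      have h1 : G.natDegree ≤ 2 := natDegree_quadratic_le
      rw [hH, natDegree_mul hP0 hH0] at h1; omega
    obtain ⟨f, rfl⟩ : ∃ f, H = C f := ⟨_, eq_C_of_natDegree_eq_zero hHd⟩
    have hf : f ≠ 0 := by rintro rfl; simp at hH0
    have q2 : Q w1 = φ (χ 0 0) * f := by
      have := congrArg (fun p => p.coeff 2) hH
      simpa [hG, hP, coeff_X, coeff_C] using this
    set u : ι → RatFunc E := rc E ∘ w0 + (RatFunc.X : RatFunc E) • (rc E ∘ w1) with hu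
    have hQu : qf ((A.map φ).map (rc E)) u = rc E f * qf (χ.map ((rc E).comp φ)) (Fin.cons RatFunc.X (rc E ∘ g)) := by
      rw [key, hu, qadd, QuadraticMap.map_smul, polar_smul_right, qf_map, qf_map, polar_map]
      have e1 := congrArg (fun p => p.eval₂ (rc E) RatFunc.X) hH
      simp only [hG, eval₂_mul, eval₂_C, eval₂_add, eval₂_pow, eval₂_X] at e1
      rw [mul_comm (rc E f), ← e1]
      simp only [smul_eq_mul]; ring
    have hne : qf ((A.map φ).map (rc E)) (rc E ∘ w1) ≠ 0 := by
      rw [qf_map, ← hQ, q2]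
      simp [h00, hf]
    have hR' : Round ((A.map φ).map (rc E)) := by rw [map_map']; exact hR _ _
    obtain ⟨S, hS⟩ := hR' _ hne
    obtain ⟨e, he, -⟩ := subform hA (IsGen.succ n E iE φ g hg) (χ 0 0 • χ) Empty (fun l => l.elim) (fun l => l.elim)
      ((rc E f)⁻¹ • S u) (by
        have e5 : (χ 0 0 • χ).map ((rc E).comp φ) = (rc E (φ (χ 0 0))) • χ.map ((rc E).comp φ) := by
          ext; simp
        rw [← map_map', QuadraticMap.map_smul, hS, hQu, qf_map, ← hQ, q2, e5, qf_smul, map_mul]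
        have : rc E f ≠ 0 := by simpa using hf
        simp only [smul_eq_mul]
        field_simp) (fun l => l.elim)
    exact ⟨χ 0 0, e, h00, fun z => by rw [he, qf_smul]⟩

end
end PN

namespace PN
open QuadraticMap
set_option linter.all false

section
variable {L : Type} [Field L]

theorem witt {V : Type} [AddCommGroup V] [Module L V] {Q : QuadraticForm L V} (hQ : An Q) :
    ∀ (n : ℕ) (a b : Fin n → V), (∀ i, Q (a i) = Q (b i)) →
      (∀ i j, polar Q (a i) (a j) = polar Q (b i) (b j)) →
      ∃ R : V →ₗ[L] V, (∀ x, Q (R x) = Q x) ∧ ∀ i, R (a i) = b i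
  | 0, a, b, _, _ => ⟨LinearMap.id, fun _ => rfl, fun i => i.elim0⟩
  | n+1, a, b, h1, h2 => by
    obtain ⟨R, hR, hRa⟩ := witt hQ n (fun i => a i.castSucc) (fun i => b i.castSucc)
      (fun i => h1 _) (fun i j => h2 _ _)
    by_cases hd : R (a (Fin.last n)) - b (Fin.last n) = 0
    · refine ⟨R, hR, fun i => ?_⟩
      refine Fin.lastCases ?_ (fun i => ?_) i
      · exact sub_eq_zero.1 hd
      · exact hRa i
    · have hd' : Q (R (a (Fin.last n)) - b (Fin.last n)) ≠ 0 := fun h => hd (hQ _ h)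
      refine ⟨rfl' Q (R (a (Fin.last n)) - b (Fin.last n)) ∘ₗ R, fun x => ?_, fun i => ?_⟩
      · rw [LinearMap.comp_apply, rfl'_isom Q hd', hR]
      · refine Fin.lastCases ?_ (fun i => ?_) i
        · rw [LinearMap.comp_apply, rfl'_move Q _ hd']
          rw [hR, h1]
        · rw [LinearMap.comp_apply, hRa, rfl'_fix]
          rw [polar_sub_left, ← hRa, polar_of_isom' hR, hRa, h2, sub_self]

/-- Witt extension, in terms of linear maps. -/
theorem witt' {V : Type} [AddCommGroup V] [Module L V] {Q : QuadraticForm L V} (hQ : An Q)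
    {κ : Type} [Fintype κ] (f g : (κ → L) →ₗ[L] V) (h : ∀ z, Q (f z) = Q (g z)) :
    ∃ R : V →ₗ[L] V, (∀ x, Q (R x) = Q x) ∧ ∀ z, R (f z) = g z := by
  classical
  obtain ⟨R, hR, hR2⟩ := witt hQ (Fintype.card κ)
    (fun i => f (Pi.single ((Fintype.equivFin κ).symm i) 1))
    (fun i => g (Pi.single ((Fintype.equivFin κ).symm i) 1)) (fun i => h _)
    (fun i j => by simp only [polar, ← map_add, h])
  refine ⟨R, hR, fun z => ?_⟩
  have : R ∘ₗ f = g := by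
    apply LinearMap.pi_ext'
    intro i
    ext
    have := hR2 (Fintype.equivFin κ i)
    simpa using this
  exact congrArg (fun f => f z) this

theorem meet {V W U : Type} [AddCommGroup V] [Module L V] [AddCommGroup W] [Module L W]
    [AddCommGroup U] [Module L U] [FiniteDimensional L V] [FiniteDimensional L W] [FiniteDimensional L U]
    (f : V →ₗ[L] W) (g : U →ₗ[L] W) (hg : Function.Injective g)
    (h : Module.finrank L W < Module.finrank L V + Module.finrank L U) :
    ∃ v u, v ≠ 0 ∧ f v = g u := by
  have : ¬ Function.Injective (f.coprod (-g)) := by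
    intro hi
    have := LinearMap.finrank_le_finrank_of_injective hi
    rw [Module.finrank_prod] at this
    omega
  rw [injective_iff_map_eq_zero] at this
  push Not at this
  obtain ⟨⟨v, u⟩, h1, h2⟩ := this
  simp [LinearMap.coprod_apply] at h1
  have h1' : f v = g u := by rwa [← sub_eq_add_neg, sub_eq_zero] at h1
  refine ⟨v, u, ?_, h1'⟩
  rintro rfl
  rw [map_zero] at h1'
  have : u = 0 := hg (by rw [← h1', map_zero])
  exact h2 (by rw [this]; rfl)

theorem lc_inj_map {ι κ K : Type} [Fintype ι] [Fintype κ] [Field K] (φ : L →+* K) (a : κ → ι → L)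
    (h : Function.Injective (lc a)) : Function.Injective (lc (fun l => φ ∘ a l)) := by
  classical
  obtain ⟨g, hg⟩ := LinearMap.exists_leftInverse_of_injective (lc a) (LinearMap.ker_eq_bot.2 h)
  have : (lc (fun l => φ ∘ g (Pi.single l 1))) ∘ₗ (lc (fun l => φ ∘ a l)) = LinearMap.id := by
    apply LinearMap.pi_ext'
    intro i
    ext1
    simp only [LinearMap.comp_apply, LinearMap.single_apply, LinearMap.id_apply, LinearMap.coe_single]
    rw [lc_single, lc_map, eq_lc, ← lc_single a i, ← LinearMap.comp_apply, hg, LinearMap.id_apply, ← map_single]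
  exact Function.LeftInverse.injective (g := lc (fun l => φ ∘ g (Pi.single l 1))) (fun x => congrArg (fun f => f x) this)

theorem exists_qf {n : ℕ} (Q : QuadraticForm L (Fin n → L)) : ∃ M : Matrix (Fin n) (Fin n) L, qf M = Q := by
  refine ⟨Matrix.of fun i j => if i = j then Q (Pi.single i 1) else if i < j then polar Q (Pi.single i 1) (Pi.single j 1) else 0, ?_⟩
  have key : ∀ (M : Matrix (Fin n) (Fin n) L) i j, polar (qf M) (Pi.single i 1) (Pi.single j 1) = M i j + M j i := by
    intro M i j
    simp only [polar, qf_apply, Pi.add_apply, mul_add, add_mul, Finset.sum_add_distrib, Pi.single_apply]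
    simp
    ring
  apply qform_ext
  · intro i
    simp [qf_apply, Pi.single_apply]
  · intro i j
    rw [key]
    rcases lt_trichotomy i j with h | h | h
    · simp [h.ne, h, h.ne', not_lt.2 h.le]
    · subst h; simp [polar_self, two_mul]
    · simp [h.ne, h, h.ne', not_lt.2 h.le, polar_comm]

variable {ι : Type} [Fintype ι] {A : Matrix ι ι L}

theorem iso_lem (h2 : (2 : L) = 0) (hA : PfLike A) {a b c : L} (ha : An (qf (dbl A a))) (hb : An (qf (dbl A b)))
    (T : (ι ⊕ ι → L) →ₗ[L] (ι ⊕ ι → L)) (hc : c ≠ 0) (hT : ∀ w, qf (dbl A b) (T w) = c * qf (dbl A a) w) :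
    ¬ An (qf (dbl A (a * b))) := by
  have := hA.nonempty
  obtain ⟨v, hv⟩ := hA.one
  obtain ⟨hAn, ha0⟩ := An_dbl ha
  obtain ⟨-, hb0⟩ := An_dbl hb
  have e1 : qf (dbl A b) (T (Sum.elim v 0)) = c := by
    rw [hT, qf_dbl_elim, hv]; simp
  obtain ⟨S, hS⟩ := (hA.dbl b).round' (T (Sum.elim v 0)) (by rw [e1]; exact hc)
  rw [e1] at hS
  set T1 := c⁻¹ • (S ∘ₗ T) with hT1
  have hT1' : ∀ w, qf (dbl A b) (T1 w) = qf (dbl A a) w := by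
    intro w
    rw [hT1, LinearMap.smul_apply, QuadraticMap.map_smul, LinearMap.comp_apply, hS, hT]
    simp only [smul_eq_mul]; field_simp
  set il : (ι → L) →ₗ[L] (ι ⊕ ι → L) := pair LinearMap.id 0 with hil
  have il_apply : ∀ x, il x = Sum.elim x 0 := fun x => rfl
  obtain ⟨R, hR, hRT⟩ := witt' hb (T1 ∘ₗ il) il (fun z => by
    rw [LinearMap.comp_apply, hT1', il_apply, qf_dbl_elim, qf_dbl_elim]; simp)
  have hRT' : ∀ w, qf (dbl A b) ((R ∘ₗ T1) w) = qf (dbl A a) w := fun w => by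
    rw [LinearMap.comp_apply, hR, hT1']
  set y := (R ∘ₗ T1) (Sum.elim 0 v) with hy
  have hp : ∀ x, polar (qf (dbl A b)) (Sum.elim x 0) y = 0 := by
    intro x
    have := polar_of_isom' hRT' (Sum.elim x 0) (Sum.elim 0 v)
    have e : (R ∘ₗ T1) (Sum.elim x 0) = Sum.elim x 0 := hRT x
    rw [e, ← hy] at this
    rw [this, polar_dbl_elim]; simp
  have hy0 : pl L ι ι y = 0 := by
    apply hA.nd' hAn
    intro x
    have := hp x
    rw [← elim_pl_pr y, polar_dbl_elim] at this
    simp at this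
    rw [polar_comm]; exact this
  have e2 : b * qf A (pr L ι ι y) = a := by
    have := hRT' (Sum.elim 0 v)
    rw [← hy, ← elim_pl_pr y, qf_dbl_elim, qf_dbl_elim, hy0, hv] at this
    simpa using this
  rw [not_An]
  refine ⟨Sum.elim (b • pr L ι ι y) v, ?_, ?_⟩
  · intro h
    have := congrArg (pr L ι ι) h
    rw [pr_elim] at this
    rw [this] at hv
    simp at hv
  · rw [qf_dbl_elim, QuadraticMap.map_smul, hv, ← e2]
    simp only [smul_eq_mul]
    linear_combination (b * b * qf A (pr L ι ι y)) * h2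

theorem nei (h2 : (2 : L) = 0) (hA : PfLike A) {a b c : L} (ha : An (qf (dbl A a))) (hb : An (qf (dbl A b)))
    (hab : An (qf (dbl A (a * b)))) {p : ℕ} (D : Matrix (Fin p) (Fin p) L) (hp : Fintype.card ι < p)
    (f g : (Fin p → L) →ₗ[L] (ι ⊕ ι → L)) (hf : Function.Injective f) (hc : c ≠ 0)
    (hfD : ∀ z, qf (dbl A a) (f z) = qf D z) (hgD : ∀ z, qf (dbl A b) (g z) = c * qf D z) : False := by
  have hne := hA.nonempty
  have hD : An (qf D) := fun z hz => by
    have := ha _ ((hfD z).trans hz)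
    exact hf (this.trans (map_zero f).symm)
  have hg : Function.Injective g := inj_of_An hD hc hgD
  have hcard : 0 < Fintype.card ι := Fintype.card_pos
  obtain ⟨n, hn⟩ : ∃ n, Fintype.card (ι ⊕ ι) = n + 2 := ⟨Fintype.card (ι ⊕ ι) - 2, by simp; omega⟩
  let e : ι ⊕ ι ≃ Fin (n+2) := Fintype.equivFinOfCardEq hn
  set χ := Matrix.reindex e e (dbl A a) with hχ
  have hχv : ∀ x, qf χ x = qf (dbl A a) (x ∘ e) := fun x => qf_reindex e _ x
  have hχA : An (qf χ) := fun x hx => by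
    rw [hχv] at hx
    have := ha _ hx
    ext i
    have := congrFun this (e.symm i)
    simpa using this
  obtain ⟨K, _, φ, x, hx, hx1, -, hsim⟩ := ff χ hχA
  have hiso : ∃ y, y ≠ 0 ∧ qf ((dbl A a).map φ) y = 0 := by
    refine ⟨x ∘ e, ?_, ?_⟩
    · intro h
      have := congrFun h (e.symm (Fin.last _))
      simp [hx1] at this
    · rw [← hx, ← qf_reindex]
      rfl
  obtain ⟨ζ, _, t, ht, htc, ht0⟩ := (hA.dbl a).half K φ hiso
  simp only [Fintype.card_sum] at htc
  rw [← eq_lc f] at hfD hf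
  rw [← eq_lc g] at hgD hg
  have hfi := lc_inj_map φ _ hf
  have hgi := lc_inj_map φ _ hg
  obtain ⟨v, u, hv, huv⟩ := meet (lc (fun l => φ ∘ f (Pi.single l 1))) t ht (by
    simp; omega)
  have ef := qf_lc_map φ _ D _ 1 (fun z => (hfD z).trans (one_mul _).symm) v
  have eg := qf_lc_map φ _ D _ c hgD v
  rw [huv, ht0, map_one, one_mul] at ef
  rw [← ef, mul_zero] at eg
  obtain ⟨c', a', hc', ha'⟩ := hsim (ι ⊕ ι) (dbl A b) (hA.dbl b).round hb (by
    rw [not_An]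
    exact ⟨_, fun h => hv (hgi (h.trans (map_zero _).symm)), eg⟩)
  refine iso_lem h2 hA ha hb (lc a' ∘ₗ LinearMap.funLeft L L e.symm) hc' (fun w => ?_) hab
  rw [LinearMap.comp_apply, ha', hχv]
  congr 2
  ext i; simp [LinearMap.funLeft_apply]

theorem An_dbl_sq {a b : L} (ha : An (qf (dbl A a))) (hb : b ≠ 0) : An (qf (dbl A (a * b ^ 2))) := by
  intro x hx
  have := ha (Sum.elim (pl L ι ι x) (b • pr L ι ι x)) (by
    rw [qf_dbl_elim, QuadraticMap.map_smul, ← hx, qf_dbl']; simp only [smul_eq_mul]; ring)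
  have e1 := congrArg (pl L ι ι) this
  have e2 := congrArg (pr L ι ι) this
  rw [pl_elim] at e1
  rw [pr_elim, map_zero, smul_eq_zero] at e2
  rw [← elim_pl_pr x, e1, e2.resolve_left hb]
  ext i; rcases i with i | i <;> rfl

end
end PN

namespace PN
open QuadraticMap
set_option linter.all false

section
variable {L : Type} [Field L]

theorem nd_surj' {W : Type} [AddCommGroup W] [Module L W] [FiniteDimensional L W]
    {Q : QuadraticForm L W} (hQ : ND Q) (l : W →ₗ[L] L) : ∃ w, ∀ z, polar Q w z = l z := by
  have hi : Function.Injective (Q.polarBilin : W →ₗ[L] Module.Dual L W) := by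
    rw [injective_iff_map_eq_zero]
    intro x hx
    apply hQ
    intro y
    exact congrArg (fun f => f y) hx
  have hs := (LinearMap.injective_iff_surjective_of_finrank_eq_finrank
    (Subspace.dual_finrank_eq (K := L) (V := W)).symm).1 hi
  obtain ⟨w, hw⟩ := hs l
  exact ⟨w, fun z => congrArg (fun f => f z) hw⟩

theorem nd_surj {V W : Type} [AddCommGroup W] [Module L W] [FiniteDimensional L W] [AddCommGroup V] [Module L V]
    {Q : QuadraticForm L W} (hQ : ND Q) (J : V →ₗ[L] W) (hJ : Function.Injective J)
    (l : V →ₗ[L] L) : ∃ w, ∀ z, polar Q w (J z) = l z := by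
  obtain ⟨g, hg⟩ := LinearMap.exists_leftInverse_of_injective J (LinearMap.ker_eq_bot.2 hJ)
  obtain ⟨w, hw⟩ := nd_surj' hQ (l ∘ₗ g)
  refine ⟨w, fun z => ?_⟩
  rw [hw]
  exact congrArg (fun f => l (f z)) hg

theorem nd_perp {V W : Type} [AddCommGroup W] [Module L W] [FiniteDimensional L W] [AddCommGroup V] [Module L V]
    {Q : QuadraticForm L W} (hQ : ND Q) (J : V →ₗ[L] W) (w : W)
    (h : ∀ x, (∀ z, polar Q x (J z) = 0) → polar Q x w = 0) : ∃ u, J u = w := by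
  by_contra hn
  obtain ⟨f, hf, hf2⟩ := Submodule.exists_le_ker_of_notMem (p := LinearMap.range J) (v := w) (by
    rintro ⟨u, hu⟩; exact hn ⟨u, hu⟩)
  obtain ⟨x, hx⟩ := nd_surj' hQ f
  have := h x (fun z => by
    rw [hx]; exact hf2 ⟨z, rfl⟩)
  rw [hx] at this
  exact hf this

theorem param {W : Type} [AddCommGroup W] [Module L W] [FiniteDimensional L W] (H : Submodule L W) :
    ∃ f : (Fin (Module.finrank L H) → L) →ₗ[L] W, Function.Injective f ∧ ∀ w, w ∈ H ↔ ∃ z, f z = w := by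
  refine ⟨H.subtype ∘ₗ (Module.finBasis L H).equivFun.symm.toLinearMap, ?_, fun w => ?_⟩
  · rw [LinearMap.coe_comp]
    exact Function.Injective.comp (Submodule.subtype_injective H) (LinearEquiv.injective _)
  · constructor
    · intro hw
      exact ⟨(Module.finBasis L H).equivFun ⟨w, hw⟩, by simp⟩
    · rintro ⟨z, rfl⟩
      exact ((Module.finBasis L H).equivFun.symm z).2

/-- Parametrisation of the orthogonal complement of the image of `J`. -/
theorem perp_param {V W : Type} [AddCommGroup W] [Module L W] [FiniteDimensional L W] [AddCommGroup V] [Module L V]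
    [FiniteDimensional L V] (Q : QuadraticForm L W) (J : V →ₗ[L] W) :
    ∃ (p : ℕ) (f : (Fin p → L) →ₗ[L] W), Module.finrank L W ≤ p + Module.finrank L V ∧ Function.Injective f ∧
      ∀ w, (∀ v, polar Q w (J v) = 0) ↔ ∃ z, f z = w := by
  let B : W →ₗ[L] Module.Dual L V := (LinearMap.lcomp L L J) ∘ₗ Q.polarBilin
  obtain ⟨f, hf, hr⟩ := param (LinearMap.ker B)
  refine ⟨_, f, ?_, hf, fun w => ?_⟩
  · have h1 := LinearMap.finrank_range_add_finrank_ker B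
    have h2 := Submodule.finrank_le (LinearMap.range B)
    rw [Subspace.dual_finrank_eq] at h2
    omega
  · rw [← hr, LinearMap.mem_ker]
    constructor
    · intro h; ext v; exact h v
    · intro h v; exact congrArg (fun f => f v) h

theorem qf_add {ι : Type} [Fintype ι] (A B : Matrix ι ι L) (x : ι → L) : qf (A + B) x = qf A x + qf B x := by
  simp [qf_apply, add_mul, Finset.sum_add_distrib]

theorem qf_single {n : ℕ} (c : L) (x : Fin (n+1) → L) : qf (Matrix.single 0 0 c) x = c * x 0 ^ 2 := by
  rw [qf_succ]
  have : (Matrix.single 0 0 c : Matrix (Fin (n+1)) (Fin (n+1)) L).submatrix Fin.succ Fin.succ = 0 := by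
    ext i j; simp [Matrix.single_apply, (Fin.succ_ne_zero _).symm]
  rw [this]
  simp [Matrix.single_apply, (Fin.succ_ne_zero _).symm, qf_apply]

theorem lc_cons {ι : Type} [Fintype ι] {n : ℕ} (w : ι → L) (h : Fin n → ι → L) (z : Fin (n+1) → L) :
    lc (Fin.cons w h : Fin (n+1) → ι → L) z = z 0 • w + lc h (z ∘ Fin.succ) := by
  simp [lc_apply, Fin.sum_univ_succ]

theorem polar_lc {ι : Type} [Fintype ι] {n : ℕ} (Q : QuadraticForm L (ι → L)) (w : ι → L)
    (h : Fin n → ι → L) (z : Fin n → L) :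
    polar Q w (lc h z) = ∑ i, z i * polar Q w (h i) := by
  change polarBilin _ _ _ = _
  rw [lc_apply, map_sum]
  simp

variable {ι : Type} [Fintype ι] 

theorem ext_step (S : Matrix ι ι L) {M : ℕ} (ψ : Matrix (Fin (M+1)) (Fin (M+1)) L) (j : Fin M → ι → L)
    (hj : ∀ z, qf S (lc j z) = qf (ψ.submatrix Fin.succ Fin.succ) z) (w : ι → L)
    (hw : qf S w = ψ 0 0) (hb : ∀ i, polar (qf S) w (j i) = ψ 0 i.succ + ψ i.succ 0) (z : Fin (M+1) → L) :
    qf S (lc (Fin.cons w j : Fin (M+1) → ι → L) z) = qf ψ z := by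
  rw [lc_cons, qadd, QuadraticMap.map_smul, polar_smul_left, hw, hj, qf_succ ψ, polar_lc]
  simp only [hb, Function.comp, smul_eq_mul]
  have : ∀ i : Fin M, z i.succ * (ψ 0 i.succ + ψ i.succ 0) = (ψ 0 i.succ + ψ i.succ 0) * z i.succ := fun i => by ring
  simp only [this]
  ring

theorem ext_over (h2 : (2 : L) = 0) (S : Matrix ι ι L) {M p : ℕ} (j : Fin M → ι → L) (h : Fin p → ι → L) (w0 : ι → L)
    (d : L) (β : Fin M → L) (hh : Function.Injective (lc h))
    (hw0 : ∀ i, polar (qf S) w0 (j i) = β i) (hhj : ∀ l i, polar (qf S) (h l) (j i) = 0)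
    (χ' : Matrix (Fin (p+1)) (Fin (p+1)) L)
    (hχ' : ∀ z, qf S (lc (Fin.cons w0 h : Fin (p+1) → ι → L) z) = qf χ' z)
    {K : Type} [Field K] (φ : L →+* K) (hSK : An (qf (S.map φ)))
    (hK : ¬ An (qf ((χ' + Matrix.single 0 0 d).map φ))) :
    ∃ w, qf (S.map φ) w = φ d ∧ ∀ i, polar (qf (S.map φ)) w (φ ∘ j i) = φ (β i) := by
  rw [not_An] at hK
  obtain ⟨z, hz0, hz⟩ := hK
  have e0 : ∀ z, qf (S.map φ) (lc (fun l => φ ∘ (Fin.cons w0 h : Fin (p+1) → ι → L) l) z) = qf (χ'.map φ) z := by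
    intro z
    have := qf_lc_map φ S χ' _ 1 (fun z => (hχ' z).trans (one_mul _).symm) z
    rwa [map_one, one_mul] at this
  have e1 : (fun l => φ ∘ (Fin.cons w0 h : Fin (p+1) → ι → L) l) = (Fin.cons (φ ∘ w0) (fun l => φ ∘ h l) : Fin (p+1) → ι → K) := by
    ext l
    refine Fin.cases ?_ (fun l => ?_) l <;> simp
  have e2 : (χ' + Matrix.single 0 0 d).map φ = χ'.map φ + Matrix.single 0 0 (φ d) := by
    rw [Matrix.map_add φ (map_add φ)]; congr 1; simp [Matrix.map_single]
  rw [e1] at e0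
  rw [e2, qf_add, qf_single, ← e0] at hz
  have hzz : z 0 ≠ 0 := by
    intro h0
    rw [lc_cons, h0, zero_smul, zero_add] at hz
    have := hSK _ (by simpa using hz)
    have := lc_inj_map φ _ hh (this.trans (map_zero _).symm)
    apply hz0
    ext i
    refine Fin.cases h0 (fun i => congrFun this i) i
  refine ⟨(z 0)⁻¹ • lc (Fin.cons (φ ∘ w0) (fun l => φ ∘ h l) : Fin (p+1) → ι → K) z, ?_, fun i => ?_⟩
  · have h2' : (2 : K) = 0 := by rw [← map_ofNat φ 2, h2, map_zero]
    rw [QuadraticMap.map_smul, eq_neg_of_add_eq_zero_left hz]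
    simp only [smul_eq_mul]
    field_simp
    linear_combination (-φ d) * h2'
  · rw [lc_cons, smul_add, smul_smul, inv_mul_cancel₀ hzz, one_smul, polar_add_left, polar_map, hw0, polar_smul_left,
      polar_comm, polar_lc]
    have : ∀ l, polar (qf (S.map φ)) (φ ∘ j i) (φ ∘ h l) = 0 := by
      intro l; rw [polar_comm, polar_map, hhj, map_zero]
    simp [this]

/-- Anisotropic sums with `σ` itself: no new isotropy. -/
theorem no_sigma (h2 : (2 : L) = 0) (S : Matrix ι ι L) (hS : An (qf S)) (hR : Round S) (hnd : ND (qf S)) {M p : ℕ}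
    (j : Fin M → ι → L) (h : Fin (p+1) → ι → L) (w0 : ι → L)
    (ψ : Matrix (Fin (M+1)) (Fin (M+1)) L) (hψ : An (qf ψ)) (hh : Function.Injective (lc h))
    (hj : ∀ z, qf S (lc j z) = qf (ψ.submatrix Fin.succ Fin.succ) z)
    (hw0 : ∀ i, polar (qf S) w0 (j i) = ψ 0 i.succ + ψ i.succ 0)
    (hperp : ∀ w, (∀ v, polar (qf S) w (lc j v) = 0) ↔ ∃ z, lc h z = w)
    (χ' : Matrix (Fin (p+2)) (Fin (p+2)) L)
    (hχ' : ∀ z, qf S (lc (Fin.cons w0 h : Fin (p+2) → ι → L) z) = qf χ' z)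
    (c : L) (a : Fin (p+2) → ι → L) (hc : c ≠ 0)
    (ha : ∀ z, qf S (lc a z) = c * qf (χ' + Matrix.single 0 0 (ψ 0 0)) z) : False := by
  set χ := χ' + Matrix.single 0 0 (ψ 0 0) with hχ
  have hχv : ∀ z, qf χ z = qf S (z 0 • w0 + lc h (z ∘ Fin.succ)) + ψ 0 0 * z 0 ^ 2 := by
    intro z; rw [hχ, qf_add, qf_single, ← hχ', lc_cons]
  obtain ⟨T, hT⟩ : ∃ T : (ι → L) →ₗ[L] (ι → L), ∀ x, qf S (T x) = c⁻¹ * qf S x := by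
    set v : Fin (p+2) → L := Fin.cons 0 (Pi.single 0 1) with hv
    have e1 : qf S (lc a v) = c * qf S (h 0) := by
      rw [ha, hχv]
      have : v ∘ Fin.succ = Pi.single 0 1 := by ext i; simp [hv]
      rw [this, lc_single]; simp [hv]
    have hu : qf S (h 0) ≠ 0 := by
      intro h0
      have := hS _ h0
      rw [← lc_single h 0] at this
      have := congrFun (hh (this.trans (map_zero _).symm)) 0
      simp at this
    obtain ⟨S1, hS1⟩ := hR (h 0) hu
    obtain ⟨S2, hS2⟩ := hR (lc a v) (by rw [e1]; exact mul_ne_zero hc hu)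
    refine ⟨(c * qf S (h 0))⁻¹ • (S1 ∘ₗ S2), fun x => ?_⟩
    rw [LinearMap.smul_apply, LinearMap.comp_apply, QuadraticMap.map_smul, hS1, hS2, e1]
    simp only [smul_eq_mul]; field_simp
  set G := T ∘ₗ lc a with hG
  have hGv : ∀ z, qf S (G z) = qf χ z := fun z => by
    rw [hG, LinearMap.comp_apply, hT, ha]; field_simp
  let cz : (Fin (p+1) → L) →ₗ[L] (Fin (p+2) → L) := LinearMap.pi (Fin.cons 0 (fun i => LinearMap.proj i))
  have cz0 : ∀ z, cz z 0 = 0 := fun z => by simp [cz]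
  have czs : ∀ z, (cz z) ∘ Fin.succ = z := fun z => by ext i; simp [cz]
  obtain ⟨R, hR1, hR2⟩ := witt' hS (G ∘ₗ cz) (lc h) (fun z => by
    rw [LinearMap.comp_apply, hGv, hχv, cz0, czs]; simp)
  have hRG : ∀ z, qf S ((R ∘ₗ G) z) = qf χ z := fun z => by rw [LinearMap.comp_apply, hR1, hGv]
  set e0 : Fin (p+2) → L := Pi.single 0 1 with he0
  have e00 : e0 0 = 1 := by simp [he0]
  have e0s : e0 ∘ Fin.succ = 0 := by ext i; simp [he0]
  set w1 := (R ∘ₗ G) e0 with hw1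
  have v1 : qf S w1 = qf S w0 + ψ 0 0 := by
    rw [hw1, hRG, hχv, e00, e0s]; simp
  have p1 : ∀ z, polar (qf S) w1 (lc h z) = polar (qf S) w0 (lc h z) := by
    intro z
    have e := polar_of_isom' hRG e0 (cz z)
    rw [← hw1, show (R ∘ₗ G) (cz z) = lc h z from hR2 z] at e
    rw [e]
    have a1 : (e0 + cz z) 0 = 1 := by simp [e00, cz0]
    have a2 : (e0 + cz z) ∘ Fin.succ = z := by
      have : (e0 + cz z) ∘ Fin.succ = e0 ∘ Fin.succ + (cz z) ∘ Fin.succ := rfl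
      rw [this, e0s, czs, zero_add]
    simp only [polar]
    rw [hχv, hχv, hχv, a1, a2, e00, e0s, cz0, czs]
    simp
  obtain ⟨u, hu⟩ := nd_perp hnd (lc j) (w1 - w0) (fun x hx => by
    obtain ⟨z, rfl⟩ := (hperp x).1 hx
    rw [polar_sub_right, polar_comm _ _ w1, polar_comm _ _ w0, p1, sub_self])
  have hw1' : w1 = w0 + lc j u := by rw [hu]; abel
  rw [hw1', qadd, hj, polar_lc] at v1
  simp only [hw0] at v1
  have hz : qf ψ (Fin.cons 1 u) = 0 := by
    rw [qf_succ]
    have : (Fin.cons 1 u : Fin (M+1) → L) ∘ Fin.succ = u := by ext i; simp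
    rw [this]
    simp only [Fin.cons_zero, Fin.cons_succ]
    have e : ∑ i : Fin M, u i * (ψ 0 i.succ + ψ i.succ 0) = ∑ i : Fin M, (ψ 0 i.succ + ψ i.succ 0) * u i :=
      Finset.sum_congr rfl fun i _ => mul_comm _ _
    rw [e] at v1
    linear_combination v1 + (ψ 0 0) * h2
  have := congrFun (hψ _ hz) 0
  simp at this

end

section
variable {F : Type} [Field F] {ι : Type} [Fintype ι] {A : Matrix ι ι F}

theorem sep (h2 : (2 : F) = 0) (hA : PfLike A) {s : F} (hs : An (qf (dbl A s))) :
    ∀ (M : ℕ) (_ : M ≤ Fintype.card ι) (ψ : Matrix (Fin M) (Fin M) F) (j0 : Fin M → ι ⊕ ι → F)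
      (_ : Function.Injective (lc j0)) (_ : ∀ z, qf (dbl A s) (lc j0 z) = qf ψ z),
    ∃ (L : Type) (_ : Field L) (φ : F →+* L) (t : L),
      An (qf (dbl (A.map φ) (φ s))) ∧ An (qf (dbl (A.map φ) t)) ∧ An (qf (dbl (A.map φ) (φ s * t))) ∧
      ∃ j : Fin M → ι ⊕ ι → L, ∀ z, qf (dbl (A.map φ) t) (lc j z) = qf (ψ.map φ) z
  | 0, _, ψ, j0, hj0, hj => by
    have := hA.nonempty
    obtain ⟨h1, hs0⟩ := An_dbl hs
    refine ⟨RatFunc F, inferInstance, rc F, RatFunc.X, ?_, ?_, ?_, fun i => i.elim0, fun z => ?_⟩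
    · rw [← dbl_map]; exact An_rc hs
    · have := An_dbl_X h1 (one_ne_zero (α := F))
      rwa [map_one, one_mul] at this
    · exact An_dbl_X h1 hs0
    · rw [Subsingleton.elim z 0, map_zero, QuadraticMap.map_zero, QuadraticMap.map_zero]
  | M+1, hM, ψ, j0, hj0, hjψ => by
    have hne := hA.nonempty
    obtain ⟨L, _, φ, t, hsL, htL, hstL, j, hj⟩ := sep h2 hA hs M (by omega) (ψ.submatrix Fin.succ Fin.succ)
      (fun i => j0 i.succ) (by
        intro x y hxy
        have key : ∀ x : Fin M → F, lc (fun i => j0 i.succ) x = lc j0 (Fin.cons 0 x) := by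
          intro x; simp [lc_apply, Fin.sum_univ_succ]
        rw [key, key] at hxy
        have := hj0 hxy
        exact (Fin.cons_injective2 this).2) (by
        intro x
        have key : ∀ x : Fin M → F, lc (fun i => j0 i.succ) x = lc j0 (Fin.cons 0 x) := by
          intro x; simp [lc_apply, Fin.sum_univ_succ]
        rw [key, hjψ, qf_succ]
        have : (Fin.cons 0 x : Fin (M+1) → F) ∘ Fin.succ = x := by ext i; simp
        rw [this]; simp)
    have h2L : (2 : L) = 0 := by rw [← map_ofNat φ 2, h2, map_zero]
    have hAL := hA.map φ
    set B := A.map φ with hB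
    set ψL := ψ.map φ with hψL
    have hjs : ∀ z, qf (dbl B t) (lc j z) = qf (ψL.submatrix Fin.succ Fin.succ) z := hj
    have hψA : An (qf ψL) := by
      intro z hz
      have e := qf_lc_map φ _ ψ _ 1 (fun z => (hjψ z).trans (one_mul _).symm) z
      rw [map_one, one_mul, hz, dbl_map] at e
      exact lc_inj_map φ _ hj0 ((hsL _ e).trans (map_zero _).symm)
    have hψA' : An (qf (ψL.submatrix Fin.succ Fin.succ)) := by
      intro x hx
      have := hψA (Fin.cons 0 x) (by
        rw [qf_succ]
        have : (Fin.cons 0 x : Fin (M+1) → L) ∘ Fin.succ = x := by ext i; simp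
        rw [this, hx]; simp)
      ext i
      have := congrFun this i.succ
      simpa using this
    have hji : Function.Injective (lc j) := inj_of_An hψA' one_ne_zero (fun z => (hjs z).trans (one_mul _).symm)
    have hnd := (hAL.dbl t).nd' htL
    obtain ⟨w0, hw0⟩ := nd_surj hnd (lc j) hji (∑ i, (ψL 0 i.succ + ψL i.succ 0) • LinearMap.proj i)
    have hw0' : ∀ i, polar (qf (dbl B t)) w0 (j i) = ψL 0 i.succ + ψL i.succ 0 := by
      intro i
      have := hw0 (Pi.single i 1)
      rw [lc_single] at this
      rw [this]; simp [Pi.single_apply]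
    obtain ⟨p', h', hp', hhi', hperp'⟩ := perp_param (qf (dbl B t)) (lc j)
    have hcard : 0 < Fintype.card ι := Fintype.card_pos
    simp only [Module.finrank_fintype_fun_eq_card, Fintype.card_sum, Fintype.card_fin] at hp'
    obtain ⟨p, rfl⟩ : ∃ p, p' = p + 1 := ⟨p' - 1, by omega⟩
    obtain ⟨h, rfl⟩ : ∃ h, h' = lc h := ⟨_, (eq_lc h').symm⟩
    have hhj : ∀ l i, polar (qf (dbl B t)) (h l) (j i) = 0 := by
      intro l i
      have := (hperp' (h l)).2 ⟨Pi.single l 1, lc_single _ _⟩ (Pi.single i 1)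
      rwa [lc_single] at this
    obtain ⟨χ', hχ''⟩ := exists_qf ((qf (dbl B t)).comp (lc (Fin.cons w0 h : Fin (p+2) → ι ⊕ ι → L)))
    have hχ' : ∀ z, qf (dbl B t) (lc (Fin.cons w0 h : Fin (p+2) → ι ⊕ ι → L) z) = qf χ' z := by
      intro z; rw [hχ'']; rfl
    obtain ⟨D, hD'⟩ := exists_qf ((qf (dbl B t)).comp (lc h))
    have hD : ∀ z, qf (dbl B t) (lc h z) = qf D z := by
      intro z; rw [hD']; rfl
    obtain ⟨K, _, η, k1, k2, k3, kiso⟩ : ∃ (K : Type) (_ : Field K) (η : L →+* K),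
        An (qf ((dbl B (φ s)).map η)) ∧ An (qf ((dbl B t).map η)) ∧ An (qf ((dbl B (φ s * t)).map η)) ∧
        ¬ An (qf ((χ' + Matrix.single 0 0 (ψL 0 0) : Matrix (Fin (p+2)) (Fin (p+2)) L).map η)) := by
      by_cases hχA : An (qf (χ' + Matrix.single 0 0 (ψL 0 0)))
      · obtain ⟨K, _, η, x, hx, hx1, -, hsim⟩ := ff _ hχA
        have bad : ∀ b, An (qf (dbl B b)) → An (qf (dbl B (t * b))) → An (qf ((dbl B b).map η)) := by
          intro b hb htb
          by_contra hcon
          obtain ⟨c, a, hc, ha⟩ := hsim _ (dbl B b) (hAL.dbl b).round hb hcon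
          let cz : (Fin (p+1) → L) →ₗ[L] (Fin (p+2) → L) := LinearMap.pi (Fin.cons 0 (fun i => LinearMap.proj i))
          have cz0 : ∀ z, cz z 0 = 0 := fun z => by simp [cz]
          have czs : ∀ z, (cz z) ∘ Fin.succ = z := fun z => by ext i; simp [cz]
          refine nei h2L hAL htL hb htb D (by omega) (lc h) (lc a ∘ₗ cz) hhi' hc hD (fun z => ?_)
          rw [LinearMap.comp_apply, ha, qf_add, qf_single, ← hχ', lc_cons, cz0, czs, ← hD]
          simp
        refine ⟨K, inferInstance, η, ?_, ?_, ?_, ?_⟩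
        · exact bad _ hsL (by rwa [mul_comm])
        · by_contra hcon
          obtain ⟨c, a, hc, ha⟩ := hsim _ (dbl B t) (hAL.dbl t).round htL hcon
          exact no_sigma h2L (dbl B t) htL (hAL.dbl t).round' hnd j h w0 ψL hψA hhi' hjs hw0' hperp' χ' hχ' c a hc ha
        · refine bad _ hstL ?_
          have := An_dbl_sq hsL (An_dbl htL).2
          rwa [show φ s * t ^ 2 = t * (φ s * t) by ring] at this
        · rw [not_An]
          refine ⟨x, ?_, hx⟩
          intro h0; rw [h0] at hx1; simp at hx1
      · exact ⟨L, inferInstance, RingHom.id L, by rwa [map_id'], by rwa [map_id'], by rwa [map_id'], by rwa [map_id']⟩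
    obtain ⟨w, hw, hwb⟩ := ext_over h2L (dbl B t) j h w0 (ψL 0 0) _ hhi' hw0' hhj χ' hχ' η k2 kiso
    rw [dbl_map, hB, map_map'] at k1 k2 k3 hw hwb
    refine ⟨K, inferInstance, η.comp φ, η t, k1, k2, by simpa using k3, _, ext_step _ (ψ.map (η.comp φ)) (fun i => η ∘ j i) (fun z => ?_) w ?_ ?_⟩
    · have := qf_lc_map η _ _ j 1 (fun z => (hjs z).trans (one_mul _).symm) z
      rw [dbl_map, hB, map_map', map_one, one_mul] at this
      rw [this]
      rfl
    · rw [hw]; rfl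
    · intro i; rw [hwb]; simp [hψL]

end
end PN

namespace PN
open QuadraticMap Polynomial
set_option linter.all false

section
variable {F : Type} [Field F]

/-- A generic zero of `q` in a field over which `ψ` stays anisotropic. -/
def GZ {n M : ℕ} (q : Matrix (Fin (n+2)) (Fin (n+2)) F) (ψ : Matrix (Fin M) (Fin M) F) : Prop :=
  ∃ (K : Type) (_ : Field K) (φ : F →+* K) (x : Fin (n+2) → K),
      qf (q.map φ) x = 0 ∧ x (Fin.last _) = 1 ∧
      (∀ r0 r1 : MvPolynomial (Fin n) F,
        MvPolynomial.eval₂ φ (fun i => x i.castSucc.succ) r0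
          + x 0 * MvPolynomial.eval₂ φ (fun i => x i.castSucc.succ) r1 = 0 → r0 = 0 ∧ r1 = 0) ∧
      An (qf (ψ.map φ))

theorem gz_zero {n : ℕ} (q : Matrix (Fin (n+2)) (Fin (n+2)) F) (hq : An (qf q)) (ψ : Matrix (Fin 0) (Fin 0) F) :
    GZ q ψ := by
  obtain ⟨K, _, φ, x, h1, h2, h3, -⟩ := ff q hq
  exact ⟨K, inferInstance, φ, x, h1, h2, h3, fun z _ => Subsingleton.elim _ _⟩

theorem gz_succ {ι : Type} [Fintype ι] {A : Matrix ι ι F} (h2 : (2 : F) = 0) (hA : PfLike A) {s : F}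
    (hs : An (qf (dbl A s))) {n M : ℕ} (q : Matrix (Fin (n+2)) (Fin (n+2)) F) (ψ : Matrix (Fin M) (Fin M) F)
    (hn : Fintype.card ι < n + 2) (hM : M ≤ Fintype.card ι) {d : F} (hd : d ≠ 0)
    (f : Fin (n+2) → ι ⊕ ι → F) (hfi : Function.Injective (lc f)) (hf : ∀ z, qf (dbl A s) (lc f z) = d * qf q z)
    (j0 : Fin M → ι ⊕ ι → F) (hj0i : Function.Injective (lc j0)) (hj0 : ∀ z, qf (dbl A s) (lc j0 z) = d * qf ψ z) :
    GZ q ψ := by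
  obtain ⟨L, _, φ, t, hsL, htL, hstL, j, hj⟩ := sep h2 hA hs M hM (d • ψ) j0 hj0i (fun z => by rw [hj0, qf_smul])
  have h2L : (2 : L) = 0 := by rw [← map_ofNat φ 2, h2, map_zero]
  have hAL := hA.map φ
  have hd' : φ d ≠ 0 := by simpa using hd
  have sm : (d • ψ).map φ = φ d • ψ.map φ := by ext; simp
  simp only [sm, qf_smul] at hj
  have hqL : ∀ z, qf (dbl (A.map φ) (φ s)) (lc (fun l => φ ∘ f l) z) = φ d * qf (q.map φ) z := by
    intro z
    have := qf_lc_map φ _ q f d hf z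
    rwa [dbl_map] at this
  have hqLA : An (qf (q.map φ)) := by
    intro z hz
    have e := hqL z
    rw [hz, mul_zero] at e
    exact lc_inj_map φ _ hfi ((hsL _ e).trans (map_zero _).symm)
  have hψLA : An (qf (ψ.map φ)) := by
    intro z hz
    have e := qf_lc_map φ _ ψ j0 d hj0 z
    rw [dbl_map, hz, mul_zero] at e
    exact lc_inj_map φ _ hj0i ((hsL _ e).trans (map_zero _).symm)
  have hji : Function.Injective (lc j) := inj_of_An hψLA hd' hj
  obtain ⟨K, _, η, x, hx, hx1, hgen, hsim⟩ := ff (q.map φ) hqLA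
  have htK : An (qf ((dbl (A.map φ) t).map η)) := by
    by_contra hcon
    obtain ⟨c, a, hc, ha⟩ := hsim _ _ (hAL.dbl t).round htL hcon
    refine nei h2L hAL hsL htL hstL (φ d • q.map φ) hn (lc (fun l => φ ∘ f l)) (lc a) (lc_inj_map φ _ hfi)
      (c := c * (φ d)⁻¹) (by positivity) (fun z => by rw [hqL, qf_smul]) (fun z => ?_)
    rw [ha, qf_smul]; field_simp
  refine ⟨K, inferInstance, η.comp φ, x, ?_, hx1, ?_, ?_⟩
  · rw [← map_map']; exact hx
  · intro r0 r1 h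
    rw [← MvPolynomial.eval₂_map, ← MvPolynomial.eval₂_map] at h
    obtain ⟨g0, g1⟩ := hgen _ _ h
    have hinj := MvPolynomial.map_injective (σ := Fin n) φ φ.injective
    exact ⟨hinj (g0.trans (map_zero _).symm), hinj (g1.trans (map_zero _).symm)⟩
  · rw [← map_map']
    intro z hz
    have e := qf_lc_map η _ _ j _ hj z
    rw [hz, mul_zero] at e
    exact lc_inj_map η _ hji ((htK _ e).trans (map_zero _).symm)

theorem eval_eq {n : ℕ} (q : QF F n) (x : Fin n → F) : QF.eval q x = qf q x := by
  rw [qf_apply]; rfl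

/-- The generic affine vector. -/
noncomputable def av (F : Type) [Field F] (n : ℕ) (i : Fin (n+2)) : MvPolynomial (Fin (n+1)) F :=
  if h : (i : ℕ) < n + 1 then MvPolynomial.X (⟨(i : ℕ), h⟩ : Fin (n+1)) else 1

theorem affine_eq {n : ℕ} (q : QF F (n+2)) :
    QF.affinePoly q = qf (q.map (MvPolynomial.C : F →+* MvPolynomial (Fin (n+1)) F)) (av F n) := by
  rw [qf_apply]; rfl

theorem av_last (n : ℕ) : av F n (Fin.last _) = 1 := by simp [av]
theorem av_castSucc (n : ℕ) (i : Fin (n+1)) : av F n i.castSucc = MvPolynomial.X i := by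
  simp only [av, Fin.val_castSucc]
  rw [dif_pos i.2]

theorem qf_map_comp {R S T : Type} [CommRing R] [CommRing S] [CommRing T] {ι : Type} [Fintype ι]
    (f : R →+* S) (g : S →+* T) (A : Matrix ι ι R) (v : ι → S) :
    g (qf (A.map f) v) = qf (A.map (g.comp f)) (g ∘ v) := by
  rw [← qf_map]; congr 1


end
end PN

namespace PN
open QuadraticMap Polynomial
set_option linter.all false

theorem ker_abs {R K : Type} [CommRing R] [Nontrivial R] [CommRing K] (g : R[X] →+* K) (a a' b c : R) (ha : a' * a = 1)
    (P0 : R[X]) (hE : P0 = C a * X ^ 2 + C b * X + C c) (h0 : g P0 = 0)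
    (hgen : ∀ r0 r1 : R, g (C r0) + g X * g (C r1) = 0 → r0 = 0 ∧ r1 = 0) (h : R[X]) (hh : g h = 0) : P0 ∣ h := by
  set P : R[X] := C a' * P0 with hP
  have hP' : P = X ^ 2 + (C (a' * b) * X + C (a' * c)) := by
    rw [hP, hE, mul_add, mul_add, ← mul_assoc, ← C_mul, ha]
    simp only [C_mul, map_one]; ring
  have hmon : P.Monic := by
    rw [hP']
    apply monic_X_pow_add
    exact lt_of_le_of_lt degree_linear_le (by norm_num)
  have hdeg : P.natDegree = 2 := by
    rw [hP']
    apply natDegree_eq_of_degree_eq_some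
    rw [degree_add_eq_left_of_degree_lt, degree_X_pow]
    rw [degree_X_pow]
    exact lt_of_le_of_lt degree_linear_le (by norm_num)
  have hrd : (h %ₘ P).natDegree ≤ 1 := by
    have := natDegree_modByMonic_lt h hmon (by intro h1; rw [h1] at hdeg; simp at hdeg)
    omega
  have hsplit := modByMonic_add_div h P
  have hrz : g (h %ₘ P) = 0 := by
    have := congrArg g hsplit
    rw [map_add, map_mul, hP, map_mul, h0, hh] at this
    simpa using this
  have hr := eq_X_add_C_of_natDegree_le_one hrd
  rw [hr, map_add, map_mul] at hrz
  obtain ⟨z0, z1⟩ := hgen ((h %ₘ P).coeff 0) ((h %ₘ P).coeff 1) (by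
    rw [← hrz]; ring)
  rw [z0, z1] at hr
  rw [hr] at hsplit
  refine ⟨C a' * (h /ₘ P), ?_⟩
  conv_lhs => rw [← hsplit]
  rw [hP]; simp; ring

theorem quad_abs {R S : Type} [CommRing R] [CommRing S] {m : ℕ} (φ : R →+* S) (A : Matrix (Fin (m+1)) (Fin (m+1)) R) (u : Fin m → S) :
    ∃ b c : S, qf (A.map ((C : S →+* S[X]).comp φ)) (Fin.cons X (fun i => C (u i)) : Fin (m+1) → S[X]) =
      C (φ (A 0 0)) * X ^ 2 + C b * X + C c := by
  refine ⟨∑ i : Fin m, (φ (A 0 i.succ) + φ (A i.succ 0)) * u i,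
      qf ((A.submatrix Fin.succ Fin.succ).map φ) u, ?_⟩
  rw [qf_succ, ← qf_map C]
  simp only [Fin.cons_zero, Fin.cons_succ, Matrix.map_apply, RingHom.comp_apply, ← C_add, ← C_mul, map_sum, mul_comm X]
  rfl

section
variable {F : Type} [Field F]

theorem fse_C (n : ℕ) (r : F) : MvPolynomial.finSuccEquiv F n (MvPolynomial.C r) = C (MvPolynomial.C r) := by
  simp [MvPolynomial.finSuccEquiv_apply]

/-- The affine equation, with the expected type. -/
noncomputable def ap {n : ℕ} (q : QF F (n+2)) : MvPolynomial (Fin (n+1)) F :=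
  qf (q.map (MvPolynomial.C : F →+* MvPolynomial (Fin (n+1)) F)) (av F n)

theorem fse_affine {n : ℕ} (q : QF F (n+2)) :  ∃ b c : MvPolynomial (Fin n) F, MvPolynomial.finSuccEquiv F n (ap q) =
      C (MvPolynomial.C (q 0 0)) * X ^ 2 + C b * X + C c := by
    let u : Fin (n+1) → MvPolynomial (Fin n) F := fun i => if h : (i : ℕ) < n then MvPolynomial.X ⟨(i : ℕ), h⟩ else 1
    obtain ⟨E, hEd⟩ : ∃ E : MvPolynomial (Fin (n+1)) F →+* (MvPolynomial (Fin n) F)[X], ∀ p, E p = MvPolynomial.finSuccEquiv F n p :=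
      ⟨(MvPolynomial.finSuccEquiv F n : _ →+* _), fun p => rfl⟩
    have e1 : E ∘ av F n = (Fin.cons X (fun i => C (u i)) : Fin (n+2) → (MvPolynomial (Fin n) F)[X]) := by
      ext1 i
      refine Fin.cases ?_ (fun i => ?_) i
      · have : av F n 0 = MvPolynomial.X 0 := av_castSucc n 0
        rw [Function.comp, this, hEd, MvPolynomial.finSuccEquiv_X_zero, Fin.cons_zero]
      · refine Fin.lastCases ?_ (fun i => ?_) i
        · rw [Function.comp, Fin.succ_last, av_last]; simp [u]
        · rw [Function.comp, Fin.succ_castSucc, av_castSucc, hEd, MvPolynomial.finSuccEquiv_X_succ,← Fin.succ_castSucc, Fin.cons_succ]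
          simp only [u, Fin.val_castSucc]
          rw [dif_pos i.2]
    have e2 : E.comp MvPolynomial.C = (C : MvPolynomial (Fin n) F →+* _).comp MvPolynomial.C := by
      ext1 r; simp only [RingHom.comp_apply, hEd, fse_C]
    have key := quad_abs (MvPolynomial.C : F →+* MvPolynomial (Fin n) F) q u
    rw [← e1, ← e2, ← qf_map_comp] at key
    simpa only [← hEd, ap] using key

theorem ker_gen {n : ℕ} (q : QF F (n+2)) (h00 : q 0 0 ≠ 0) {K : Type} [Field K] (φ : F →+* K) (x : Fin (n+2) → K)
    (hx : qf (q.map φ) x = 0) (hx1 : x (Fin.last _) = 1)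
    (hgen : ∀ r0 r1 : MvPolynomial (Fin n) F,
        MvPolynomial.eval₂ φ (fun i => x i.castSucc.succ) r0
          + x 0 * MvPolynomial.eval₂ φ (fun i => x i.castSucc.succ) r1 = 0 → r0 = 0 ∧ r1 = 0)
    (h : MvPolynomial (Fin (n+1)) F) :
    MvPolynomial.eval₂Hom φ (fun i => x i.castSucc) h = 0 ↔ ap q ∣ h := by
  obtain ⟨g, hg⟩ : ∃ g, g = MvPolynomial.eval₂Hom φ (fun i : Fin (n+1) => x i.castSucc) := ⟨_, rfl⟩
  rw [← hg]
  have hgX : ∀ i, g (MvPolynomial.X i) = x i.castSucc := fun i => by rw [hg, MvPolynomial.eval₂Hom_X']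
  have hgC : ∀ r, g (MvPolynomial.C r) = φ r := fun i => by rw [hg, MvPolynomial.eval₂Hom_C]
  have hgv : g ∘ av F n = x := by
    ext i
    refine Fin.lastCases ?_ (fun i => ?_) i
    · rw [Function.comp, av_last, hx1, map_one]
    · rw [Function.comp, av_castSucc, hgX]
  have hga : g (ap q) = 0 := by
    rw [ap, qf_map_comp, hgv]
    rw [← hx]; congr 2
    ext i j; simp only [Matrix.map_apply, RingHom.comp_apply, hgC]
  constructor
  swap
  · rintro ⟨r, rfl⟩; rw [map_mul, hga, zero_mul]
  intro hh
  obtain ⟨b, c, hE⟩ := fse_affine q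
  have hEC := fse_C (F := F) n
  have hEX0 := MvPolynomial.finSuccEquiv_X_zero (R := F) (n := n)
  have hEXs := fun j => MvPolynomial.finSuccEquiv_X_succ (R := F) (n := n) (j := j)
  generalize MvPolynomial.finSuccEquiv F n = E at hE hEC hEX0 hEXs
  obtain ⟨g', hg'⟩ : ∃ g' : (MvPolynomial (Fin n) F)[X] →+* K, ∀ p, g' p = g (E.symm p) :=
    ⟨g.comp (E.symm : _ →+* MvPolynomial (Fin (n+1)) F), fun p => rfl⟩
  have hg'E : ∀ p, g' (E p) = g p := fun p => by rw [hg', E.symm_apply_apply]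
  have hC : ∀ r, g' (C r) = MvPolynomial.eval₂ φ (fun i : Fin n => x i.castSucc.succ) r := by
      intro r
      have : g'.comp C = MvPolynomial.eval₂Hom φ (fun i : Fin n => x i.castSucc.succ) := by
        apply MvPolynomial.ringHom_ext
        · intro r
          rw [RingHom.comp_apply, ← hEC, hg'E, hgC, MvPolynomial.eval₂Hom_C]
        · intro i
          rw [RingHom.comp_apply, ← hEXs, hg'E, hgX, MvPolynomial.eval₂Hom_X', Fin.succ_castSucc]
      exact congrArg (fun f => f r) this
  have hX : g' X = x 0 := by rw [← hEX0, hg'E, hgX]; rfl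
  have := ker_abs g' (MvPolynomial.C (q 0 0)) (MvPolynomial.C (q 0 0)⁻¹) b c (by rw [← MvPolynomial.C_mul, inv_mul_cancel₀ h00, map_one])
    _ hE (by rw [hg'E, hga]) (fun r0 r1 h => hgen r0 r1 (by rw [← hC, ← hC, ← hX]; exact h)) (E h) (by rw [hg'E, hh])
  exact (map_dvd_iff E).1 this

end
end PN

namespace PN
open QuadraticMap
set_option linter.all false
section
variable {F : Type} [Field F]

theorem ff_elem {σ : Type} {K : Type} [Field K] [Algebra F K] (f : MvPolynomial σ F →ₐ[F] K)
    (h : IntermediateField.adjoin F (Set.range fun i => f (MvPolynomial.X i)) = ⊤) (y : K) :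
    ∃ p r : MvPolynomial σ F, f r ≠ 0 ∧ f p = y * f r := by
  have hy : y ∈ IntermediateField.adjoin F (Set.range fun i => f (MvPolynomial.X i)) := by rw [h]; trivial
  rw [IntermediateField.mem_adjoin_range_iff] at hy
  obtain ⟨p, r, e⟩ := hy
  have hf : ∀ p, MvPolynomial.aeval (fun i => f (MvPolynomial.X i)) p = f p := by
    intro p
    have : MvPolynomial.aeval (fun i => f (MvPolynomial.X i)) = f := by ext; simp
    rw [this]
  rw [hf, hf] at e
  by_cases hr : f r = 0
  · exact ⟨0, 1, by simp, by rw [e, hr]; simp⟩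
  · exact ⟨p, r, hr, by rw [e]; field_simp⟩

theorem common_den {σ : Type} {K : Type} [Field K] [Algebra F K] (f : MvPolynomial σ F →ₐ[F] K)
    (h : IntermediateField.adjoin F (Set.range fun i => f (MvPolynomial.X i)) = ⊤) {M : ℕ} (y : Fin M → K) :
    ∃ (P : Fin M → MvPolynomial σ F) (D : K), D ≠ 0 ∧ ∀ i, f (P i) = D * y i := by
  choose p r hr hp using fun i => ff_elem f h (y i)
  refine ⟨fun i => p i * ∏ j ∈ Finset.univ.erase i, r j, ∏ j, f (r j), Finset.prod_ne_zero_iff.2 (fun i _ => hr i), fun i => ?_⟩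
  rw [map_mul, hp, map_prod, ← Finset.mul_prod_erase Finset.univ _ (Finset.mem_univ i)]
  ring

theorem qf_smulv {R ι : Type} [CommRing R] [Fintype ι] (A : Matrix ι ι R) (D : R) (y : ι → R) :
    qf A (fun i => D * y i) = D * D * qf A y := by
  have : (fun i => D * y i) = D • y := rfl
  rw [this, QuadraticMap.map_smul]; rfl

theorem An_model_aux {n M : ℕ} (q : QF F (n+2)) (h00 : q 0 0 ≠ 0) (ψ : QF F M) (hgz : GZ q ψ) (K : Type) [Field K] [Algebra F K]
    (f : MvPolynomial (Fin (n+1)) F →ₐ[F] K) (hker : RingHom.ker f = Ideal.span {ap q})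
    (hadj : IntermediateField.adjoin F (Set.range fun i => f (MvPolynomial.X i)) = ⊤) :
    An (qf (ψ.map (algebraMap F K))) ∧ ∃ x : Fin (n+2) → K, x ≠ 0 ∧ qf (q.map (algebraMap F K)) x = 0 := by
  have hk : ∀ p, f p = 0 ↔ ap q ∣ p := by
    intro p
    rw [← Ideal.mem_span_singleton, ← hker, RingHom.mem_ker]
  have hfC : (f : MvPolynomial (Fin (n+1)) F →+* K).comp MvPolynomial.C = algebraMap F K := by
    ext r; simp [MvPolynomial.algHom_C]
  constructor
  · obtain ⟨L, _, φ, x, hx, hx1, hgen, hAn⟩ := hgz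
    have hkg := ker_gen q h00 φ x hx hx1 hgen
    generalize hg : MvPolynomial.eval₂Hom φ (fun i : Fin (n+1) => x i.castSucc) = g at hkg
    have hgC : g.comp MvPolynomial.C = φ := by
      ext r; rw [← hg]; simp
    intro y hy
    obtain ⟨P, D, hD, hP⟩ := common_den f hadj y
    have e1 : f (qf (ψ.map (MvPolynomial.C : F →+* MvPolynomial (Fin (n+1)) F)) P) = 0 := by
      have := qf_map_comp (MvPolynomial.C : F →+* MvPolynomial (Fin (n+1)) F) (f : MvPolynomial (Fin (n+1)) F →+* K) ψ P
      rw [hfC] at this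
      refine this.trans ?_
      have e : ((f : MvPolynomial (Fin (n+1)) F →+* K) ∘ P) = fun i => D * y i := funext hP
      rw [e, qf_smulv, hy, mul_zero]
    have e2 := (hkg _).2 ((hk _).1 e1)
    rw [qf_map_comp, hgC] at e2
    have e3 := hAn _ e2
    ext i
    have e4 : g (P i) = 0 := congrFun e3 i
    have e5 := (hk _).2 ((hkg _).1 e4)
    rw [hP] at e5
    exact (mul_eq_zero.1 e5).resolve_left hD
  · refine ⟨f ∘ av F n, ?_, ?_⟩
    · intro h
      have := congrFun h (Fin.last _)
      simp [av_last] at this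
    · have := qf_map_comp (MvPolynomial.C : F →+* MvPolynomial (Fin (n+1)) F) (f : MvPolynomial (Fin (n+1)) F →+* K) q (av F n)
      rw [hfC] at this
      refine this.symm.trans ?_
      exact (hk _).2 (by rw [ap])

theorem An_model {n M : ℕ} (q : QF F (n+2)) (h00 : q 0 0 ≠ 0) (ψ : QF F M) (hgz : GZ q ψ) (K : Type) [Field K] [Algebra F K]
    (hK : QF.IsFunctionField q K) :
    An (qf (ψ.map (algebraMap F K))) ∧ ∃ x : Fin (n+2) → K, x ≠ 0 ∧ qf (q.map (algebraMap F K)) x = 0 := by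
  obtain ⟨f, h1, h2⟩ := hK
  have e : QF.affinePoly q = ap q := affine_eq q
  rw [e] at h1
  exact An_model_aux q h00 ψ hgz K f h1 h2
end
end PN

namespace PN
open QuadraticMap
set_option linter.all false
section
variable {K : Type} [Field K] {X Y V W U : Type} [AddCommGroup X] [Module K X] [FiniteDimensional K X]
  [AddCommGroup Y] [Module K Y] [FiniteDimensional K Y]
  [AddCommGroup V] [Module K V] [FiniteDimensional K V] [AddCommGroup W] [Module K W] [FiniteDimensional K W]
  [AddCommGroup U] [Module K U] [FiniteDimensional K U]

theorem ti_polar (Q : QuadraticForm K X) (ζ : V →ₗ[K] X) (h : ∀ v, Q (ζ v) = 0) (v w : V) :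
    polar Q (ζ v) (ζ w) = 0 := by
  rw [polar, ← map_add, h, h, h]; simp

theorem perp_eq (Q : QuadraticForm K W) (hQ : ND Q) (J : V →ₗ[K] W) (hJ : Function.Injective J)
    (P : U →ₗ[K] W) (hP : Function.Injective P) (h : ∀ u v, polar Q (P u) (J v) = 0)
    (hd : Module.finrank K W ≤ Module.finrank K U + Module.finrank K V) (x : W)
    (hx : ∀ v, polar Q x (J v) = 0) : ∃ u, P u = x := by
  have hB : (polarBilin Q).Nondegenerate := by
    have : (polarBilin Q).IsRefl := fun a b h => by
      simp only [polarBilin_apply_apply] at h ⊢; rw [polar_comm, h]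
    rw [this.nondegenerate_iff_separatingLeft]
    intro x hx
    exact hQ x (fun y => by simpa using hx y)
  have e := LinearMap.BilinForm.finrank_orthogonal hB (LinearMap.range J)
  rw [LinearMap.finrank_range_of_inj hJ] at e
  have hle : LinearMap.range P ≤ LinearMap.BilinForm.orthogonal (polarBilin Q) (LinearMap.range J) := by
    rintro _ ⟨u, rfl⟩
    rw [LinearMap.BilinForm.mem_orthogonal_iff]
    rintro _ ⟨v, rfl⟩
    show polar Q (J v) (P u) = 0
    rw [polar_comm]; exact h u v
  have heq := Submodule.eq_of_le_of_finrank_le hle (by rw [LinearMap.finrank_range_of_inj hP]; omega)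
  have : x ∈ LinearMap.range P := by
    rw [heq, LinearMap.BilinForm.mem_orthogonal_iff]
    rintro _ ⟨v, rfl⟩
    simp [polar_comm, hx, LinearMap.BilinForm.IsOrtho]
  exact this

theorem dual_sys (Q : QuadraticForm K X) {z : ℕ} (ζ : (Fin z → K) →ₗ[K] X)
    (hr : ∀ a, (∀ x, polar Q (ζ a) x = 0) → a = 0) :
    ∃ η : (Fin z → K) →ₗ[K] X, ∀ a b, polar Q (ζ a) (η b) = a ⬝ᵥ b := by
  let Λ : X →ₗ[K] (Fin z → K) := LinearMap.pi (fun i => polarBilin Q (ζ (Pi.single i 1)))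
  have hΛ : ∀ a x, polar Q (ζ a) x = a ⬝ᵥ Λ x := by
    intro a x
    have : ((polarBilin Q).flip x).comp ζ = (dotProductBilin K K).flip (Λ x) := by
      apply LinearMap.pi_ext'
      intro i
      ext
      simp [Λ]
    simpa using congrArg (fun g => g a) this
  have hs : Function.Surjective Λ := by
    rw [← LinearMap.dualMap_injective_iff, injective_iff_map_eq_zero]
    intro l hl
    have hl' : ∀ y, l y = (fun i => l (Pi.single i 1)) ⬝ᵥ y := by
      intro y
      conv_lhs => rw [← Finset.univ_sum_single y]
      rw [map_sum]
      simp only [dotProduct]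
      refine Finset.sum_congr rfl fun i _ => ?_
      have : (Pi.single i (y i) : Fin z → K) = y i • Pi.single i 1 := by simp [← Pi.single_smul]
      rw [this, map_smul, smul_eq_mul, mul_comm]
    have h0 := hr (fun i => l (Pi.single i 1)) (fun x => by
      rw [hΛ, ← hl']; exact congrArg (fun g => g x) hl)
    ext i
    simpa using congrFun h0 i
  obtain ⟨η, hη⟩ := Λ.exists_rightInverse_of_surjective (LinearMap.range_eq_top.2 hs)
  refine ⟨η, fun a b => ?_⟩
  rw [hΛ]
  congr 1
  exact congrArg (fun g => g b) hη

theorem dual_sys_iso (Q : QuadraticForm K X) {z : ℕ} (ζ : (Fin z → K) →ₗ[K] X) (hz : ∀ a, Q (ζ a) = 0)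
    (hr : ∀ a, (∀ x, polar Q (ζ a) x = 0) → a = 0) :
    ∃ η : (Fin z → K) →ₗ[K] X, (∀ b, Q (η b) = 0) ∧ ∀ a b, polar Q (ζ a) (η b) = a ⬝ᵥ b := by
  obtain ⟨η, hη⟩ := dual_sys Q ζ hr
  obtain ⟨M, hM⟩ := exists_qf (Q.comp η)
  have hM' : ∀ b, Q (η b) = Matrix.vecMul b M ⬝ᵥ b := by
    intro b
    have := congrArg (fun g => g b) hM
    simp only [QuadraticMap.comp_apply] at this
    rw [← this, qf_apply]
    simp only [Matrix.vecMul, dotProduct, Finset.sum_mul]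
    rw [Finset.sum_comm]
    refine Finset.sum_congr rfl fun i _ => Finset.sum_congr rfl fun j _ => ?_
    ring
  refine ⟨η - ζ.comp (Matrix.vecMulLinear M), fun b => ?_, fun a b => ?_⟩
  · have : (η - ζ.comp (Matrix.vecMulLinear M)) b = η b + (- ζ (Matrix.vecMul b M)) := by
      simp [sub_eq_add_neg]
    rw [this, qadd, QuadraticMap.map_neg, hz, polar_neg_right, polar_comm, hη, hM']; ring
  · simp only [LinearMap.sub_apply, polar_sub_right, hη, LinearMap.comp_apply, ti_polar Q ζ hz]; simp

theorem hs_lem (Q : QuadraticForm K X) (c : QuadraticForm K Y) (hc : An c) {z : ℕ} (ι : Y →ₗ[K] X)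
    (hι : ∀ y, Q (ι y) = c y) (ζ : (Fin z → K) →ₗ[K] X) (hz : ∀ a, Q (ζ a) = 0)
    (hr : ∀ a, (∀ x, polar Q (ζ a) x = 0) → a = 0) (hιζ : ∀ y a, polar Q (ι y) (ζ a) = 0)
    (hd : Module.finrank K X = Module.finrank K Y + (z + z)) :
    ∃ e : (Y × ((Fin z → K) × (Fin z → K))) ≃ₗ[K] X, ∀ y a b, Q (e (y, (a, b))) = c y + a ⬝ᵥ b := by
  obtain ⟨η, hη0, hη⟩ := dual_sys_iso Q ζ hz hr
  let m : Y →ₗ[K] (Fin z → K) := LinearMap.pi (fun i => ((polarBilin Q).flip (η (Pi.single i 1))).comp ι)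
  have hm : ∀ y b, polar Q (ι y) (η b) = m y ⬝ᵥ b := by
    intro y b
    have : ((polarBilin Q) (ι y)).comp η = (dotProductBilin K K) (m y) := by
      apply LinearMap.pi_ext'
      intro i
      ext
      simp [m]
    simpa using congrArg (fun g => g b) this
  let κ : Y →ₗ[K] X := ι - ζ.comp m
  have hκ : ∀ y, Q (κ y) = c y := by
    intro y
    have : κ y = ι y + (- ζ (m y)) := by simp [κ, sub_eq_add_neg]
    rw [this, qadd, QuadraticMap.map_neg, hz, polar_neg_right, hιζ, hι]; ring
  have hκζ : ∀ y a, polar Q (κ y) (ζ a) = 0 := by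
    intro y a
    simp only [κ, LinearMap.sub_apply, polar_sub_left, hιζ, LinearMap.comp_apply, ti_polar Q ζ hz]; simp
  have hκη : ∀ y a, polar Q (κ y) (η a) = 0 := by
    intro y a
    simp only [κ, LinearMap.sub_apply, polar_sub_left, hm, LinearMap.comp_apply, hη]; simp
  let E : (Y × ((Fin z → K) × (Fin z → K))) →ₗ[K] X := κ.coprod (ζ.coprod η)
  have hE : ∀ y a b, E (y, (a, b)) = κ y + (ζ a + η b) := fun y a b => by simp [E]
  have hQE : ∀ y a b, Q (E (y, (a, b))) = c y + a ⬝ᵥ b := by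
    intro y a b
    rw [hE, qadd, qadd, hκ, hz, hη0, polar_add_right, hκζ, hκη, hη]; ring
  have hinj : Function.Injective E := by
    rw [injective_iff_map_eq_zero]
    rintro ⟨y, a, b⟩ h
    have hb : b = 0 := by
      have : ∀ a', a' ⬝ᵥ b = 0 := by
        intro a'
        have e : polar Q (ζ a') (E (y, (a, b))) = a' ⬝ᵥ b := by
          rw [hE, polar_add_right, polar_add_right, polar_comm, hκζ, ti_polar Q ζ hz, hη]; ring
        rw [← e, h]; simp
      exact (dotProduct_eq_zero_iff.1 (fun w => by rw [dotProduct_comm]; exact this w))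
    have ha : a = 0 := by
      have : ∀ a', a ⬝ᵥ a' = 0 := by
        intro a'
        have e : polar Q (E (y, (a, b))) (η a') = a ⬝ᵥ a' := by
          rw [hE, polar_add_left, polar_add_left, hκη, ti_polar Q η hη0, hη]; ring
        rw [← e, h]; simp
      exact (dotProduct_eq_zero_iff.1 this)
    subst ha hb
    have := hQE y 0 0
    rw [h] at this
    have hy := hc y (by simpa using this.symm)
    simp [hy]
  refine ⟨LinearEquiv.ofInjectiveOfFinrankEq E hinj ?_, hQE⟩
  simp [hd]

end
end PN

namespace PN
open QuadraticMap
set_option linter.all false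
section
variable {F : Type} [Field F]

theorem qf_orthSum {n m : ℕ} (q : QF F n) (q' : QF F m) (x : Fin (n+m) → F) :
    qf (QF.orthSum q q') x = qf q (fun i => x (Fin.castAdd m i)) + qf q' (fun i => x (Fin.natAdd n i)) := by
  rw [QF.orthSum, qf_reindex, qf_fromBlocks]
  simp
  congr 1

theorem qf_binSum {r : ℕ} (a b : Fin r → F) (x : Fin (r+r) → F) :
    qf (QF.binSum a b) x = ∑ i, (a i * x (Fin.castAdd r i) ^ 2 + b i * x (Fin.natAdd r i) ^ 2
      + x (Fin.castAdd r i) * x (Fin.natAdd r i)) := by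
  rw [QF.binSum, qf_reindex, qf_fromBlocks]
  simp [qf_apply, Matrix.diagonal_apply, Matrix.one_apply, Finset.sum_add_distrib, pow_two, mul_assoc]

theorem qf_hyper (w : ℕ) (x : Fin (w+w) → F) :
    qf (QF.hyper w) x = (fun i => x (Fin.castAdd w i)) ⬝ᵥ (fun i => x (Fin.natAdd w i)) := by
  rw [QF.hyper, qf_binSum]; simp [dotProduct]

theorem qf_zeroForm (d : ℕ) (x : Fin d → F) : qf (QF.zeroForm d) x = 0 := by
  simp [qf_apply, QF.zeroForm]

theorem qf_diag {s : ℕ} (c : Fin s → F) (x : Fin s → F) : qf (QF.diag c) x = ∑ i, c i * x i ^ 2 := by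
  simp [qf_apply, QF.diag, Matrix.diagonal_apply]
  refine Finset.sum_congr rfl fun i _ => by ring

/-- Splitting of coordinates. -/
def spl (F : Type) [Field F] (n m : ℕ) : (Fin (n+m) → F) ≃ₗ[F] (Fin n → F) × (Fin m → F) where
  toFun x := (fun i => x (Fin.castAdd m i), fun i => x (Fin.natAdd n i))
  invFun p := Fin.append p.1 p.2
  map_add' _ _ := rfl
  map_smul' _ _ := rfl
  left_inv x := by ext i; refine Fin.addCases (fun i => ?_) (fun i => ?_) i <;> simp
  right_inv p := by ext i <;> simp

theorem qf_orthSum' {n m : ℕ} (q : QF F n) (q' : QF F m) (x : Fin (n+m) → F) :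
    qf (QF.orthSum q q') x = qf q (spl F n m x).1 + qf q' (spl F n m x).2 := qf_orthSum q q' x

theorem qf_hyper' (w : ℕ) (x : Fin (w+w) → F) :
    qf (QF.hyper w) x = (spl F w w x).1 ⬝ᵥ (spl F w w x).2 := qf_hyper w x

theorem isom_of_hs {n m z : ℕ} (q : QF F n) (c : QF F m)
    (e : ((Fin m → F) × ((Fin z → F) × (Fin z → F))) ≃ₗ[F] (Fin n → F))
    (he : ∀ y a b, qf q (e (y, (a, b))) = qf c y + a ⬝ᵥ b) :
    QF.Isom q (QF.orthSum (QF.orthSum c (QF.hyper z)) (QF.zeroForm 0)) := by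
  let E : (Fin (m + (z + z)) → F) ≃ₗ[F] (Fin n → F) :=
    ((spl F m (z+z)).trans ((LinearEquiv.refl F _).prodCongr (spl F z z))).trans e
  refine ⟨E.symm, fun x => ?_⟩
  rw [eval_eq, eval_eq, qf_orthSum']
  obtain ⟨y, rfl⟩ := E.surjective x
  rw [LinearEquiv.symm_apply_apply, qf_zeroForm, add_zero]
  have : (spl F (m + (z+z)) 0 y).1 = y := rfl
  rw [this, qf_orthSum', qf_hyper']
  exact (he _ _ _).symm
end
end PN

namespace PN
open QuadraticMap
set_option linter.all false
section
variable {F : Type} [Field F]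

theorem polar_self2 {V : Type} [AddCommGroup V] [Module F V] (h2 : (2:F) = 0) (Q : QuadraticForm F V) (v : V) : polar Q v v = 0 := by
  rw [polar_self, two_smul, ← two_mul, h2, zero_mul]

theorem compl {κ : Type} [Fintype κ] (h2 : (2:F) = 0) (B : Matrix κ κ F) (hB : An (qf B)) (hND : ND (qf B))
    {N M m w d w' d' : ℕ} (q : QF F N) (hq : An (qf q)) (f : (Fin N → F) →ₗ[F] (κ → F)) (hf : ∀ x, qf B (f x) = qf q x)
    (qc : QF F M) (hM : M + N = Fintype.card κ) (qa : QF F m) (hqa : An (qf qa))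
    (e1 : ((Fin m → F) × ((Fin w → F) × (Fin w → F)) × (Fin d → F)) ≃ₗ[F] ((Fin N → F) × (κ → F)))
    (he1 : ∀ y a b t, qf q (e1 (y, (a, b), t)).1 + qf B (e1 (y, (a, b), t)).2 = qf qa y + a ⬝ᵥ b)
    (e2 : (Fin M → F) ≃ₗ[F] ((Fin m → F) × ((Fin w' → F) × (Fin w' → F)) × (Fin d' → F)))
    (he2 : ∀ x, qf qc x = qf qa (e2 x).1 + (e2 x).2.1.1 ⬝ᵥ (e2 x).2.1.2) :
    An (qf qc) ∧ ∃ g : (Fin M → F) →ₗ[F] (κ → F), (∀ x, qf B (g x) = qf qc x) ∧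
      ∀ x v, polar (qf B) (g x) (f v) = 0 := by
  obtain ⟨Q, hQ⟩ : ∃ Q : QuadraticForm F ((Fin N → F) × (κ → F)), ∀ x, Q x = qf q x.1 + qf B x.2 :=
    ⟨QuadraticMap.prod (qf q) (qf B), fun x => by simp⟩
  have hQp : ∀ x y, polar Q x y = polar (qf q) x.1 y.1 + polar (qf B) x.2 y.2 := by
    intro x y; simp only [polar, hQ, Prod.fst_add, Prod.snd_add]; ring
  have hQe : ∀ y a b t, Q (e1 (y, (a, b), t)) = qf qa y + a ⬝ᵥ b := fun y a b t => by rw [hQ, he1]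
  have hQep : ∀ y a b t y' a' b' t', polar Q (e1 (y, (a, b), t)) (e1 (y', (a', b'), t')) =
      polar (qf qa) y y' + a ⬝ᵥ b' + a' ⬝ᵥ b := by
    intro y a b t y' a' b' t'
    simp only [polar]
    rw [← map_add]
    simp only [Prod.mk_add_mk, hQe, dotProduct_add, add_dotProduct]
    ring
  have polB : ∀ v v', polar (qf B) (f v) (f v') = polar (qf q) v v' := by
    intro v v'; simp only [polar, ← map_add, hf]
  have hd0 : d = 0 := by
    by_contra hd
    have key : ∀ t : Fin d → F, t = 0 := by
      intro t
      have hp : ∀ x, polar Q (e1 (0, (0, 0), t)) x = 0 := by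
        intro x
        obtain ⟨⟨y, ⟨a, b⟩, t'⟩, rfl⟩ := e1.surjective x
        rw [hQep]; simp
      have h1 : (e1 (0, (0, 0), t)).2 = 0 := by
        apply hND
        intro p
        have := hp (0, p)
        rw [hQp] at this
        simpa using this
      have h3 := he1 0 0 0 t
      rw [h1] at h3
      have h4 := hq (e1 (0, (0, 0), t)).1 (by simpa using h3)
      have h5 : e1 (0, (0, 0), t) = 0 := Prod.ext h4 h1
      have h6 := e1.map_eq_zero_iff.1 h5
      simpa using h6
    have := congrFun (key (fun _ => 1)) ⟨0, by omega⟩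
    simp at this
  subst hd0
  let j1 : (Fin N → F) →ₗ[F] ((Fin N → F) × (κ → F)) := LinearMap.id.prod f
  let j2 : (Fin w → F) →ₗ[F] ((Fin N → F) × (κ → F)) :=
    e1.toLinearMap.comp ((LinearMap.inr F _ _).comp ((LinearMap.inl F _ _).comp (LinearMap.inl F _ _)))
  have hj1 : ∀ v, j1 v = (v, f v) := fun v => rfl
  have hj2 : ∀ a, j2 a = e1 (0, (a, 0), 0) := fun v => rfl
  have hj1i : Function.Injective j1 := fun a b h => congrArg Prod.fst h
  have hj2i : Function.Injective j2 := fun a b h => by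
    rw [hj2, hj2] at h
    simpa using e1.injective h
  obtain ⟨Z1, hZ1⟩ : ∃ Z1, Z1 = LinearMap.range j1 := ⟨_, rfl⟩
  obtain ⟨Z2, hZ2⟩ : ∃ Z2, Z2 = LinearMap.range j2 := ⟨_, rfl⟩
  have hZ1f : Module.finrank F Z1 = N := by rw [hZ1, LinearMap.finrank_range_of_inj hj1i]; simp
  have hZ2f : Module.finrank F Z2 = w := by rw [hZ2, LinearMap.finrank_range_of_inj hj2i]; simp
  have hsum := Submodule.finrank_sup_add_finrank_inf_eq Z1 Z2
  obtain ⟨p, τ, hp, hτi, hτ⟩ := perp_param Q (Z1 ⊔ Z2).subtype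
  have hτ1 : ∀ z v, polar Q (τ z) (j1 v) = 0 := fun z v =>
    (hτ (τ z)).2 ⟨z, rfl⟩ ⟨j1 v, Submodule.mem_sup_left (by rw [hZ1]; exact ⟨v, rfl⟩)⟩
  have hτ2 : ∀ z v, polar Q (τ z) (j2 v) = 0 := fun z v =>
    (hτ (τ z)).2 ⟨z, rfl⟩ ⟨j2 v, Submodule.mem_sup_right (by rw [hZ2]; exact ⟨v, rfl⟩)⟩
  let G : ((Fin N → F) × (κ → F)) →ₗ[F] (κ → F) := LinearMap.snd F _ _ - f.comp (LinearMap.fst F _ _)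
  have hG : ∀ x, G x = x.2 - f x.1 := fun x => rfl
  have hpol : ∀ z v, polar (qf B) (τ z).2 (f v) = polar (qf q) (τ z).1 v := by
    intro z v
    have := hτ1 z v
    rw [hQp, hj1] at this
    have e : polar (qf q) (τ z).1 v + polar (qf q) (τ z).1 v = 0 := by rw [← two_mul, h2, zero_mul]
    linear_combination this - e
  have hGf : ∀ z v, polar (qf B) (G (τ z)) (f v) = 0 := by
    intro z v
    rw [hG, polar_sub_left, hpol, polB, sub_self]
  have hGQ : ∀ z, qf B (G (τ z)) = Q (τ z) := by
    intro z
    rw [hG, sub_eq_add_neg, qadd, QuadraticMap.map_neg, polar_neg_right, hpol, polar_self2 h2, hQ, hf]; ring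
  have hb : ∀ z, (e1.symm (τ z)).2.1.2 = 0 := by
    intro z
    obtain ⟨⟨y, ⟨a, b⟩, t⟩, hx⟩ := e1.surjective (τ z)
    rw [← hx, e1.symm_apply_apply]
    refine dotProduct_eq_zero_iff.1 (fun a' => ?_)
    have := hτ2 z a'
    rw [← hx, hj2, hQep] at this
    rw [dotProduct_comm]
    simpa using this
  have hQz : ∀ z, Q (τ z) = qf qa (e1.symm (τ z)).1 := by
    intro z
    have h := hb z
    obtain ⟨⟨y, ⟨a, b⟩, t⟩, hx⟩ := e1.surjective (τ z)
    rw [← hx, e1.symm_apply_apply] at h ⊢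
    simp only at h
    rw [hQe, h]; simp
  let μ : (Fin p → F) →ₗ[F] (Fin m → F) := (LinearMap.fst F _ _).comp (e1.symm.toLinearMap.comp τ)
  have hμ : ∀ z, μ z = (e1.symm (τ z)).1 := fun z => rfl
  have hker : Module.finrank F (LinearMap.ker μ) ≤ Module.finrank F (Z1 ⊓ Z2 : Submodule F _) := by
    have hin : ∀ z ∈ LinearMap.ker μ, τ z ∈ (Z1 ⊓ Z2 : Submodule F _) := by
      intro z hz
      rw [LinearMap.mem_ker] at hz
      constructor
      · have : Q (τ z) = 0 := by rw [hQz, ← hμ, hz, map_zero]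
        rw [← hGQ] at this
        have h3 := hB _ this
        rw [hG, sub_eq_zero] at h3
        rw [hZ1]
        exact ⟨(τ z).1, Prod.ext rfl h3.symm⟩
      · rw [hZ2]
        refine ⟨(e1.symm (τ z)).2.1.1, ?_⟩
        rw [hj2]
        apply e1.symm.injective
        rw [e1.symm_apply_apply]
        refine Prod.ext ?_ (Prod.ext (Prod.ext rfl ?_) (Subsingleton.elim _ _))
        · exact hz.symm
        · exact (hb z).symm
    refine LinearMap.finrank_le_finrank_of_injective (f := (τ.restrict hin)) ?_
    intro a b h
    apply Subtype.ext
    apply hτi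
    exact congrArg Subtype.val h
  have hrk := LinearMap.finrank_range_add_finrank_ker μ
  have d1 := e1.finrank_eq
  have d2 := e2.finrank_eq
  have hle := Submodule.finrank_le (LinearMap.range μ)
  simp at d1 d2 hrk hp hle
  rw [hZ1f, hZ2f] at hsum
  have hmM : m = M := by omega
  have hsur : LinearMap.range μ = ⊤ := by
    apply Submodule.eq_top_of_finrank_eq
    simp; omega
  have hw' : w' = 0 := by omega
  have hd' : d' = 0 := by omega
  subst hw' hd'
  have he2' : ∀ x, qf qc x = qf qa (e2 x).1 := fun x => by rw [he2]; simp
  obtain ⟨σ, hσ⟩ := μ.exists_rightInverse_of_surjective hsur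
  have hσ' : ∀ y, μ (σ y) = y := fun y => congrArg (fun g => g y) hσ
  constructor
  · intro x hx
    rw [he2'] at hx
    have h3 := hqa _ hx
    apply e2.map_eq_zero_iff.1
    exact Prod.ext h3 (Subsingleton.elim _ _)
  · refine ⟨G.comp (τ.comp (σ.comp ((LinearMap.fst F _ _).comp e2.toLinearMap))), fun x => ?_, fun x v => ?_⟩
    · simp only [LinearMap.comp_apply]
      rw [hGQ, hQz, ← hμ, hσ', he2']; rfl
    · simp only [LinearMap.comp_apply]
      exact hGf _ _
end
end PN

namespace PN
open QuadraticMap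
set_option linter.all false
section
variable {K : Type} [Field K]

theorem ker_le {κ ζ : Type} [Fintype κ] [Fintype ζ] {N P : ℕ} (f : (Fin N → K) →ₗ[K] (κ → K)) (Z : (ζ → K) →ₗ[K] (κ → K))
    (hζ : 2 * Fintype.card ζ = Fintype.card κ) (hP : P * 2 = Fintype.card κ) :
    N - P ≤ Module.finrank K (LinearMap.ker (f.coprod Z)) := by
  have h1 := LinearMap.finrank_range_add_finrank_ker (f.coprod Z)
  have h2 := Submodule.finrank_le (LinearMap.range (f.coprod Z))
  simp at h1 h2
  omega

theorem i0_bdd {N : ℕ} (q : QF K N) : BddAbove {d | ∃ W : Submodule K (Fin N → K), Module.finrank K W = d ∧ ∀ x ∈ W, QF.eval q x = 0} := by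
  refine ⟨N, ?_⟩
  rintro _ ⟨W, rfl, -⟩
  simpa using Submodule.finrank_le W

theorem i0_ge {κ : Type} [Fintype κ] (B : Matrix κ κ K) (hhalf : Half B) {N P : ℕ} (q : QF K N)
    (f : (Fin N → K) →ₗ[K] (κ → K)) (hfi : Function.Injective f) (hf : ∀ x, qf B (f x) = qf q x)
    (hP : P * 2 = Fintype.card κ) (hiso : ∃ x, x ≠ 0 ∧ qf q x = 0) : N - P ≤ QF.i0 q := by
  obtain ⟨x, hx, hx0⟩ := hiso
  obtain ⟨ζ, _, Z, hZi, hζ, hZ⟩ := hhalf ⟨f x, fun h => hx (hfi (h.trans (map_zero f).symm)), by rw [hf, hx0]⟩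
  refine (ker_le f Z hζ hP).trans ?_
  let ρ : LinearMap.ker (f.coprod Z) →ₗ[K] (Fin N → K) := (LinearMap.fst K _ _).comp (LinearMap.ker (f.coprod Z)).subtype
  have hρ : Function.Injective ρ := by
    rw [injective_iff_map_eq_zero]
    rintro ⟨⟨v, c⟩, h⟩ h0
    simp only [LinearMap.mem_ker, LinearMap.coprod_apply] at h
    have hv : v = 0 := h0
    subst hv
    rw [map_zero, zero_add] at h
    have hc : c = 0 := hZi (h.trans (map_zero _).symm)
    subst hc
    rfl
  refine le_csSup (i0_bdd q) ⟨LinearMap.range ρ, LinearMap.finrank_range_of_inj hρ, ?_⟩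
  rintro _ ⟨⟨⟨v, c⟩, h⟩, rfl⟩
  simp only [LinearMap.mem_ker, LinearMap.coprod_apply] at h
  show QF.eval q v = 0
  rw [eval_eq, ← hf, eq_neg_of_add_eq_zero_left h, QuadraticMap.map_neg, hZ]

theorem over_K {κ : Type} [Fintype κ] (h2 : (2:K) = 0) (B : Matrix κ κ K) (hND : ND (qf B)) (hhalf : Half B) {N M P : ℕ} (q : QF K N)
    (f : (Fin N → K) →ₗ[K] (κ → K)) (hfi : Function.Injective f) (hf : ∀ x, qf B (f x) = qf q x)
    (qc : QF K M) (hqc : An (qf qc)) (g : (Fin M → K) →ₗ[K] (κ → K)) (hg : ∀ x, qf B (g x) = qf qc x)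
    (hgf : ∀ x v, polar (qf B) (g x) (f v) = 0) (hMN : M + N = Fintype.card κ)
    (hP : P * 2 = Fintype.card κ) (hPN : P < N) (hiso : ∃ x, x ≠ 0 ∧ qf q x = 0) :
    ∃ e : ((Fin M → K) × ((Fin (N-P) → K) × (Fin (N-P) → K))) ≃ₗ[K] (Fin N → K),
      ∀ y a b, qf q (e (y, (a, b))) = qf qc y + a ⬝ᵥ b := by
  obtain ⟨x, hx, hx0⟩ := hiso
  obtain ⟨ζ, _, Z, hZi, hζ, hZ⟩ := hhalf ⟨f x, fun h => hx (hfi (h.trans (map_zero f).symm)), by rw [hf, hx0]⟩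
  have hgi : Function.Injective g := inj_of_An hqc one_ne_zero (fun x => by rw [hg, one_mul])
  have polB : ∀ v v', polar (qf B) (f v) (f v') = polar (qf q) v v' := by
    intro v v'; simp only [polar, ← map_add, hf]
  have hfp : ∀ y, (∀ v, polar (qf B) y (f v) = 0) → ∃ u, g u = y := 
    perp_eq (qf B) hND f hfi g hgi hgf (by simp; omega)
  have hZp : ∀ y, (∀ v, polar (qf B) y (Z v) = 0) → ∃ u, Z u = y := 
    perp_eq (qf B) hND Z hZi Z hZi (ti_polar (qf B) Z hZ) (by simp; omega)
  have hsur : Function.Surjective (f.coprod Z) := by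
    intro x
    refine nd_perp hND (f.coprod Z) x (fun y hy => ?_)
    have a1 : ∀ v, polar (qf B) y (f v) = 0 := fun v => by simpa using hy (v, 0)
    have a2 : ∀ v, polar (qf B) y (Z v) = 0 := fun v => by simpa using hy (0, v)
    obtain ⟨u, rfl⟩ := hfp y a1
    obtain ⟨c, hc⟩ := hZp _ a2
    have : qf qc u = 0 := by rw [← hg, ← hc, hZ]
    rw [hqc u this, map_zero, polar_zero_left]
  obtain ⟨σ, hσ⟩ := (f.coprod Z).exists_rightInverse_of_surjective (LinearMap.range_eq_top.2 hsur)
  have hσ' : ∀ y, f (σ y).1 + Z (σ y).2 = y := fun y => by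
    simpa using congrArg (fun g => g y) hσ
  let ι : (Fin M → K) →ₗ[K] (Fin N → K) := (LinearMap.fst K _ _).comp (σ.comp g)
  have hι : ∀ u, f (ι u) = g u + (- Z (σ (g u)).2) := fun u => by
    rw [← sub_eq_add_neg]; exact eq_sub_of_add_eq (hσ' (g u))
  have hgZ : ∀ u, polar (qf B) (g u) (Z (σ (g u)).2) = 0 := by
    intro u
    have : Z (σ (g u)).2 = g u - f (ι u) := by rw [hι]; abel
    rw [this, polar_sub_right, polar_self2 h2, hgf, sub_zero]
  have hιq : ∀ u, qf q (ι u) = qf qc u := by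
    intro u
    rw [← hf, hι, qadd, QuadraticMap.map_neg, hZ, polar_neg_right, hgZ, hg]; ring
  have hfr : Module.finrank K (Fin (N-P) → K) = Module.finrank K (LinearMap.ker (f.coprod Z)) := by
    have h1 := LinearMap.finrank_range_add_finrank_ker (f.coprod Z)
    rw [LinearMap.range_eq_top.2 hsur] at h1
    simp at h1 ⊢
    omega
  let E := LinearEquiv.ofFinrankEq (Fin (N-P) → K) (LinearMap.ker (f.coprod Z)) hfr
  let z : (Fin (N-P) → K) →ₗ[K] (Fin N → K) :=
    (LinearMap.fst K _ _).comp ((LinearMap.ker (f.coprod Z)).subtype.comp E.toLinearMap)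
  have hz : ∀ a, f (z a) = - Z (E a).1.2 := by
    intro a
    have := (E a).2
    rw [LinearMap.mem_ker, LinearMap.coprod_apply] at this
    exact eq_neg_of_add_eq_zero_left this
  have hzq : ∀ a, qf q (z a) = 0 := fun a => by rw [← hf, hz, QuadraticMap.map_neg, hZ]
  refine hs_lem (qf q) (qf qc) hqc ι hιq z hzq ?_ ?_ ?_
  · intro a ha
    obtain ⟨u, hu⟩ := hfp (f (z a)) (fun v => by rw [polB, ha])
    have h0 : u = 0 := hqc u (by rw [← hg, hu, hf, hzq])
    rw [h0, map_zero] at hu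
    have hza : z a = 0 := hfi (hu.symm.trans (map_zero f).symm)
    have h1 := hz a
    rw [← hu] at h1
    have h3 : (E a).1.2 = 0 := hZi (by rw [map_zero]; exact (neg_eq_zero.1 h1.symm))
    have h4 : E a = 0 := Subtype.ext (Prod.ext hza h3)
    exact E.map_eq_zero_iff.1 h4
  · intro u a
    rw [← polB, hι, polar_add_left, hgf, hz, polar_neg_left, polar_neg_right, ti_polar (qf B) Z hZ]; simp
  · simp; omega

theorem i0_le {N M z : ℕ} (q : QF K N) (qc : QF K M) (hqc : An (qf qc))
    (e : ((Fin M → K) × ((Fin z → K) × (Fin z → K))) ≃ₗ[K] (Fin N → K))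
    (he : ∀ y a b, qf q (e (y, (a, b))) = qf qc y + a ⬝ᵥ b) : QF.i0 q ≤ z := by
  refine csSup_le ⟨0, ⊥, by simp, fun x hx => ?_⟩ ?_
  · rw [Submodule.mem_bot] at hx; rw [hx, eval_eq, map_zero]
  rintro _ ⟨W, rfl, hW⟩
  have hW' : ∀ x : W, qf q x = 0 := fun x => by rw [← eval_eq]; exact hW x x.2
  have hWe : ∀ x : W, qf qc (e.symm x).1 + (e.symm x).2.1 ⬝ᵥ (e.symm x).2.2 = 0 := by
    intro x
    rw [← he, ← hW' x]
    congr 1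
    exact e.apply_symm_apply _
  let β : W →ₗ[K] (Fin z → K) := (LinearMap.snd K _ _).comp ((LinearMap.snd K _ _).comp (e.symm.toLinearMap.comp W.subtype))
  let α : W →ₗ[K] (Fin z → K) := (LinearMap.fst K _ _).comp ((LinearMap.snd K _ _).comp (e.symm.toLinearMap.comp W.subtype))
  have hk : ∀ x : W, β x = 0 → (e.symm x).1 = 0 := by
    intro x hx
    have := hWe x
    have hb : (e.symm x).2.2 = 0 := hx
    rw [hb] at this
    exact hqc _ (by simpa using this)
  have hpol : ∀ x y : W, β x = 0 → α x ⬝ᵥ β y = 0 := by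
    intro x y hx
    have h0 := hk x hx
    have hb : (e.symm x).2.2 = 0 := hx
    have h1 := hWe (x + y)
    have h2 := hWe y
    simp only [Submodule.coe_add, map_add, Prod.fst_add, Prod.snd_add, h0, hb, zero_add, add_dotProduct] at h1
    show (e.symm x).2.1 ⬝ᵥ (e.symm y).2.2 = 0
    linear_combination h1 - h2
  let α' : LinearMap.ker β →ₗ[K] (Fin z → K) := α.comp (LinearMap.ker β).subtype
  have hα : Function.Injective α' := by
    rw [injective_iff_map_eq_zero]
    rintro ⟨x, hx⟩ h
    rw [LinearMap.mem_ker] at hx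
    have h0 := hk x hx
    have h1 : e.symm x = 0 := Prod.ext h0 (Prod.ext h hx)
    have h2 : (x : Fin N → K) = 0 := e.symm.map_eq_zero_iff.1 h1
    exact Subtype.ext (Subtype.ext h2)
  have hnd : (dotProductBilin K K : LinearMap.BilinForm K (Fin z → K)).Nondegenerate := by
    have : (dotProductBilin K K : LinearMap.BilinForm K (Fin z → K)).IsRefl := fun a b h => by
      simp only [dotProductBilin_apply_apply] at h ⊢; rw [dotProduct_comm, h]
    rw [this.nondegenerate_iff_separatingLeft]
    intro x hx
    exact dotProduct_eq_zero_iff.1 (fun y => by simpa using hx y)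
  have e1 := LinearMap.BilinForm.finrank_orthogonal hnd (LinearMap.range α')
  rw [LinearMap.finrank_range_of_inj hα] at e1
  have hle : LinearMap.range β ≤ LinearMap.BilinForm.orthogonal (dotProductBilin K K) (LinearMap.range α') := by
    rintro _ ⟨u, rfl⟩
    rw [LinearMap.BilinForm.mem_orthogonal_iff]
    rintro _ ⟨v, rfl⟩
    show α v.1 ⬝ᵥ β u = 0
    exact hpol v.1 u v.2
  have h3 := Submodule.finrank_mono hle
  have h4 := LinearMap.finrank_range_add_finrank_ker β
  have h5 := LinearMap.finrank_le_finrank_of_injective hα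
  simp at e1 h5
  omega

theorem part1 {κ : Type} [Fintype κ] (h2 : (2:K) = 0) (B : Matrix κ κ K) (hND : ND (qf B)) {N M P r s : ℕ} (q : QF K N)
    (f : (Fin N → K) →ₗ[K] (κ → K)) (hfi : Function.Injective f) (hf : ∀ x, qf B (f x) = qf q x)
    (g : (Fin M → K) →ₗ[K] (κ → K)) (hgi : Function.Injective g)
    (hgf : ∀ x v, polar (qf B) (g x) (f v) = 0) (hMN : M + N = Fintype.card κ)
    (hP : P * 2 = Fintype.card κ) (hty : QF.HasType q r s) : r + s ≤ P := by
  obtain ⟨c, a, b, e, he⟩ := hty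
  have hd := e.finrank_eq
  simp at hd
  have polB : ∀ v v', polar (qf B) (f v) (f v') = polar (qf q) v v' := by
    intro v v'; simp only [polar, ← map_add, hf]
  have hfp : ∀ y, (∀ v, polar (qf B) y (f v) = 0) → ∃ u, g u = y := 
    perp_eq (qf B) hND f hfi g hgi hgf (by simp; omega)
  let ρ : (Fin s → K) →ₗ[K] (Fin N → K) := e.symm.toLinearMap.comp ((spl K (r+r) s).symm.toLinearMap.comp (LinearMap.inr K _ _))
  have hρi : Function.Injective ρ := by
    intro x y h
    have := (spl K (r+r) s).symm.injective (e.symm.injective h)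
    simpa using this
  have hq : ∀ x, qf q x = qf (QF.binSum a b) (spl K (r+r) s (e x)).1 + qf (QF.diag c) (spl K (r+r) s (e x)).2 := by
    intro x
    rw [← qf_orthSum', ← eval_eq, ← eval_eq, he]
  have hρ1 : ∀ t, spl K (r+r) s (e (ρ t)) = (0, t) := fun t => by simp [ρ]
  have hpol : ∀ t x, polar (qf q) (ρ t) x = 0 := by
    intro t x
    simp only [polar, hq, map_add, hρ1, Prod.fst_add, Prod.snd_add, zero_add, qf_diag, Pi.add_apply]
    rw [map_zero]
    have : ∀ i, c i * (t i + (spl K (r+r) s (e x)).2 i) ^ 2 = c i * t i ^ 2 + c i * (spl K (r+r) s (e x)).2 i ^ 2 := by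
      intro i
      linear_combination (c i * t i * (spl K (r+r) s (e x)).2 i) * h2
    simp only [this, Finset.sum_add_distrib]
    ring
  have hle : LinearMap.range (f.comp ρ) ≤ LinearMap.range g := by
    rintro _ ⟨t, rfl⟩
    exact hfp _ (fun v => by rw [LinearMap.comp_apply, polB, hpol])
  have h3 := Submodule.finrank_mono hle
  have hcomp : Function.Injective (f.comp ρ) := fun x y h => hρi (hfi h)
  rw [LinearMap.finrank_range_of_inj hgi, LinearMap.finrank_range_of_inj hcomp] at h3
  simp at h3
  omega
end
end PN

namespace PN
open QuadraticMap
set_option linter.all false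
section
variable {F : Type} [Field F]

theorem half_smul {K ι : Type} [Field K] [Fintype ι] {A : Matrix ι ι K} (h : Half A) {d : K} (hd : d ≠ 0) : Half (d • A) := by
  rintro ⟨x, hx, hx0⟩
  rw [qf_smul] at hx0
  obtain ⟨ζ, i, f, h1, h2, h3⟩ := h ⟨x, hx, (mul_eq_zero.1 hx0).resolve_left hd⟩
  exact ⟨ζ, i, f, h1, h2, fun x => by rw [qf_smul, h3, mul_zero]⟩

theorem nd_smul {K ι : Type} [Field K] [Fintype ι] {A : Matrix ι ι K} (h : ND (qf A)) {d : K} (hd : d ≠ 0) : ND (qf (d • A)) := by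
  intro x hx
  apply h
  intro y
  have := hx y
  have e : polar (qf (d • A)) x y = d * polar (qf A) x y := by simp only [polar, qf_smul]; ring
  rw [e] at this
  exact (mul_eq_zero.1 this).resolve_left hd

/-- Standard coordinates on a Witt decomposition. -/
def stdE (F : Type) [Field F] (m w d : ℕ) :
    (Fin (m + (w + w) + d) → F) ≃ₗ[F] ((Fin m → F) × ((Fin w → F) × (Fin w → F)) × (Fin d → F)) :=
  ((spl F (m + (w+w)) d).trans (((spl F m (w+w)).trans ((LinearEquiv.refl F _).prodCongr (spl F w w))).prodCongr
    (LinearEquiv.refl F _))).trans (LinearEquiv.prodAssoc F _ _ _)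

theorem qf_std {m w d : ℕ} (qa : QF F m) (x) :
    qf (QF.orthSum (QF.orthSum qa (QF.hyper w)) (QF.zeroForm d)) x =
      qf qa (stdE F m w d x).1 + (stdE F m w d x).2.1.1 ⬝ᵥ (stdE F m w d x).2.1.2 := by
  rw [qf_orthSum', qf_orthSum', qf_hyper', qf_zeroForm, add_zero]
  rfl

theorem core (h2 : (2:F) = 0) {κ : Type} [Fintype κ] (B : Matrix κ κ F) (hB : PfLike B) {d : F} (hd : d ≠ 0)
    {n r s P T M : ℕ} (hP : P * 2 = Fintype.card κ) (q : QF F (n+2)) (hty : QF.HasType q r s) (hq : An (qf q))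
    (hPN : P < n+2) (hNP : n + 2 ≤ P * 2)
    (π : QF F T) (e : (Fin T → F) ≃ₗ[F] (κ → F)) (he : ∀ x, qf π x = d * qf B (e x)) 
    (f0 : (Fin (n+2) → F) →ₗ[F] (Fin T → F)) (hf0 : ∀ x, qf π (f0 x) = qf q x)
    (qc : QF F M) (hM : M = P * 2 - (n+2)) (hw : QF.WittEquiv (QF.orthSum q π) qc)
    (hgz : An (qf B) → ∀ f : (Fin (n+2) → F) →ₗ[F] (κ → F), Function.Injective f → (∀ x, qf (d • B) (f x) = qf q x) →
      ∀ g : (Fin M → F) →ₗ[F] (κ → F), Function.Injective g → (∀ x, qf (d • B) (g x) = qf qc x) → GZ q qc) :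
    r + s ≤ P ∧
    (∀ (K : Type) [Field K] [Algebra F K], QF.IsFunctionField q K →
      QF.IsAnisotropicPart (QF.baseChange q K) (QF.baseChange qc K)) ∧
    QF.izh q = P := by
  let f : (Fin (n+2) → F) →ₗ[F] (κ → F) := e.toLinearMap.comp f0
  have hf : ∀ x, qf (d • B) (f x) = qf q x := fun x => by
    rw [← hf0, he, qf_smul]; rfl
  have hfi : Function.Injective f := inj_of_An hq one_ne_zero (fun x => by rw [hf, one_mul])
  have hBA : An (qf B) := by
    by_contra hcon
    obtain ⟨x, hx, hx0⟩ := not_An.1 hcon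
    obtain ⟨ζ, _, Z, hZi, hζ, hZ⟩ := hB.half' ⟨x, hx, hx0⟩
    obtain ⟨v, u, hv, hvu⟩ := meet f Z hZi (by simp; omega)
    apply hv
    apply hq
    rw [← hf, hvu, qf_smul, hZ, mul_zero]
  have hBA' : An (qf (d • B)) := by
    intro x hx
    rw [qf_smul] at hx
    exact hBA x ((mul_eq_zero.1 hx).resolve_left hd)
  have hmapB : ∀ (K : Type) [Field K] (φ : F →+* K), (d • B).map φ = φ d • B.map φ := by
    intro K _ φ; ext; simp
  have hNDm : ∀ (K : Type) [Field K] (φ : F →+* K), ND (qf ((d • B).map φ)) := by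
    intro K _ φ
    rw [hmapB]
    exact nd_smul (hB.nd hBA K φ) (by simpa using hd)
  have hHm : ∀ (K : Type) [Field K] (φ : F →+* K), Half ((d • B).map φ) := by
    intro K _ φ
    rw [hmapB]
    exact half_smul (hB.half K φ) (by simpa using hd)
  have hND : ND (qf (d • B)) := nd_smul (hB.nd' hBA) hd
  have hMN : M + (n+2) = Fintype.card κ := by omega
  obtain ⟨m, qa, ⟨hqa, w, d0, E1, hE1⟩, -, w', d0', E2, hE2⟩ := hw
  have hqa' : An (qf qa) := fun x hx => hqa x (by rw [eval_eq]; exact hx)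
  obtain ⟨hqc, g, hg, hgf⟩ := compl h2 (d • B) hBA' hND q hq f hf qc hMN qa hqa'
    ((stdE F m w d0).symm.trans (E1.symm.trans ((spl F (n+2) T).trans ((LinearEquiv.refl F _).prodCongr e))))
    (fun y a b t => by
      obtain ⟨x, hx⟩ := (stdE F m w d0).surjective (y, (a, b), t)
      obtain ⟨v, rfl⟩ := E1.surjective x
      have := hE1 v
      rw [eval_eq, eval_eq, qf_std, hx, qf_orthSum', he] at this
      rw [← hx]
      simp only [LinearEquiv.trans_apply, LinearEquiv.symm_apply_apply]
      rw [this, qf_smul]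
      rfl)
    (E2.trans (stdE F m w' d0'))
    (fun x => by rw [← eval_eq, ← hE2, eval_eq, qf_std]; rfl)
  have hgi : Function.Injective g := inj_of_An hqc one_ne_zero (fun x => by rw [hg, one_mul])
  have hgz' := hgz hBA f hfi hf g hgi hg
  have h00 : q 0 0 ≠ 0 := by
    intro h
    have := hq (Pi.single 0 1) (by rw [qf_apply]; simp [Pi.single_apply, h])
    simpa using congrFun this 0
  have fm : ∀ (K : Type) [Field K] (φ : F →+* K), ∃ fK : (Fin (n+2) → K) →ₗ[K] (κ → K), Function.Injective fK ∧
      (∀ x, qf ((d • B).map φ) (fK x) = qf (q.map φ) x) ∧ ∃ gK : (Fin M → K) →ₗ[K] (κ → K),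
      (∀ x, qf ((d • B).map φ) (gK x) = qf (qc.map φ) x) ∧ ∀ x v, polar (qf ((d • B).map φ)) (gK x) (fK v) = 0 := by
    intro K _ φ
    refine ⟨lc (fun l => φ ∘ f (Pi.single l 1)), lc_inj_map φ _ (by rw [eq_lc]; exact hfi), fun x => ?_,
      lc (fun l => φ ∘ g (Pi.single l 1)), fun x => ?_, fun x v => ?_⟩
    · rw [qf_lc_map φ _ q (fun l => f (Pi.single l 1)) 1 (fun z => by rw [eq_lc, hf, one_mul])]; simp
    · rw [qf_lc_map φ _ qc (fun l => g (Pi.single l 1)) 1 (fun z => by rw [eq_lc, hg, one_mul])]; simp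
    · rw [polar_lc_map φ _ _ _ (fun _ _ => 0) (fun i j => hgf _ _)]; simp
  have h2K : ∀ (K : Type) [Field K] (φ : F →+* K), (2 : K) = 0 := fun K _ φ => by rw [← map_ofNat φ 2, h2, map_zero]
  have main : ∀ (K : Type) [Field K] (φ : F →+* K), An (qf (qc.map φ)) → (∃ x, x ≠ 0 ∧ qf (q.map φ) x = 0) →
      ∃ e : ((Fin M → K) × ((Fin (n+2-P) → K) × (Fin (n+2-P) → K))) ≃ₗ[K] (Fin (n+2) → K),
      ∀ y a b, qf (q.map φ) (e (y, (a, b))) = qf (qc.map φ) y + a ⬝ᵥ b := by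
    intro K _ φ hA hi
    obtain ⟨fK, hfKi, hfK, gK, hgK, hgfK⟩ := fm K φ
    exact over_K (h2K K φ) _ (hNDm K φ) (hHm K φ) (q.map φ) fK hfKi hfK (qc.map φ) hA gK hgK hgfK hMN hP hPN hi
  refine ⟨part1 h2 (d • B) hND q f hfi hf g hgi hgf hMN hP hty, ?_, ?_⟩
  · intro K _ _ hK
    obtain ⟨hA, hi⟩ := An_model q h00 qc hgz' K hK
    obtain ⟨eK, heK⟩ := main K (algebraMap F K) hA hi
    refine ⟨fun x hx => hA x (by rw [← eval_eq]; exact hx), n+2-P, 0, ?_⟩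
    exact isom_of_hs _ _ eK heK
  · have h1 : QF.i1 q = n + 2 - P := by
      have hlow : ∀ K : QF.FieldExt F, 0 < QF.i0 (QF.baseChange q K.carrier) → n + 2 - P ≤ QF.i0 (QF.baseChange q K.carrier) := by
        intro K hpos
        obtain ⟨fK, hfKi, hfK, -⟩ := fm K.carrier (algebraMap F K.carrier)
        refine i0_ge _ (hHm K.carrier (algebraMap F K.carrier)) _ fK hfKi hfK hP ?_
        by_contra hcon
        push Not at hcon
        have : QF.i0 (QF.baseChange q K.carrier) ≤ 0 := by
          refine csSup_le ⟨0, ⊥, by simp, fun x hx => ?_⟩ ?_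
          · rw [Submodule.mem_bot] at hx; rw [hx, eval_eq, map_zero]
          · rintro _ ⟨W, rfl, hW⟩
            have : W = ⊥ := by
              rw [Submodule.eq_bot_iff]
              intro x hx
              by_contra hx0
              exact hcon x hx0 (by rw [← eval_eq]; exact hW x hx)
            rw [this]; simp
        omega
      obtain ⟨K, _, φ, x, hx, hx1, -, hA⟩ := hgz'
      obtain ⟨eK, heK⟩ := main K φ hA ⟨x, fun h => by rw [h] at hx1; simp at hx1, hx⟩
      letI : Algebra F K := φ.toAlgebra
      have hle : QF.i0 (QF.baseChange q K) ≤ n + 2 - P := i0_le _ _ hA eK heK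
      have hge : n + 2 - P ≤ QF.i0 (QF.baseChange q K) := by
        obtain ⟨fK, hfKi, hfK, -⟩ := fm K φ
        exact i0_ge _ (hHm K φ) _ fK hfKi hfK hP ⟨x, fun h => by rw [h] at hx1; simp at hx1, hx⟩
      apply le_antisymm
      · refine Nat.sInf_le ⟨by omega, ⟨K⟩, le_antisymm hle hge⟩
      · refine le_csInf ⟨_, by omega, ⟨K⟩, le_antisymm hle hge⟩ ?_
        rintro _ ⟨hpos, K', rfl⟩
        exact hlow K' hpos
    rw [QF.izh, h1]; omega

end
end PN

namespace PN
open QuadraticMap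
set_option linter.all false
section
variable {F : Type} [Field F]

theorem final [CharP F 2] {N r s k M : ℕ}
    (q : QF F N) (hty : QF.HasType q r s) (haniso : QF.Anisotropic q)
    (hk : 2 ^ k < N) (hk' : N ≤ 2 ^ k * 2)
    (π : QF F (2 ^ k * 2)) (hπ : QF.IsGenPfister k π) (hdom : QF.Dominated q π)
    (qc : QF F M) (hqc : QF.IsComplement q π qc) :
    r + s ≤ 2 ^ k ∧
    (∀ (K : Type) [Field K] [Algebra F K], QF.IsFunctionField q K →
      QF.IsAnisotropicPart (QF.baseChange q K) (QF.baseChange qc K)) ∧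
    QF.izh q = 2 ^ k := by
  have h2 : (2:F) = 0 := by simpa using CharP.cast_eq_zero F 2
  have hpos : 1 ≤ 2 ^ k := Nat.one_le_two_pow
  obtain ⟨n, rfl⟩ : ∃ n, N = n + 2 := ⟨N - 2, by omega⟩
  have hq : An (qf q) := fun x hx => haniso x (by rw [eval_eq]; exact hx)
  obtain ⟨d, hd, a, c, e0, he0⟩ := hπ
  obtain ⟨f0, -, hf0⟩ := hdom
  obtain ⟨hM, -, hw⟩ := hqc
  have hf0' : ∀ x, qf π (f0 x) = qf q x := fun x => by rw [← eval_eq, hf0, eval_eq]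
  cases k with
  | zero =>
    obtain ⟨ι, _, A, e, hA, h⟩ := pf_exists h2 0 a c
    obtain ⟨e', he'⟩ := qPfister_eval a c A e h
    refine core h2 A hA hd (P := 2 ^ 0) ?_ q hty hq hk hk' π
      (e0.trans (LinearEquiv.funCongrLeft F F e')) (fun x => ?_) f0 hf0' qc hM hw ?_
    · rw [Fintype.card_congr e']; simp
    · rw [← eval_eq, ← he0, eval_eq, qf_smul, he']; rfl
    · intro _ f _ _ g _ _
      have : M = 0 := by simp at hM; omega
      subst this
      exact gz_zero q hq qc
  | succ k =>
    obtain ⟨ι, _, A, e, hA, h⟩ := pf_exists h2 k (Fin.tail a) c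
    obtain ⟨e', he'⟩ := qPfister_eval a c (dbl A (a 0)) (splitEquiv e) (pfm_split e a c A h)
    have hc : Fintype.card ι = 2 ^ (k+1) := by
      rw [Fintype.card_congr e]; simp [pow_succ]
    refine core h2 (dbl A (a 0)) (hA.dbl _) hd (P := 2 ^ (k+1)) ?_ q hty hq hk hk' π
      (e0.trans (LinearEquiv.funCongrLeft F F e')) (fun x => ?_) f0 hf0' qc hM hw ?_
    · rw [Fintype.card_congr e']; simp
    · rw [← eval_eq, ← he0, eval_eq, qf_smul, he']; rfl
    · intro hB f hfi hf g hgi hg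
      have ef := eq_lc f
      have eg := eq_lc g
      rw [← ef] at hfi hf
      rw [← eg] at hgi hg
      refine gz_succ h2 hA hB q qc (by omega) (by omega) (inv_ne_zero hd) _ hfi (fun z => ?_) _ hgi (fun z => ?_)
      · rw [← hf, qf_smul, inv_mul_cancel_left₀ hd]
      · rw [← hg, qf_smul, inv_mul_cancel_left₀ hd]
end
end PN

/-- Lemma 2.13: let `φ` be an anisotropic quadratic form of type `(r, s)`
over a field `F` of characteristic 2, with `2 ^ k < dim φ ≤ 2 ^ (k + 1)`.  If `φ` is a
Pfister neighbour with ambient general Pfister form `π` and complementary form `φ^c`,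
then (1) `r + s ≤ 2 ^ k`; (2) `φ₁ ≅ (φ^c)_{F(φ)}`, i.e. over any model `K` of `F(φ)` the
base change of `φ^c` is the anisotropic part of `φ_K`; (3) `φ` has maximal splitting,
i.e. `dim_Izh(φ) = 2 ^ k`. -/
theorem statement4 (F : Type) [Field F] [CharP F 2] {N r s k M : ℕ}
    (q : QF F N) (hty : QF.HasType q r s) (haniso : QF.Anisotropic q)
    (hk : 2 ^ k < N) (hk' : N ≤ 2 ^ k * 2)
    (π : QF F (2 ^ k * 2)) (hπ : QF.IsGenPfister k π) (hdom : QF.Dominated q π)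
    (qc : QF F M) (hqc : QF.IsComplement q π qc) :
    r + s ≤ 2 ^ k ∧
    (∀ (K : Type) [Field K] [Algebra F K], QF.IsFunctionField q K →
      QF.IsAnisotropicPart (QF.baseChange q K) (QF.baseChange qc K)) ∧
    QF.izh q = 2 ^ k := by
  exact PN.final q hty haniso hk hk' π hπ hdom qc hqc
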